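/- arXiv:1909.00263 — 7 statements merged into one kernel-verified Lean document; each statement's English description precedes it below -/
import Mathlib

section
/- Shortest homotopic curves are invariant under affine transformations: let P ⊂ ℝ² be a finite set of point obstacles, let γ be a piecewise-linear loop whose image is disjoint from P, let δ be a piecewise-linear loop of minimal length among all piecewise-linear loops homotopic rel P in the extended sense to γ, and let T : ℝ² → ℝ² be an invertible affine map. Then T∘δ has minimal length among all piecewise-linear loops homotopic rel T(P) in the extended sense to T∘γ. -/
/-!
Statement 3: shortest homotopic curves are invariant under invertible affine
transformations.
-/

/-!
Statement 0: existence of a shortest piecewise-linear loop homotopic rel `P`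
(in the extended sense) to a given piecewise-linear loop avoiding `P`.
-/

noncomputable section

/-- The Euclidean plane. -/
abbrev Pt : Type := EuclideanSpace ℝ (Fin 2)

/-- A piecewise-linear loop, given by a cyclic sequence of `m ≥ 1` vertices. -/
structure PLLoop where
  m : ℕ
  m_pos : 0 < m
  v : ZMod m → Pt

/-- The standard 1-periodic parametrization of a piecewise-linear loop: on the
interval `[i/m, (i+1)/m]` it traverses the straight segment from `v i` to `v (i+1)`. -/
def PLLoop.toFun (γ : PLLoop) : ℝ → Pt := fun t =>
  let x : ℝ := Int.fract t * γ.m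
  let i : ℤ := ⌊x⌋
  (1 - (x - (i : ℝ))) • γ.v (i : ZMod γ.m) + (x - (i : ℝ)) • γ.v ((i + 1 : ℤ) : ZMod γ.m)

/-- The length of a piecewise-linear loop: the sum of the Euclidean lengths of
its segments. -/
def PLLoop.length (γ : PLLoop) : ℝ :=
  ∑ i ∈ Finset.range γ.m, dist (γ.v (i : ZMod γ.m)) (γ.v ((i : ZMod γ.m) + 1))

/-- The image of a piecewise-linear loop in the plane. -/
def PLLoop.image (γ : PLLoop) : Set Pt := Set.range γ.toFun

/-- `γ` (avoiding `P`) is homotopic rel `P` in the extended sense to `δ` (which may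
meet `P`): there is a continuous `H` on `[0,1] × S¹` (given here via 1-periodic maps
in the second variable) with `H(0,·) = γ`, `H(1,·) = δ`, and the image of `H(t,·)`
disjoint from `P` for every `t < 1`. -/
def HomotopicRelExt (P : Set Pt) (γ δ : PLLoop) : Prop :=
  ∃ H : ℝ × ℝ → Pt, Continuous H ∧
    (∀ s : ℝ, H (0, s) = γ.toFun s) ∧
    (∀ s : ℝ, H (1, s) = δ.toFun s) ∧
    (∀ t s : ℝ, H (t, s + 1) = H (t, s)) ∧
    (∀ t s : ℝ, 0 ≤ t → t < 1 → H (t, s) ∉ P)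



/-- The image of a piecewise-linear loop under the invertible affine map
`x ↦ A x + b`, obtained by applying the map to each vertex. -/
def PLLoop.affMap (A : Pt ≃ₗ[ℝ] Pt) (b : Pt) (γ : PLLoop) : PLLoop :=
  ⟨γ.m, γ.m_pos, fun i => A (γ.v i) + b⟩

open CategoryTheory Set Filter Topology

section ConvexPaths

variable {E : Type} [NormedAddCommGroup E] [NormedSpace ℝ E]

/-- The straight segment between two points of a convex set, as a path in that set. -/
def Convex.segmentPath {V : Set E} (hV : Convex ℝ V) (a b : V) : Path a b where
  toFun u := ⟨(1 - (u : ℝ)) • (a : E) + (u : ℝ) • (b : E),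
    hV a.2 b.2 (by linarith [u.2.2]) u.2.1 (by ring)⟩
  continuous_toFun := by fun_prop
  source' := by ext; simp
  target' := by ext; simp

/-- Two paths with the same end points which stay in a convex subset are homotopic. -/
theorem Path.homotopic_of_mem_convex {U V : Set E} (hV : Convex ℝ V) (hVU : V ⊆ U) {x y : U}
    (p q : Path x y) (hp : ∀ t, (p t : E) ∈ V) (hq : ∀ t, (q t : E) ∈ V) : p.Homotopic q := by
  refine ⟨⟨⟨⟨fun z => ⟨(1 - (z.1 : ℝ)) • (p z.2 : E) + (z.1 : ℝ) • (q z.2 : E),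
    hVU (hV (hp _) (hq _) (by linarith [z.1.2.2]) z.1.2.1 (by ring))⟩, by fun_prop⟩, ?_, ?_⟩, ?_⟩⟩
  · intro u; ext; simp
  · intro u; ext; simp
  · rintro t u (rfl | rfl)
    · ext; simp [← add_smul]
    · ext; simp [← add_smul]

/-- The class in the fundamental groupoid of `U` of the image of a segment under a map from a
convex set to `U`. -/
def Convex.segmentHom {X : Type} [TopologicalSpace X] {V : Set E} (hV : Convex ℝ V) (g : C(V, X))
    (a b : V) : FundamentalGroupoid.mk (g a) ⟶ FundamentalGroupoid.mk (g b) :=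
  FundamentalGroupoid.fromPath (Path.Homotopic.Quotient.mk ((hV.segmentPath a b).map g.continuous))

theorem Convex.segmentHom_comp {X : Type} [TopologicalSpace X] {V : Set E} (hV : Convex ℝ V)
    (g : C(V, X)) (a b c : V) :
    hV.segmentHom g a b ≫ hV.segmentHom g b c = hV.segmentHom g a c := by
  have h : ((hV.segmentPath a b).trans (hV.segmentPath b c)).Homotopic (hV.segmentPath a c) :=
    Path.homotopic_of_mem_convex hV subset_rfl _ _ (fun t => Subtype.coe_prop _)
      (fun t => Subtype.coe_prop _)
  have h2 := h.map g
  rw [Path.map_trans] at h2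
  exact Quotient.sound h2

end ConvexPaths

/-- A groupoid with a chosen tree of arrows from a base point to the points of `S` maps to the
vertex group at the base point. -/
theorem CategoryTheory.Groupoid.exists_vertexGroup_cocycle {C : Type} [Groupoid.{0} C] (c : C)
    (S : C → Prop) (e : ∀ x, S x → (c ⟶ x)) :
    ∃ Φ : ∀ {x y : C}, (x ⟶ y) → (c ⟶ c),
      (∀ {x y z : C} (q : x ⟶ y) (r : y ⟶ z), Φ (q ≫ r) = Φ q * Φ r) ∧
      ∀ {x y : C} (hx : S x) (hy : S y) (q : x ⟶ y), Φ q ≫ e y hy = e x hx ≫ q := by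
  classical
  let τ : ∀ x, Nonempty (c ⟶ x) → (c ⟶ x) := fun x h =>
    if hx : S x then e x hx else h.some
  refine ⟨fun {x y} q => if h : Nonempty (c ⟶ x) then
    τ x h ≫ q ≫ inv (τ y ⟨h.some ≫ q⟩) else 1, ?_, ?_⟩
  · intro x y z q r
    by_cases h : Nonempty (c ⟶ x)
    · have h' : Nonempty (c ⟶ y) := ⟨h.some ≫ q⟩
      simp [h, h', Groupoid.vertexGroup_mul]
    · have h' : ¬ Nonempty (c ⟶ y) := fun h' => h ⟨h'.some ≫ inv q⟩
      simp only [h, h', dite_false, mul_one]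
  · intro x y hx hy q
    have h : Nonempty (c ⟶ x) := ⟨e x hx⟩
    simp [h, τ, hx, hy]

/-- A group-valued transition function on a set `U`: it is multiplicative on convex pieces of
`U`, trivial on `S`, and triviality of its continuation along an arc with end points in `S` detects
that the arc can be straightened inside `U`. -/
structure TransitionSystem (U S : Set Pt) where
  G : Type
  [group : Group G]
  w : Pt → Pt → G
  w_mul : ∀ V ⊆ U, Convex ℝ V → ∀ x ∈ V, ∀ y ∈ V, ∀ z ∈ V, w x y * w y z = w x z
  w_eq_one : ∀ x ∈ S, ∀ y ∈ S, w x y = 1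
  exists_lift : ∀ α : ℝ → Pt, Continuous α → ∀ x y : ℝ, x ≤ y → (∀ s ∈ Icc x y, α s ∈ U) →
    ∃ L : ℝ → G, L x = 1 ∧
      (∀ s ∈ Icc x y, ∀ᶠ s' in 𝓝[Icc x y] s, L s' = L s * w (α s) (α s')) ∧
      (α x ∈ S → α y ∈ S → L y = 1 → ∃ K : ℝ × ℝ → Pt, Continuous K ∧ (∀ z, K z ∈ U) ∧
        (∀ u ∈ Icc (0 : ℝ) 1, K (0, u) = α (x + u * (y - x))) ∧
        (∀ u ∈ Icc (0 : ℝ) 1, K (1, u) = (1 - u) • α x + u • α y) ∧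
        (∀ t, K (t, 0) = α x) ∧ (∀ t, K (t, 1) = α y))

attribute [instance] TransitionSystem.group

theorem exists_transitionSystem {U S : Set Pt} (hU : IsOpen U) (hS : Convex ℝ S) (hSU : S ⊆ U)
    (p₀ : Pt) (hp₀ : p₀ ∈ S) : Nonempty (TransitionSystem U S) := by
  classical
  let c : FundamentalGroupoid U := .mk ⟨p₀, hSU hp₀⟩
  let inc : ∀ V : Set Pt, V ⊆ U → C(V, U) := fun V h => ⟨Set.inclusion h, continuous_inclusion h⟩
  obtain ⟨Φ, hΦ, hΦS⟩ := CategoryTheory.Groupoid.exists_vertexGroup_cocycle c (fun x => x.as.1 ∈ S)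
    (fun x hx => hS.segmentHom (inc S hSU) ⟨p₀, hp₀⟩ ⟨x.as.1, hx⟩)
  have hΦS1 : ∀ x (hx : x ∈ S) y (hy : y ∈ S),
      Φ (hS.segmentHom (inc S hSU) ⟨x, hx⟩ ⟨y, hy⟩) = 1 := by
    intro x hx y hy
    have h := hΦS (x := .mk ⟨x, hSU hx⟩) (y := .mk ⟨y, hSU hy⟩) hx hy
      (hS.segmentHom (inc S hSU) ⟨x, hx⟩ ⟨y, hy⟩)
    have h' : _ = 𝟙 c ≫ _ := (h.trans (hS.segmentHom_comp (inc S hSU) ⟨p₀, hp₀⟩ ⟨x, hx⟩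
      ⟨y, hy⟩)).trans (Category.id_comp _).symm
    exact (cancel_mono _).1 h'
  let w : Pt → Pt → (c ⟶ c) := fun x y =>
    if h : segment ℝ x y ⊆ U then Φ ((convex_segment x y).segmentHom (inc _ h)
      ⟨x, left_mem_segment _ _ _⟩ ⟨y, right_mem_segment _ _ _⟩) else 1
  have hw : ∀ (V : Set Pt) (h : V ⊆ U) (hV : Convex ℝ V) x (hx : x ∈ V) y (hy : y ∈ V),
      w x y = Φ (hV.segmentHom (inc V h) ⟨x, hx⟩ ⟨y, hy⟩) := by
    intro V h hV x hx y hy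
    have := (hV.segment_subset hx hy).trans h
    simp only [w, dif_pos this]
    rfl
  refine ⟨⟨c ⟶ c, w, ?_, ?_, ?_⟩⟩
  · intro V hVU hV x hx y hy z hz
    rw [hw V hVU hV x hx y hy, hw V hVU hV y hy z hz, hw V hVU hV x hx z hz, ← hΦ,
      Convex.segmentHom_comp]
  · intro x hx y hy
    rw [hw S hSU hS x hx y hy, hΦS1]
  · intro α hα x y hxy hmem
    let g : C(Icc x y, U) := ⟨fun s => ⟨α s, hmem s s.2⟩, by fun_prop⟩
    have hI : Convex ℝ (Icc x y) := convex_Icc x y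
    have hx : x ∈ Icc x y := left_mem_Icc.2 hxy
    have hy : y ∈ Icc x y := right_mem_Icc.2 hxy
    refine ⟨fun s => if h : s ∈ Icc x y then Φ (hI.segmentHom g ⟨x, hx⟩ ⟨s, h⟩) else 1, ?_, ?_, ?_⟩
    · simp only [dif_pos hx]
      have := hΦ (hI.segmentHom g ⟨x, hx⟩ ⟨x, hx⟩) (hI.segmentHom g ⟨x, hx⟩ ⟨x, hx⟩)
      rw [Convex.segmentHom_comp] at this
      exact left_eq_mul.1 this
    · intro s hs
      obtain ⟨r, hr, hrU⟩ := Metric.isOpen_iff.1 hU (α s) (hmem s hs)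
      obtain ⟨d, hd, hdr⟩ := Metric.continuous_iff.1 hα s r hr
      filter_upwards [self_mem_nhdsWithin, mem_nhdsWithin_of_mem_nhds (Metric.ball_mem_nhds s hd)]
        with s' hs' hss'
      simp only [dif_pos hs, dif_pos hs']
      have hball : α s' ∈ Metric.ball (α s) r := hdr s' hss'
      rw [hw _ hrU (convex_ball _ _) _ (Metric.mem_ball_self hr) _ hball,
        ← Convex.segmentHom_comp hI g ⟨x, hx⟩ ⟨s, hs⟩ ⟨s', hs'⟩, hΦ]
      congr 2
      refine Quotient.sound (Path.homotopic_of_mem_convex (convex_ball (α s) r) hrU _ _ ?_ ?_)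
      · intro u
        refine hdr _ ?_
        exact ((convex_ball s d) (Metric.mem_ball_self hd) hss' (by linarith [u.2.2]) u.2.1
          (by ring) : (1 - (u : ℝ)) • s + (u : ℝ) • s' ∈ Metric.ball s d)
      · intro u
        exact (convex_ball (α s) r) (Metric.mem_ball_self hr) hball (by linarith [u.2.2]) u.2.1
          (by ring)
    · intro hxS hyS h1
      simp only [dif_pos hy] at h1
      have h2 := h1.trans (hΦS1 _ hxS _ hyS).symm
      have h3 := hΦS (x := .mk ⟨α x, hSU hxS⟩) (y := .mk ⟨α y, hSU hyS⟩) hxS hyS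
        (hI.segmentHom g ⟨x, hx⟩ ⟨y, hy⟩)
      have h4 := hΦS (x := .mk ⟨α x, hSU hxS⟩) (y := .mk ⟨α y, hSU hyS⟩) hxS hyS
        (hS.segmentHom (inc S hSU) ⟨α x, hxS⟩ ⟨α y, hyS⟩)
      have h5 := (h3.symm.trans (congrArg (· ≫ _) h2)).trans h4
      rw [cancel_epi] at h5
      obtain ⟨K⟩ := Quotient.exact h5
      refine ⟨fun z => K (projIcc 0 1 zero_le_one z.1, projIcc 0 1 zero_le_one z.2), ?_, ?_, ?_, ?_,
        ?_, ?_⟩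
      · have := continuous_projIcc (a := (0 : ℝ)) (b := 1) (h := zero_le_one)
        fun_prop
      · exact fun z => Subtype.coe_prop _
      · intro u hu
        have h6 := congrArg Subtype.val (K.apply_zero (projIcc 0 1 zero_le_one u))
        simp only [projIcc_left]
        refine h6.trans ?_
        simp only [projIcc_of_mem _ hu]
        change α ((1 - u) • x + u • y) = _
        simp only [smul_eq_mul]
        ring_nf
      · intro u hu
        have h6 := congrArg Subtype.val (K.apply_one (projIcc 0 1 zero_le_one u))
        simp only [projIcc_right]
        refine h6.trans ?_
        simp only [projIcc_of_mem _ hu]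
        rfl
      · intro t
        simp only [projIcc_left]
        exact congrArg Subtype.val (K.source _)
      · intro t
        simp only [projIcc_right]
        exact congrArg Subtype.val (K.target _)

theorem eq_of_eventually_eq_on_Icc {X : Type} (D : ℝ → X) {x y : ℝ} (hxy : x ≤ y)
    (h : ∀ s ∈ Icc x y, ∀ᶠ s' in 𝓝[Icc x y] s, D s' = D s) : D x = D y := by
  let _ : TopologicalSpace X := ⊥
  have _ : DiscreteTopology X := ⟨rfl⟩
  refine isPreconnected_Icc.constant (f := D) ?_ (left_mem_Icc.2 hxy) (right_mem_Icc.2 hxy)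
  intro s hs
  exact tendsto_nhds_of_eventually_eq (h s hs)

section Lifts

variable {G : Type} [Group G]

/-- The transition function `w` is multiplicative on `V`. -/
def CocycleOn (w : Pt → Pt → G) (V : Set Pt) : Prop :=
  ∀ a ∈ V, ∀ b ∈ V, ∀ c ∈ V, w a b * w b c = w a c

/-- `F` continues the transition function `w` along the curve `α` on `[0, ∞)`. -/
def IsLift (w : Pt → Pt → G) (α : ℝ → Pt) (F : ℝ → G) : Prop :=
  ∀ s, 0 ≤ s → ∀ᶠ s' in 𝓝[Ici 0] s, F s' = F s * w (α s) (α s')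

theorem exists_uniform_cocycle {P : Set Pt} {w : Pt → Pt → G}
    (hw : ∀ x, x ∉ P → ∃ V, IsOpen V ∧ x ∈ V ∧ CocycleOn w V)
    {H : ℝ × ℝ → Pt} (hH : Continuous H) (hper : ∀ t s, H (t, s + 1) = H (t, s))
    (hav : ∀ t s, 0 ≤ t → t ≤ 1 → H (t, s) ∉ P) :
    ∃ h > 0, ∀ t s, 0 ≤ t → t ≤ 1 → ∃ V, CocycleOn w V ∧
      ∀ t' s', |t' - t| < h → |s' - s| < h → H (t', s') ∈ V := by
  obtain ⟨h, hh, hV⟩ := lebesgue_number_lemma_of_metric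
    (s := Icc (0 : ℝ) 1 ×ˢ Icc (0 : ℝ) 1) (ι := {V : Set Pt // IsOpen V ∧ CocycleOn w V})
    (c := fun V => H ⁻¹' V.1) (isCompact_Icc.prod isCompact_Icc)
    (fun V => V.2.1.preimage hH) (by
      rintro ⟨t, s⟩ ⟨ht, -⟩
      obtain ⟨V, hVo, hxV, hc⟩ := hw _ (hav t s ht.1 ht.2)
      exact mem_iUnion.2 ⟨⟨V, hVo, hc⟩, hxV⟩)
  refine ⟨h, hh, fun t s ht0 ht1 => ?_⟩
  obtain ⟨V, hsub⟩ := hV (t, Int.fract s)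
    ⟨⟨ht0, ht1⟩, ⟨Int.fract_nonneg s, (Int.fract_lt_one s).le⟩⟩
  refine ⟨V.1, V.2.2, fun t' s' ht' hs' => ?_⟩
  have hp : Function.Periodic (fun s => H (t', s)) 1 := hper t'
  have h1 : H (t', s') = H (t', s' - ⌊s⌋) := by
    have := hp.sub_zsmul_eq (x := s') ⌊s⌋
    simp only [zsmul_eq_mul, mul_one] at this
    exact this.symm
  rw [h1]
  apply hsub
  rw [Metric.mem_ball, Prod.dist_eq, max_lt_iff, Real.dist_eq, Real.dist_eq]
  refine ⟨ht', ?_⟩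
  have : s' - ⌊s⌋ - Int.fract s = s' - s := by rw [Int.fract]; ring
  rwa [this]

theorem exists_isLift {w : Pt → Pt → G} {α : ℝ → Pt} {h : ℝ} (hh : 0 < h)
    (hc : ∀ s, ∃ V, CocycleOn w V ∧ ∀ s', |s' - s| < h → α s' ∈ V) : ∃ F, IsLift w α F := by
  obtain ⟨d, hd⟩ : ∃ d, d = h / 2 := ⟨_, rfl⟩
  have hd0 : 0 < d := by linarith
  let B : ℕ → G := fun n => Nat.rec 1 (fun n b => b * w (α (n * d)) (α ((n + 1 : ℕ) * d))) n
  have hB : ∀ n : ℕ, B (n + 1) = B n * w (α (n * d)) (α ((n + 1 : ℕ) * d)) := fun n => rfl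
  have hfl : ∀ s : ℝ, 0 ≤ s → (⌊s / d⌋₊ : ℝ) * d ≤ s ∧ s < (⌊s / d⌋₊ : ℝ) * d + d := by
    intro s hs
    have h1 := Nat.floor_le (div_nonneg hs hd0.le)
    have h2 := Nat.lt_floor_add_one (s / d)
    rw [le_div_iff₀ hd0] at h1
    rw [div_lt_iff₀ hd0] at h2
    exact ⟨h1, by linarith⟩
  refine ⟨fun s => B ⌊s / d⌋₊ * w (α (⌊s / d⌋₊ * d)) (α s), fun s hs => ?_⟩
  filter_upwards [self_mem_nhdsWithin, mem_nhdsWithin_of_mem_nhds (Metric.ball_mem_nhds s hd0)]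
    with s' hs' hss'
  rw [Metric.mem_ball, Real.dist_eq, abs_lt] at hss'
  rw [mem_Ici] at hs'
  obtain ⟨V, hV, hαV⟩ := hc s
  obtain ⟨a1, a2⟩ := hfl s hs
  obtain ⟨b1, b2⟩ := hfl s' hs'
  generalize ⌊s / d⌋₊ = n at *
  generalize ⌊s' / d⌋₊ = n' at *
  have m1 : α s ∈ V := hαV _ (by rw [abs_lt]; constructor <;> linarith)
  have m2 : α s' ∈ V := hαV _ (by rw [abs_lt]; constructor <;> linarith)
  have m3 : α (n * d) ∈ V := hαV _ (by rw [abs_lt]; constructor <;> linarith)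
  have m4 : α (n' * d) ∈ V := hαV _ (by rw [abs_lt]; constructor <;> linarith)
  have hn1 : n' ≤ n + 1 := by
    by_contra hcon
    have : (n : ℝ) + 2 ≤ n' := by exact_mod_cast (by omega : n + 2 ≤ n')
    nlinarith
  have hn2 : n ≤ n' + 1 := by
    by_contra hcon
    have : (n' : ℝ) + 2 ≤ n := by exact_mod_cast (by omega : n' + 2 ≤ n)
    nlinarith
  obtain rfl | rfl | rfl : n' = n ∨ n' = n + 1 ∨ n = n' + 1 := by omega
  · rw [mul_assoc, hV _ m3 _ m1 _ m2]
  · rw [hB, mul_assoc, mul_assoc, hV _ m3 _ m4 _ m2, hV _ m3 _ m1 _ m2]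
  · rw [hB, mul_assoc, mul_assoc, hV _ m3 _ m1 _ m2, hV _ m4 _ m3 _ m2]

/-- The displacements `F 0 ⁻¹ * F k` of two lifts agree up to conjugation by a fixed element. -/
def ConjDisplacement (F F' : ℝ → G) : Prop :=
  ∃ u : G, ∀ k : ℕ, (F 0)⁻¹ * F k = u * ((F' 0)⁻¹ * F' k) * u⁻¹

theorem ConjDisplacement.trans {F F' F'' : ℝ → G} (h : ConjDisplacement F F')
    (h' : ConjDisplacement F' F'') : ConjDisplacement F F'' := by
  obtain ⟨u, hu⟩ := h
  obtain ⟨v, hv⟩ := h'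
  exact ⟨u * v, fun k => by rw [hu, hv]; group⟩

theorem ConjDisplacement.symm {F F' : ℝ → G} (h : ConjDisplacement F F') :
    ConjDisplacement F' F := by
  obtain ⟨u, hu⟩ := h
  exact ⟨u⁻¹, fun k => by rw [hu]; group⟩

theorem conjDisplacement_of_close {w : Pt → Pt → G} {α β : ℝ → Pt} (hα : ∀ s, α (s + 1) = α s)
    (hβ : ∀ s, β (s + 1) = β s) {h : ℝ} (hh : 0 < h)
    (hc : ∀ s, ∃ V, CocycleOn w V ∧ ∀ s', |s' - s| < h → α s' ∈ V ∧ β s' ∈ V)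
    {F F' : ℝ → G} (hF : IsLift w α F) (hF' : IsLift w β F') : ConjDisplacement F F' := by
  refine ⟨w (α 0) (β 0), fun k => ?_⟩
  have hαk : α k = α 0 := by
    have := (show Function.Periodic α 1 from hα).nat_mul k 0
    simpa using this
  have hβk : β k = β 0 := by
    have := (show Function.Periodic β 1 from hβ).nat_mul k 0
    simpa using this
  have key := eq_of_eventually_eq_on_Icc (fun s => F s * w (α s) (β s) * (F' s)⁻¹)
    (x := 0) (y := k) (Nat.cast_nonneg k) (by
      intro s hs
      obtain ⟨V, hV, hm⟩ := hc s
      have hsub : Icc (0 : ℝ) k ⊆ Ici 0 := fun x hx => hx.1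
      filter_upwards [mem_nhdsWithin_of_mem_nhds (Metric.ball_mem_nhds s hh),
        nhdsWithin_mono _ hsub (hF s hs.1), nhdsWithin_mono _ hsub (hF' s hs.1)] with s' h1 h2 h3
      obtain ⟨m1, m2⟩ := hm s (by simpa using hh)
      obtain ⟨m3, m4⟩ := hm s' h1
      have e1 : w (α s) (α s') * w (α s') (β s') = w (α s) (β s) * w (β s) (β s') := by
        rw [hV _ m1 _ m3 _ m4, hV _ m1 _ m2 _ m4]
      rw [h2, h3, mul_inv_rev, mul_assoc (F s), e1]
      group)
  simp only [hαk, hβk] at key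
  have e : F k = F 0 * w (α 0) (β 0) * (F' 0)⁻¹ * (F' k) * (w (α 0) (β 0))⁻¹ := by
    rw [key]; group
  rw [e]; group

theorem conjDisplacement_of_homotopy {P : Set Pt} {w : Pt → Pt → G}
    (hw : ∀ x, x ∉ P → ∃ V, IsOpen V ∧ x ∈ V ∧ CocycleOn w V)
    {H : ℝ × ℝ → Pt} (hH : Continuous H) (hper : ∀ t s, H (t, s + 1) = H (t, s))
    (hav : ∀ t s, 0 ≤ t → t ≤ 1 → H (t, s) ∉ P) {F F' : ℝ → G}
    (hF : IsLift w (fun s => H (0, s)) F) (hF' : IsLift w (fun s => H (1, s)) F') :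
    ConjDisplacement F F' := by
  obtain ⟨h, hh, hV⟩ := exists_uniform_cocycle hw hH hper hav
  have hclose : ∀ t t', 0 ≤ t → t ≤ 1 → |t' - t| < h → ∀ F F' : ℝ → G,
      IsLift w (fun s => H (t, s)) F → IsLift w (fun s => H (t', s)) F' →
      ConjDisplacement F F' := by
    intro t t' h0 h1 htt' F F' hF hF'
    refine conjDisplacement_of_close (hper t) (hper t') hh (fun s => ?_) hF hF'
    obtain ⟨V, hc, hm⟩ := hV t s h0 h1
    exact ⟨V, hc, fun s' hs' => ⟨hm _ _ (by simpa using hh) hs', hm _ _ htt' hs'⟩⟩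
  obtain ⟨n, hn⟩ := exists_nat_one_div_lt hh
  have hn0 : (0 : ℝ) < (n : ℝ) + 1 := by positivity
  have main : ∀ j : ℕ, j ≤ n + 1 → ∀ F' : ℝ → G,
      IsLift w (fun s => H (j / ((n : ℝ) + 1), s)) F' → ConjDisplacement F F' := by
    intro j
    induction j with
    | zero =>
      intro _ F' hF'
      refine hclose 0 0 le_rfl zero_le_one (by simpa using hh) F F' hF ?_
      simpa using hF'
    | succ j ih =>
      intro hj F' hF'
      have h0 : 0 ≤ (j : ℝ) / ((n : ℝ) + 1) := by positivity
      have h1 : (j : ℝ) / ((n : ℝ) + 1) ≤ 1 := by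
        rw [div_le_one hn0]
        exact_mod_cast (by omega : j ≤ n + 1)
      obtain ⟨F₁, hF₁⟩ := exists_isLift (w := w) (α := fun s => H (j / ((n : ℝ) + 1), s)) hh
        (fun s => by
          obtain ⟨V, hc, hm⟩ := hV _ s h0 h1
          exact ⟨V, hc, fun s' hs' => hm _ _ (by simpa using hh) hs'⟩)
      refine (ih (by omega) F₁ hF₁).trans (hclose _ _ h0 h1 ?_ F₁ F' hF₁ hF')
      rw [← sub_div]
      push_cast
      rw [add_sub_cancel_left, abs_of_pos (by positivity)]
      exact hn
  refine main (n + 1) le_rfl F' ?_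
  have : (((n + 1 : ℕ) : ℝ)) / ((n : ℝ) + 1) = 1 := by push_cast; exact div_self hn0.ne'
  rwa [this]

end Lifts

section Sides

open Monoid

/-- The signed height of `x` above the line `f = c`, seen from the side `b`. -/
def sideHeight (f : Pt →L[ℝ] ℝ) (c : ℝ) (b : Bool) (x : Pt) : ℝ := if b then f x - c else c - f x

/-- The thickened half plane on the side `b` of the line `f = c`, with `P` removed. -/
def sideSet (P : Set Pt) (f : Pt →L[ℝ] ℝ) (c r : ℝ) (b : Bool) : Set Pt :=
  {x | x ∉ P ∧ -r < sideHeight f c b x}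

/-- The open strip around the line `f = c`. -/
def strip (f : Pt →L[ℝ] ℝ) (c r : ℝ) : Set Pt := {x | |f x - c| < r}

variable {P : Set Pt} {f : Pt →L[ℝ] ℝ} {c r : ℝ}

theorem continuous_sideHeight (b : Bool) : Continuous (sideHeight f c b) := by
  cases b
  · exact continuous_const.sub f.continuous
  · exact f.continuous.sub continuous_const

theorem isOpen_sideSet (hP : P.Finite) (b : Bool) : IsOpen (sideSet P f c r b) :=
  hP.isClosed.isOpen_compl.inter (isOpen_lt continuous_const (continuous_sideHeight b))

theorem convex_strip : Convex ℝ (strip f c r) := by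
  have : strip f c r = f ⁻¹' (Metric.ball c r) := by
    ext x; simp [strip, Real.dist_eq]
  rw [this]
  exact (convex_ball c r).linear_preimage f.toLinearMap

theorem strip_subset_sideSet (hr : ∀ p ∈ P, r ≤ |f p - c|) (b : Bool) :
    strip f c r ⊆ sideSet P f c r b := by
  intro x hx
  have hx' : |f x - c| < r := hx
  refine ⟨fun hp => absurd (hr x hp) (not_le.2 hx'), ?_⟩
  rw [abs_lt] at hx'
  cases b <;> simp [sideHeight] <;> linarith

theorem mem_strip_of_mem_sideSet {x : Pt} (b : Bool) (h : x ∈ sideSet P f c r b)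
    (h' : x ∈ sideSet P f c r (!b)) : x ∈ strip f c r := by
  have h1 := h.2
  have h2 := h'.2
  change |f x - c| < r
  rw [abs_lt]
  cases b <;> simp [sideHeight] at h1 h2 <;> constructor <;> linarith

variable (T : ∀ b, TransitionSystem (sideSet P f c r b) (strip f c r))

open Classical in
/-- The transition function with values in the free product obtained by gluing the transition
functions on the two sides of a line. -/
def gluedTransition (x y : Pt) : CoprodI fun b => (T b).G :=
  if x ∈ sideSet P f c r true ∧ y ∈ sideSet P f c r true then
    CoprodI.of (i := true) ((T true).w x y) else CoprodI.of (i := false) ((T false).w x y)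

theorem gluedTransition_eq {b : Bool} {x y : Pt} (hx : x ∈ sideSet P f c r b)
    (hy : y ∈ sideSet P f c r b) :
    gluedTransition T x y = CoprodI.of (i := b) ((T b).w x y) := by
  cases b
  · unfold gluedTransition
    split_ifs with h
    · have hxs := mem_strip_of_mem_sideSet true h.1 hx
      have hys := mem_strip_of_mem_sideSet true h.2 hy
      rw [(T true).w_eq_one _ hxs _ hys, (T false).w_eq_one _ hxs _ hys, map_one, map_one]
    · rfl
  · simp [gluedTransition, hx, hy]

theorem gluedTransition_cocycleOn {b : Bool} {V : Set Pt} (hV : Convex ℝ V)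
    (hVU : V ⊆ sideSet P f c r b) : CocycleOn (gluedTransition T) V := by
  intro x hx y hy z hz
  rw [gluedTransition_eq T (hVU hx) (hVU hy), gluedTransition_eq T (hVU hy) (hVU hz),
    gluedTransition_eq T (hVU hx) (hVU hz), ← map_mul, (T b).w_mul V hVU hV x hx y hy z hz]

theorem exists_mem_sideSet (hr0 : 0 < r) {x : Pt} (hx : x ∉ P) : ∃ b, x ∈ sideSet P f c r b := by
  rcases le_total (f x) c with h | h
  · exact ⟨false, hx, by simp [sideHeight]; linarith⟩
  · exact ⟨true, hx, by simp [sideHeight]; linarith⟩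

theorem gluedTransition_local (hP : P.Finite) (hr0 : 0 < r) (x : Pt) (hx : x ∉ P) :
    ∃ V, IsOpen V ∧ x ∈ V ∧ CocycleOn (gluedTransition T) V := by
  obtain ⟨b, hb⟩ := exists_mem_sideSet (f := f) (c := c) hr0 hx
  obtain ⟨d, hd, hsub⟩ := Metric.isOpen_iff.1 (isOpen_sideSet hP b) x hb
  exact ⟨_, Metric.isOpen_ball, Metric.mem_ball_self hd,
    gluedTransition_cocycleOn T (convex_ball x d) hsub⟩

/-- Along an arc on one side of the line, a lift moves by an element of the corresponding factor,
and if that element is trivial then the arc can be straightened on that side. -/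
theorem IsLift.exists_of_mem_sideSet {α : ℝ → Pt} (hα : Continuous α)
    {F : ℝ → CoprodI fun b => (T b).G} (hF : IsLift (gluedTransition T) α F) {x y : ℝ}
    (hx0 : 0 ≤ x) (hxy : x ≤ y) {b : Bool} (hb : ∀ s ∈ Icc x y, α s ∈ sideSet P f c r b) :
    ∃ g : (T b).G, F y = F x * CoprodI.of (i := b) g ∧
      (α x ∈ strip f c r → α y ∈ strip f c r → g = 1 → ∃ K : ℝ × ℝ → Pt, Continuous K ∧
        (∀ z, K z ∈ sideSet P f c r b) ∧
        (∀ u ∈ Icc (0 : ℝ) 1, K (0, u) = α (x + u * (y - x))) ∧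
        (∀ u ∈ Icc (0 : ℝ) 1, K (1, u) = (1 - u) • α x + u • α y) ∧
        (∀ t, K (t, 0) = α x) ∧ (∀ t, K (t, 1) = α y)) := by
  obtain ⟨L, hL1, hL, hK⟩ := (T b).exists_lift α hα x y hxy hb
  refine ⟨L y, ?_, hK⟩
  have key := eq_of_eventually_eq_on_Icc (fun s => F s * (CoprodI.of (i := b) (L s))⁻¹) hxy (by
    intro s hs
    have hsub : Icc x y ⊆ Ici 0 := fun z hz => hx0.trans hz.1
    filter_upwards [self_mem_nhdsWithin, hL s hs, nhdsWithin_mono _ hsub (hF s (hsub hs))]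
      with s' h1 h2 h3
    rw [h2, h3, gluedTransition_eq T (hb s hs) (hb s' h1), map_mul]
    group)
  simp only [hL1, map_one, inv_one, mul_one] at key
  rw [key]
  group

end Sides

namespace PLLoop

/-- The vertices of a piecewise-linear loop, indexed by the natural numbers. -/
def vertex (γ : PLLoop) (l : ℕ) : Pt := γ.v (l : ZMod γ.m)

theorem vertex_add_m (γ : PLLoop) (l : ℕ) : γ.vertex (l + γ.m) = γ.vertex l := by
  simp [vertex]

theorem m_pos' (γ : PLLoop) : (0 : ℝ) < γ.m := Nat.cast_pos.2 γ.m_pos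

theorem toFun_add_one (γ : PLLoop) (s : ℝ) : γ.toFun (s + 1) = γ.toFun s := by
  simp only [toFun, Int.fract_add_one]

theorem toFun_edge (γ : PLLoop) (l : ℕ) {θ : ℝ} (h0 : 0 ≤ θ) (h1 : θ ≤ 1) :
    γ.toFun ((l + θ) / γ.m) = (1 - θ) • γ.vertex l + θ • γ.vertex (l + 1) := by
  have key : ∀ (l : ℕ) (θ : ℝ), 0 ≤ θ → θ < 1 →
      γ.toFun ((l + θ) / γ.m) = (1 - θ) • γ.vertex l + θ • γ.vertex (l + 1) := by
    intro l θ h0 h1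
    have hm := γ.m_pos'.ne'
    have hx : Int.fract ((l + θ) / γ.m) * γ.m
        = ((l - ⌊(l + θ) / γ.m⌋ * (γ.m : ℤ) : ℤ) : ℝ) + θ := by
      rw [Int.fract, sub_mul, div_mul_cancel₀ _ hm]
      push_cast
      ring
    have hfl : ⌊Int.fract ((l + θ) / γ.m) * γ.m⌋ = l - ⌊(l + θ) / γ.m⌋ * (γ.m : ℤ) := by
      rw [hx, Int.floor_intCast_add, Int.floor_eq_zero_iff.2 ⟨h0, h1⟩, add_zero]
    simp only [toFun]
    rw [hfl, hx, add_sub_cancel_left]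
    simp [vertex]
  rcases h1.lt_or_eq with h | rfl
  · exact key l θ h0 h
  · have := key (l + 1) 0 le_rfl one_pos
    push_cast at this
    simpa using this

theorem toFun_sub_edge (γ : PLLoop) (l : ℕ) {a b θ : ℝ} (ha : a ∈ Icc (0 : ℝ) 1)
    (hb : b ∈ Icc (0 : ℝ) 1) (hθ : θ ∈ Icc (0 : ℝ) 1) :
    γ.toFun ((l + a) / γ.m + θ * ((l + b) / γ.m - (l + a) / γ.m)) =
      (1 - θ) • γ.toFun ((l + a) / γ.m) + θ • γ.toFun ((l + b) / γ.m) := by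
  have e : (l + a) / γ.m + θ * ((l + b) / γ.m - (l + a) / γ.m)
      = (l + ((1 - θ) * a + θ * b)) / γ.m := by
    have hm := γ.m_pos'.ne'
    field_simp
    ring
  have hc := (convex_Icc (0 : ℝ) 1) ha hb (by linarith [hθ.2] : 0 ≤ 1 - θ) hθ.1 (by ring)
  simp only [smul_eq_mul] at hc
  rw [e, γ.toFun_edge l hc.1 hc.2, γ.toFun_edge l ha.1 ha.2, γ.toFun_edge l hb.1 hb.2]
  module

/-- The lengths of the edges of a piecewise-linear loop. -/
def edgeLength (γ : PLLoop) (l : ℕ) : ℝ := dist (γ.vertex l) (γ.vertex (l + 1))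

theorem edgeLength_add_m (γ : PLLoop) (l : ℕ) : γ.edgeLength (l + γ.m) = γ.edgeLength l := by
  rw [edgeLength, edgeLength, vertex_add_m, add_right_comm, vertex_add_m]

theorem length_eq_sum (γ : PLLoop) : γ.length = ∑ l ∈ Finset.range γ.m, γ.edgeLength l := by
  simp [length, edgeLength, vertex]

theorem length_eq_sum_Ico (γ : PLLoop) (i : ℕ) :
    γ.length = ∑ l ∈ Finset.Ico i (i + γ.m), γ.edgeLength l := by
  induction i with
  | zero => rw [length_eq_sum, zero_add, Nat.Ico_zero_eq_range]
  | succ i ih =>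
    have h1 := Finset.sum_eq_sum_Ico_succ_bot (Nat.lt_add_of_pos_right γ.m_pos : i < i + γ.m)
      γ.edgeLength
    have h2 := Finset.sum_Ico_succ_top (by have := γ.m_pos; omega : i + 1 ≤ i + γ.m) γ.edgeLength
    rw [edgeLength_add_m] at h2
    rw [show i + 1 + γ.m = i + γ.m + 1 by ring, h2, ih, h1, add_comm]

theorem dist_toFun_edge (γ : PLLoop) (l : ℕ) {a b : ℝ} (ha : a ∈ Icc (0 : ℝ) 1)
    (hb : b ∈ Icc (0 : ℝ) 1) :
    dist (γ.toFun ((l + a) / γ.m)) (γ.toFun ((l + b) / γ.m)) = |b - a| * γ.edgeLength l := by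
  rw [γ.toFun_edge l ha.1 ha.2, γ.toFun_edge l hb.1 hb.2, edgeLength, dist_eq_norm, dist_eq_norm]
  rw [← Real.norm_eq_abs, ← norm_smul]
  congr 1
  module

/-- A closed curve which is affine between consecutive parameters `τ l` is, up to
reparametrization, a piecewise-linear loop. -/
theorem exists_of_affine_pieces {M : ℕ} (hM : 0 < M) (τ : ℕ → ℝ) (hτ : τ M = τ 0 + 1)
    (β : ℝ → Pt) (hβ : ∀ s, β (s + 1) = β s)
    (haff : ∀ l < M, ∀ θ ∈ Icc (0 : ℝ) 1,
      β (τ l + θ * (τ (l + 1) - τ l)) = (1 - θ) • β (τ l) + θ • β (τ (l + 1))) :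
    ∃ (γ : PLLoop) (φ : ℝ → ℝ), Continuous φ ∧ (∀ s, φ (s + 1) = φ s + 1) ∧
      (∀ s, γ.toFun s = β (φ s)) ∧
      γ.length = ∑ l ∈ Finset.range M, dist (β (τ l)) (β (τ (l + 1))) := by
  have hM0 : (0 : ℝ) < M := Nat.cast_pos.2 hM
  let ψ : ℝ → ℝ := fun u => ∑ k ∈ Finset.range M, (τ (k + 1) - τ k) * max 0 (min 1 (M * u - k))
  have hψc : Continuous ψ := by fun_prop
  have hψ : ∀ l < M, ∀ θ ∈ Icc (0 : ℝ) 1, ψ ((l + θ) / M) = τ l - τ 0 + θ * (τ (l + 1) - τ l) := by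
    intro l hl θ hθ
    have e1 : ∀ k : ℕ, (M : ℝ) * ((l + θ) / M) - k = l + θ - k := by
      intro k; rw [mul_div_cancel₀ _ hM0.ne']
    simp only [ψ, e1]
    rw [← Finset.sum_range_add_sum_Ico _ hl.le, Finset.sum_eq_sum_Ico_succ_bot hl,
      Finset.sum_eq_zero (s := Finset.Ico (l + 1) M), add_zero]
    · rw [← Finset.sum_range_sub τ l]
      congr 1
      · refine Finset.sum_congr rfl fun k hk => ?_
        have : (k : ℝ) + 1 ≤ l := by exact_mod_cast Finset.mem_range.1 hk
        rw [min_eq_left (by linarith [hθ.1]), max_eq_right zero_le_one, mul_one]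
      · rw [add_sub_cancel_left, min_eq_right hθ.2, max_eq_right hθ.1, mul_comm]
    · intro k hk
      have : (l : ℝ) + 1 ≤ k := by exact_mod_cast (Finset.mem_Ico.1 hk).1
      rw [max_eq_left, mul_zero]
      exact (min_le_right _ _).trans (by linarith [hθ.2])
  have hψ0 : ψ 0 = 0 := by
    have := hψ 0 hM 0 ⟨le_rfl, zero_le_one⟩
    simpa using this
  have hψ1 : ψ 1 = 1 := by
    have h := hψ (M - 1) (by omega) 1 ⟨zero_le_one, le_rfl⟩
    have e : ((M - 1 : ℕ) : ℝ) + 1 = M := by exact_mod_cast Nat.sub_add_cancel hM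
    rw [e, div_self hM0.ne', Nat.sub_add_cancel hM, hτ] at h
    rw [h]; ring
  let V : ℕ → Pt := fun l => if l = M then β (τ 0) else β (τ l)
  have hV : ∀ l ≤ M, V l = β (τ l) := by
    intro l _
    by_cases h : l = M
    · simp [V, h, hτ, hβ]
    · simp [V, h]
  have : NeZero M := ⟨hM.ne'⟩
  let γ : PLLoop := ⟨M, hM, fun z => β (τ (ZMod.val z))⟩
  have hγ : ∀ l ≤ M, γ.vertex l = β (τ l) := by
    intro l hl
    change β (τ (ZMod.val (l : ZMod M))) = _
    rcases hl.lt_or_eq with h | rfl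
    · rw [ZMod.val_natCast_of_lt h]
    · rw [ZMod.natCast_self, ZMod.val_zero, hτ, hβ]
  refine ⟨γ, fun s => s + (τ 0 + (ψ (Int.fract s) - Int.fract s)), ?_, ?_, ?_, ?_⟩
  · refine continuous_id.add (continuous_const.add ?_)
    exact ContinuousOn.comp_fract'' (f := fun u => ψ u - u) (by fun_prop) (by simp [hψ0, hψ1])
  · intro s
    simp only [Int.fract_add_one]
    ring
  · intro s
    have hp : ∀ (g : ℝ → Pt), (∀ s, g (s + 1) = g s) → ∀ (u : ℝ) (n : ℤ), g (u + n) = g u := by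
      intro g hg u n
      have := (show Function.Periodic g 1 from hg).int_mul n u
      simpa using this
    have h1 : γ.toFun s = γ.toFun (Int.fract s) := by
      conv_lhs => rw [← Int.fract_add_floor s]
      exact hp _ γ.toFun_add_one _ _
    have h2 : β (s + (τ 0 + (ψ (Int.fract s) - Int.fract s))) = β (τ 0 + ψ (Int.fract s)) := by
      rw [← hp β hβ (τ 0 + ψ (Int.fract s)) ⌊s⌋]
      congr 1
      rw [Int.fract]
      ring
    rw [h1, h2]
    have hu0 := Int.fract_nonneg s
    have hu1 := Int.fract_lt_one s
    generalize Int.fract s = u at hu0 hu1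
    obtain ⟨l, hl⟩ : ∃ l, l = ⌊u * M⌋₊ := ⟨_, rfl⟩
    have ha := Nat.floor_le (mul_nonneg hu0 hM0.le)
    have hb := Nat.lt_floor_add_one (u * M)
    rw [← hl] at ha hb
    have hlM : l < M := by
      have : (l : ℝ) < M := ha.trans_lt (by nlinarith)
      exact_mod_cast this
    have hθ : u * M - l ∈ Icc (0 : ℝ) 1 := ⟨by linarith, by linarith⟩
    have hu : u = (l + (u * M - l)) / M := by field_simp; ring
    rw [hu, hψ l hlM _ hθ]
    have h3 := γ.toFun_edge l hθ.1 hθ.2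
    rw [hγ l hlM.le, hγ (l + 1) hlM] at h3
    refine h3.trans ?_
    rw [← haff l hlM _ hθ]
    congr 1
    ring
  · rw [length_eq_sum]
    refine Finset.sum_congr rfl fun l hl => ?_
    have : l < M := Finset.mem_range.1 hl
    rw [edgeLength, hγ l this.le, hγ (l + 1) this]

end PLLoop

section Shortcut

/-- Homotopy of `1`-periodic curves through curves avoiding `P`, except possibly at the end. -/
def LoopHtpy (P : Set Pt) (α β : ℝ → Pt) : Prop :=
  ∃ H : ℝ × ℝ → Pt, Continuous H ∧ (∀ s, H (0, s) = α s) ∧ (∀ s, H (1, s) = β s) ∧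
    (∀ t s, H (t, s + 1) = H (t, s)) ∧ (∀ t s, 0 ≤ t → t < 1 → H (t, s) ∉ P)

theorem LoopHtpy.trans {P : Set Pt} {α β γ : ℝ → Pt} (h : LoopHtpy P α β) (hβ : ∀ s, β s ∉ P)
    (h' : LoopHtpy P β γ) : LoopHtpy P α γ := by
  obtain ⟨H, hH, h0, h1, hp, hav⟩ := h
  obtain ⟨K, hK, k0, k1, kp, kav⟩ := h'
  refine ⟨fun z => if z.1 ≤ 1 / 2 then H (2 * z.1, z.2) else K (2 * z.1 - 1, z.2), ?_, ?_, ?_,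
    ?_, ?_⟩
  · refine Continuous.if_le (by fun_prop) (by fun_prop) continuous_fst continuous_const ?_
    intro z hz
    rw [hz]
    norm_num
    rw [h1, k0]
  · intro s
    norm_num
    exact h0 s
  · intro s
    norm_num
    exact k1 s
  · intro t s
    simp only [hp, kp]
  · intro t s ht0 ht1
    dsimp only
    split_ifs with ht
    · rcases ht.lt_or_eq with hlt | rfl
      · exact hav _ _ (by linarith) (by linarith)
      · norm_num
        rw [h1]
        exact hβ s
    · exact kav _ _ (by linarith) (by linarith)

theorem LoopHtpy.comp_right {P : Set Pt} {α β : ℝ → Pt} (h : LoopHtpy P α β) {φ : ℝ → ℝ}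
    (hφ : Continuous φ) (hφ1 : ∀ s, φ (s + 1) = φ s + 1) :
    LoopHtpy P α (fun s => β (φ s)) := by
  obtain ⟨H, hH, h0, h1, hp, hav⟩ := h
  refine ⟨fun z => H (z.1, (1 - z.1) * z.2 + z.1 * φ z.2), by fun_prop, ?_, ?_, ?_, ?_⟩
  · intro s; simp [h0]
  · intro s; simp [h1]
  · intro t s
    dsimp only
    rw [hφ1, ← hp t ((1 - t) * s + t * φ s)]
    congr 2
    ring
  · intro t s ht0 ht1
    exact hav _ _ ht0 ht1

/-- The `1`-periodic curves which follow `g₁` on `[x, y]` and `g₂` on `[y, x + 1]`. -/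
def splice (x y : ℝ) (g₁ g₂ : ℝ × ℝ → Pt) (z : ℝ × ℝ) : Pt :=
  if Int.fract (z.2 - x) ≤ y - x then g₁ (z.1, Int.fract (z.2 - x) / (y - x))
  else g₂ (z.1, x + Int.fract (z.2 - x))

theorem continuous_splice {x y : ℝ} (hxy : x < y) (hyx : y ≤ x + 1) {g₁ g₂ : ℝ × ℝ → Pt}
    (h₁ : Continuous g₁) (h₂ : Continuous g₂) (hy : ∀ t, g₁ (t, 1) = g₂ (t, y))
    (hx : ∀ t, g₁ (t, 0) = g₂ (t, x + 1)) : Continuous (splice x y g₁ g₂) := by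
  have hd : y - x ≠ 0 := (sub_pos.2 hxy).ne'
  let g : ℝ × ℝ → Pt := fun z =>
    if z.2 ≤ y - x then g₁ (z.1, z.2 / (y - x)) else g₂ (z.1, x + z.2)
  have hg : Continuous g := by
    refine Continuous.if_le (by fun_prop) (by fun_prop) continuous_snd continuous_const ?_
    intro z hz
    rw [hz, div_self hd, hy]
    congr 2
    ring
  refine ContinuousOn.comp_fract (s := fun z : ℝ × ℝ => z.2 - x)
    (f := fun (z : ℝ × ℝ) v => g (z.1, v)) ?_ (by fun_prop) ?_
  · exact Continuous.continuousOn (by fun_prop)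
  · intro z
    simp only [g]
    rw [if_pos (sub_pos.2 hxy).le, zero_div]
    split_ifs with h
    · obtain rfl : y = x + 1 := le_antisymm hyx (by linarith)
      rw [hx, ← hy]
      simp
    · rw [hx]

theorem splice_add_one (x y : ℝ) (g₁ g₂ : ℝ × ℝ → Pt) (t s : ℝ) :
    splice x y g₁ g₂ (t, s + 1) = splice x y g₁ g₂ (t, s) := by
  simp only [splice, add_sub_right_comm, Int.fract_add_one]

theorem splice_mem {x y : ℝ} (hxy : x < y) {g₁ g₂ : ℝ × ℝ → Pt} {t : ℝ} {Q : Set Pt}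
    (h₁ : ∀ u ∈ Icc (0 : ℝ) 1, g₁ (t, u) ∈ Q) (h₂ : ∀ s, g₂ (t, s) ∈ Q) (s : ℝ) :
    splice x y g₁ g₂ (t, s) ∈ Q := by
  unfold splice
  split_ifs with h
  · exact h₁ _ ⟨div_nonneg (Int.fract_nonneg _) (sub_pos.2 hxy).le,
      (div_le_one (sub_pos.2 hxy)).2 h⟩
  · exact h₂ _

theorem splice_congr {x y : ℝ} (hxy : x < y) {g₁ g₂ k₁ k₂ : ℝ × ℝ → Pt} {t t' : ℝ}
    (h₁ : ∀ u ∈ Icc (0 : ℝ) 1, g₁ (t, u) = k₁ (t', u)) (h₂ : ∀ s, g₂ (t, s) = k₂ (t', s)) (s : ℝ) :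
    splice x y g₁ g₂ (t, s) = splice x y k₁ k₂ (t', s) := by
  simp only [splice]
  split_ifs with h
  · exact h₁ _ ⟨div_nonneg (Int.fract_nonneg _) (sub_pos.2 hxy).le,
      (div_le_one (sub_pos.2 hxy)).2 h⟩
  · exact h₂ _

theorem splice_eq_self {x y : ℝ} (hxy : x < y) {β : ℝ → Pt} (hβ : ∀ s, β (s + 1) = β s)
    {g₁ g₂ : ℝ × ℝ → Pt} {t : ℝ} (h₁ : ∀ u ∈ Icc (0 : ℝ) 1, g₁ (t, u) = β (x + u * (y - x)))
    (h₂ : ∀ s, g₂ (t, s) = β s) (s : ℝ) : splice x y g₁ g₂ (t, s) = β s := by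
  have hp : β (x + Int.fract (s - x)) = β s := by
    have := (show Function.Periodic β 1 from hβ).sub_int_mul_eq ⌊s - x⌋ (x := s)
    rw [← this, Int.fract]
    congr 1
    ring
  have hd := sub_pos.2 hxy
  simp only [splice]
  split_ifs with h
  · rw [h₁ _ ⟨div_nonneg (Int.fract_nonneg _) hd.le, (div_le_one hd).2 h⟩,
      div_mul_cancel₀ _ hd.ne', hp]
  · rw [h₂, hp]

/-- The curve `β` with its arc over `[x, y]` replaced by a segment. -/
def shortcut (β : ℝ → Pt) (x y : ℝ) (s : ℝ) : Pt :=
  splice x y (fun z => (1 - z.2) • β x + z.2 • β y) (fun z => β z.2) (0, s)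

/-- If, in a homotopy, at some time the arc over `[x, y]` can be straightened, and the endpoints
of that arc remain in an obstacle-free convex set afterwards, then the arc can be straightened in
the end. -/
theorem loopHtpy_shortcut {P S : Set Pt} {H : ℝ × ℝ → Pt} (hH : Continuous H)
    (hp : ∀ t s, H (t, s + 1) = H (t, s)) (hav : ∀ t s, 0 ≤ t → t < 1 → H (t, s) ∉ P)
    {T : ℝ} (hT0 : 0 ≤ T) (hT1 : T < 1) {x y : ℝ} (hxy : x < y) (hyx : y ≤ x + 1)
    (hS : Convex ℝ S) (hSP : ∀ p ∈ S, p ∉ P) (hxS : ∀ t ∈ Icc T 1, H (t, x) ∈ S)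
    (hyS : ∀ t ∈ Icc T 1, H (t, y) ∈ S) {K : ℝ × ℝ → Pt} (hK : Continuous K)
    (hKP : ∀ z, K z ∉ P) (hK0 : ∀ u ∈ Icc (0 : ℝ) 1, K (0, u) = H (T, x + u * (y - x)))
    (hK1 : ∀ u ∈ Icc (0 : ℝ) 1, K (1, u) = (1 - u) • H (T, x) + u • H (T, y))
    (hKx : ∀ t, K (t, 0) = H (T, x)) (hKy : ∀ t, K (t, 1) = H (T, y)) :
    LoopHtpy P (fun s => H (0, s)) (shortcut (fun s => H (1, s)) x y) := by
  have h1 : LoopHtpy P (fun s => H (0, s)) (fun s => H (T, s)) := by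
    refine ⟨fun z => H (T * z.1, z.2), by fun_prop, by simp, by simp, fun t s => hp _ _, ?_⟩
    intro t s ht0 ht1
    exact hav _ _ (mul_nonneg hT0 ht0) (by nlinarith)
  have h2 : LoopHtpy P (fun s => H (T, s)) (shortcut (fun s => H (T, s)) x y) := by
    refine ⟨splice x y K (fun z => H (T, z.2)), ?_, ?_, ?_, splice_add_one _ _ _ _, ?_⟩
    · refine continuous_splice hxy hyx hK (by fun_prop) hKy ?_
      intro t
      rw [hKx, hp]
    · exact splice_eq_self hxy (hp T) hK0 fun s => rfl
    · exact splice_congr hxy hK1 fun s => rfl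
    · intro t s _ _
      apply splice_mem hxy (Q := Pᶜ)
      exacts [fun u _ => hKP _, fun s => hav _ _ hT0 hT1]
  have hseg : ∀ t ∈ Icc T 1, ∀ u ∈ Icc (0 : ℝ) 1, (1 - u) • H (t, x) + u • H (t, y) ∉ P := by
    intro t ht u hu
    exact hSP _ (hS (hxS t ht) (hyS t ht) (by linarith [hu.2]) hu.1 (by ring))
  have h3 : LoopHtpy P (shortcut (fun s => H (T, s)) x y)
      (shortcut (fun s => H (1, s)) x y) := by
    refine ⟨splice x y (fun z => (1 - z.2) • H (T + z.1 * (1 - T), x)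
      + z.2 • H (T + z.1 * (1 - T), y)) (fun z => H (T + z.1 * (1 - T), z.2)), ?_, ?_, ?_,
      splice_add_one _ _ _ _, ?_⟩
    · refine continuous_splice hxy hyx (by fun_prop) (by fun_prop) (by simp) ?_
      intro t
      simp [hp]
    · exact splice_congr hxy (by simp) (by simp)
    · exact splice_congr hxy (by simp) (by simp)
    · intro t s ht0 ht1
      have h0 : T ≤ T + t * (1 - T) := by nlinarith
      have h1 : T + t * (1 - T) < 1 := by nlinarith
      apply splice_mem hxy (Q := Pᶜ)
      exacts [fun u hu => hseg _ ⟨h0, h1.le⟩ u hu, fun s => hav _ _ (hT0.trans h0) h1]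
  refine (h1.trans (fun s => hav _ _ hT0 hT1) h2).trans (fun s => ?_) h3
  apply splice_mem hxy (Q := Pᶜ)
  exacts [fun u hu => hseg T ⟨le_rfl, hT1.le⟩ u hu, fun s => hav _ _ hT0 hT1]

end Shortcut

section Shorten

theorem shortcut_add_one (β : ℝ → Pt) (x y s : ℝ) :
    shortcut β x y (s + 1) = shortcut β x y s := splice_add_one _ _ _ _ _ _

theorem shortcut_of_mem {β : ℝ → Pt} (hβ : ∀ s, β (s + 1) = β s) {x y s : ℝ} (hxy : x < y)
    (hs : s ∈ Icc y (x + 1)) : shortcut β x y s = β s := by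
  have hd := sub_pos.2 hxy
  rcases hs.2.lt_or_eq with h | rfl
  · have hf : Int.fract (s - x) = s - x :=
      Int.fract_eq_self.2 ⟨by linarith [hs.1], by linarith⟩
    simp only [shortcut, splice, hf]
    split_ifs with h'
    · obtain rfl : s = y := le_antisymm (by linarith) hs.1
      rw [div_self hd.ne']
      simp
    · congr 1; ring
  · simp [shortcut, splice, hd.le, hβ]

theorem shortcut_segment {β : ℝ → Pt} (hβ : ∀ s, β (s + 1) = β s) {x y θ : ℝ} (hxy : x < y)
    (hyx : y ≤ x + 1) (hθ : θ ∈ Icc (0 : ℝ) 1) :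
    shortcut β x y (x + θ * (y - x)) = (1 - θ) • β x + θ • β y := by
  have hd := sub_pos.2 hxy
  rcases hθ.2.lt_or_eq with h | rfl
  · have hf : Int.fract (x + θ * (y - x) - x) = θ * (y - x) := by
      rw [add_sub_cancel_left]
      exact Int.fract_eq_self.2 ⟨mul_nonneg hθ.1 hd.le, by nlinarith⟩
    simp only [shortcut, splice, hf]
    rw [if_pos (by nlinarith), mul_div_cancel_right₀ _ hd.ne']
  · rw [one_mul, add_sub_cancel, shortcut_of_mem hβ hxy ⟨le_rfl, hyx⟩]
    simp

theorem dist_lt_of_apply_ne (f : Pt →L[ℝ] ℝ) {c : ℝ} {p q v : Pt} (hp : f p = c) (hq : f q = c)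
    (hv : f v ≠ c) : dist p q < dist p v + dist v q := by
  refine (dist_triangle p v q).lt_of_ne fun h => hv ?_
  obtain ⟨t, -, rfl⟩ := (dist_add_dist_eq_iff.1 h.symm : Wbtw ℝ p v q)
  rw [AffineMap.lineMap_apply_module, map_add, map_smul, map_smul, hp, hq, ← add_smul]
  simp

namespace PLLoop

theorem dist_toFun_lt_sum (δ : PLLoop) (f : Pt →L[ℝ] ℝ) {c : ℝ} {i j : ℕ} {a b : ℝ}
    (ha : a ∈ Icc (0 : ℝ) 1) (hb : b ∈ Icc (0 : ℝ) 1) (hij : i < j)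
    (hfx : f (δ.toFun ((i + a) / δ.m)) = c) (hfy : f (δ.toFun ((j + b) / δ.m)) = c)
    (hne : f (δ.vertex (i + 1)) ≠ c) :
    dist (δ.toFun ((i + a) / δ.m)) (δ.toFun ((j + b) / δ.m)) <
      (1 - a) * δ.edgeLength i + ∑ k ∈ Finset.Ico (i + 1) j, δ.edgeLength k
        + b * δ.edgeLength j := by
  have h1 : dist (δ.toFun ((i + a) / δ.m)) (δ.vertex (i + 1)) = (1 - a) * δ.edgeLength i := by
    have := δ.dist_toFun_edge i ha ⟨zero_le_one, le_rfl⟩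
    rwa [δ.toFun_edge i zero_le_one le_rfl, sub_self, zero_smul, zero_add, one_smul,
      abs_of_nonneg (by linarith [ha.2])] at this
  have h2 : dist (δ.vertex j) (δ.toFun ((j + b) / δ.m)) = b * δ.edgeLength j := by
    have := δ.dist_toFun_edge j ⟨le_rfl, zero_le_one⟩ hb
    rwa [δ.toFun_edge j le_rfl zero_le_one, sub_zero, zero_smul, add_zero, one_smul, sub_zero,
      abs_of_nonneg hb.1] at this
  have h3 : dist (δ.vertex (i + 1)) (δ.vertex j) ≤ ∑ k ∈ Finset.Ico (i + 1) j, δ.edgeLength k :=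
    dist_le_Ico_sum_dist δ.vertex hij
  have h4 := dist_triangle (δ.vertex (i + 1)) (δ.vertex j) (δ.toFun ((j + b) / δ.m))
  have h5 := dist_lt_of_apply_ne f hfx hfy hne
  linarith

/-- Replacing an arc with endpoints on a line by a segment makes the loop shorter. -/
theorem exists_length_lt_of_shortcut {P : Set Pt} {γ δ : PLLoop} (f : Pt →L[ℝ] ℝ) {c : ℝ}
    {i j : ℕ} {a b : ℝ} (ha : a ∈ Icc (0 : ℝ) 1) (hb : b ∈ Icc (0 : ℝ) 1) (hij : i < j)
    (hyx : (j + b) / δ.m ≤ (i + a) / δ.m + 1)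
    (hfx : f (δ.toFun ((i + a) / δ.m)) = c) (hfy : f (δ.toFun ((j + b) / δ.m)) = c)
    (hne : f (δ.vertex (i + 1)) ≠ c)
    (h : LoopHtpy P γ.toFun (shortcut δ.toFun ((i + a) / δ.m) ((j + b) / δ.m))) :
    ∃ δ' : PLLoop, HomotopicRelExt P γ δ' ∧ δ'.length < δ.length := by
  have hm := δ.m_pos'
  have ha1 : a < 1 := ha.2.lt_of_ne (by
    rintro rfl
    rw [δ.toFun_edge i zero_le_one le_rfl] at hfx
    simp at hfx
    exact hne hfx)
  have hijR : (i : ℝ) + 1 ≤ j := by exact_mod_cast hij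
  have hxy : (i + a) / δ.m < (j + b) / δ.m :=
    div_lt_div_of_pos_right (by linarith [hb.1]) hm
  have hab : (j : ℝ) + b ≤ i + δ.m + a := by
    rw [div_add_one hm.ne', div_le_div_iff_of_pos_right hm] at hyx
    linarith
  have hji : j ≤ i + δ.m := by
    have : (j : ℝ) < i + δ.m + 1 := by linarith [hb.1]
    exact Nat.lt_succ_iff.1 (by exact_mod_cast this)
  obtain ⟨n, hn⟩ := Nat.exists_eq_add_of_le hji
  have hnR : (i : ℝ) + δ.m = j + n := by exact_mod_cast hn
  let A : ℕ → ℝ := fun l => if l = 0 then b else 0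
  let B : ℕ → ℝ := fun l => if l = n then a else 1
  let τ : ℕ → ℝ := fun l => if l = 0 then (i + a) / δ.m else
    if l = n + 2 then (j + n + a) / δ.m else (((j + (l - 1) : ℕ) : ℝ) + A (l - 1)) / δ.m
  have hA : ∀ l, A l ∈ Icc (0 : ℝ) 1 := by
    intro l; simp only [A]; split_ifs; exacts [hb, ⟨le_rfl, zero_le_one⟩]
  have hB : ∀ l, B l ∈ Icc (0 : ℝ) 1 := by
    intro l; simp only [B]; split_ifs; exacts [ha, ⟨zero_le_one, le_rfl⟩]
  have hAB : ∀ l, A l ≤ B l := by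
    intro l
    simp only [A, B]
    split_ifs with h1 h2 h2
    · have : n = 0 := by omega
      subst this
      push_cast at hnR
      linarith
    · exact hb.2
    · exact ha.1
    · exact zero_le_one
  have hτA : ∀ l ≤ n, τ (l + 1) = (((j + l : ℕ) : ℝ) + A l) / δ.m := by
    intro l hl
    simp only [τ]
    rw [if_neg (by omega), if_neg (by omega)]
    rfl
  have hτB : ∀ l ≤ n, τ (l + 1 + 1) = (((j + l : ℕ) : ℝ) + B l) / δ.m := by
    intro l hl
    simp only [τ, B]
    rw [if_neg (by omega)]
    by_cases hln : l = n
    · subst hln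
      simp
    · rw [if_neg (by omega), if_neg hln]
      simp only [A]
      rw [if_neg (by omega), Nat.add_sub_cancel]
      push_cast
      ring
  have hτ0 : τ 0 = (i + a) / δ.m := rfl
  have hτ1 : τ 1 = (j + b) / δ.m := by
    have := hτA 0 (Nat.zero_le _)
    simpa [A] using this
  have hτM : τ (n + 2) = τ 0 + 1 := by
    rw [hτ0]
    simp only [τ]
    rw [if_neg (by omega), if_pos trivial, div_add_one hm.ne', ← hnR]
    congr 1
    ring
  have hβ := shortcut_add_one δ.toFun ((i + a) / δ.m) ((j + b) / δ.m)
  have hβτ : ∀ l ≤ n, ∀ θ ∈ Icc (0 : ℝ) 1,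
      shortcut δ.toFun ((i + a) / δ.m) ((j + b) / δ.m)
        (τ (l + 1) + θ * (τ (l + 1 + 1) - τ (l + 1))) =
      δ.toFun (τ (l + 1) + θ * (τ (l + 1 + 1) - τ (l + 1))) := by
    intro l hl θ hθ
    refine shortcut_of_mem δ.toFun_add_one hxy ?_
    have hle : τ (l + 1) ≤ τ (l + 1 + 1) := by
      rw [hτA l hl, hτB l hl]
      exact div_le_div_of_nonneg_right (by linarith [hAB l]) hm.le
    have hlo : (j + b) / δ.m ≤ τ (l + 1) := by
      rw [hτA l hl]
      refine div_le_div_of_nonneg_right ?_ hm.le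
      simp only [A]
      push_cast
      split_ifs with h0
      · subst h0; simp
      · have : (1 : ℝ) ≤ l := by exact_mod_cast Nat.one_le_iff_ne_zero.2 h0
        linarith [hb.2]
    have hhi : τ (l + 1 + 1) ≤ (i + a) / δ.m + 1 := by
      rw [hτB l hl, div_add_one hm.ne']
      refine div_le_div_of_nonneg_right ?_ hm.le
      simp only [B]
      push_cast
      split_ifs with h0
      · subst h0; linarith
      · have : (l : ℝ) + 1 ≤ n := by exact_mod_cast lt_of_le_of_ne hl h0
        linarith [ha.1]
    constructor
    · nlinarith [hθ.1]
    · nlinarith [hθ.2]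
  obtain ⟨δ', φ, hφ, hφ1, hfun, hlen⟩ := exists_of_affine_pieces (by omega : 0 < n + 2) τ hτM
    (shortcut δ.toFun ((i + a) / δ.m) ((j + b) / δ.m)) hβ (by
      intro l hl θ hθ
      rcases l with - | l
      · rw [zero_add, hτ0, hτ1, shortcut_segment δ.toFun_add_one hxy hyx hθ]
        have e0 := shortcut_segment δ.toFun_add_one hxy hyx (left_mem_Icc.2 zero_le_one)
        have e1 := shortcut_segment δ.toFun_add_one hxy hyx (right_mem_Icc.2 zero_le_one)
        simp only [zero_mul, add_zero, sub_zero, one_smul, zero_smul, one_mul, add_sub_cancel,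
          sub_self, zero_add] at e0 e1
        rw [e0, e1]
      · have hl' : l ≤ n := by omega
        have e0 := hβτ l hl' 0 (left_mem_Icc.2 zero_le_one)
        have e1 := hβτ l hl' 1 (right_mem_Icc.2 zero_le_one)
        simp only [zero_mul, add_zero, one_mul, add_sub_cancel] at e0 e1
        rw [hβτ l hl' θ hθ, e0, e1, hτA l hl', hτB l hl',
          δ.toFun_sub_edge (j + l) (hA l) (hB l) hθ])
  refine ⟨δ', ?_, ?_⟩
  · have := h.comp_right hφ hφ1
    simp only [← hfun] at this
    exact this
  · have hd : ∀ l ≤ n, dist (shortcut δ.toFun ((i + a) / δ.m) ((j + b) / δ.m) (τ (l + 1)))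
        (shortcut δ.toFun ((i + a) / δ.m) ((j + b) / δ.m) (τ (l + 1 + 1))) =
        δ.edgeLength (j + l) - (if l = 0 then b * δ.edgeLength (j + l) else 0)
          - (if l = n then (1 - a) * δ.edgeLength (j + l) else 0) := by
      intro l hl
      have e0 := hβτ l hl 0 (left_mem_Icc.2 zero_le_one)
      have e1 := hβτ l hl 1 (right_mem_Icc.2 zero_le_one)
      simp only [zero_mul, add_zero, one_mul, add_sub_cancel] at e0 e1
      rw [e0, e1, hτA l hl, hτB l hl, δ.dist_toFun_edge (j + l) (hA l) (hB l),
        abs_of_nonneg (sub_nonneg.2 (hAB l))]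
      simp only [A, B]
      split_ifs <;> ring
    have hd0 : dist (shortcut δ.toFun ((i + a) / δ.m) ((j + b) / δ.m) (τ 0))
        (shortcut δ.toFun ((i + a) / δ.m) ((j + b) / δ.m) (τ (0 + 1))) =
        dist (δ.toFun ((i + a) / δ.m)) (δ.toFun ((j + b) / δ.m)) := by
      have e0 := shortcut_segment δ.toFun_add_one hxy hyx (left_mem_Icc.2 zero_le_one)
      have e1 := shortcut_segment δ.toFun_add_one hxy hyx (right_mem_Icc.2 zero_le_one)
      simp only [zero_mul, add_zero, sub_zero, one_smul, zero_smul, one_mul, add_sub_cancel,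
        sub_self, zero_add] at e0 e1
      rw [zero_add, hτ0, hτ1, e0, e1]
    rw [hlen, Finset.sum_range_succ', hd0, Finset.sum_congr rfl fun l hl =>
      hd l (Nat.lt_succ_iff.1 (Finset.mem_range.1 hl)), Finset.sum_sub_distrib,
      Finset.sum_sub_distrib, Finset.sum_ite_eq' , Finset.sum_ite_eq', if_pos (by simp),
      if_pos (by simp), ← hn, edgeLength_add_m, add_zero, Finset.sum_range_succ, ← hn,
      edgeLength_add_m, δ.length_eq_sum_Ico i, ← Finset.sum_Ico_consecutive _ hij.le hji,
      Finset.sum_eq_sum_Ico_succ_bot hij, hn, Finset.sum_Ico_eq_sum_range _ j (j + n),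
      Nat.add_sub_cancel_left]
    have := δ.dist_toFun_lt_sum f ha hb hij hfx hfy hne
    linarith

end PLLoop

end Shorten

namespace Monoid.CoprodI

variable {ι : Type} {G : ι → Type} [∀ i, Group (G i)]

open Classical in
/-- The number of syllables of the reduced word representing an element of a free product. -/
def syllableLength (g : CoprodI G) : ℕ := (Word.equiv g).toList.length

open Classical in
theorem syllableLength_prod (w : Word G) : syllableLength w.prod = w.toList.length :=
  congrArg (fun w : Word G => w.toList.length) (Word.equiv.apply_symm_apply w)

theorem syllableLength_one : syllableLength (1 : CoprodI G) = 0 :=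
  syllableLength_prod Word.empty

open Classical in
theorem Word.length_rcons_le {i : ι} (p : Word.Pair G i) :
    (Word.rcons p).toList.length ≤ p.tail.toList.length + 1 := by
  unfold Word.rcons
  split_ifs <;> simp

open Classical in
theorem Word.length_tail_le {i : ι} (p : Word.Pair G i) :
    p.tail.toList.length ≤ (Word.rcons p).toList.length := by
  unfold Word.rcons
  split_ifs <;> simp

open Classical in
theorem syllableLength_of_mul_le {i : ι} (x : G i) (g : CoprodI G) :
    syllableLength (of x * g) ≤ syllableLength g + 1 := by
  have h : Word.equiv (of x * g) = of x • Word.equiv g := by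
    change (of x * g) • (Word.empty : Word G) = of x • g • Word.empty
    rw [mul_smul]
  rw [syllableLength, h, Word.of_smul_def]
  refine (Word.length_rcons_le _).trans (Nat.succ_le_succ ?_)
  have h2 := Word.length_tail_le (Word.equivPair i (Word.equiv g))
  rwa [← Word.equivPair_symm, Equiv.symm_apply_apply] at h2

theorem syllableLength_mul_le (a b : CoprodI G) :
    syllableLength (a * b) ≤ syllableLength a + syllableLength b := by
  classical
  have key : ∀ (l : List (Σ i, G i)) (b : CoprodI G),
      syllableLength ((l.map fun y => of y.2).prod * b) ≤ l.length + syllableLength b := by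
    intro l b
    induction l with
    | nil => simp
    | cons y l ih =>
      rw [List.map_cons, List.prod_cons, mul_assoc, List.length_cons]
      have := syllableLength_of_mul_le y.2 ((l.map fun y => of y.2).prod * b)
      omega
  have := key (Word.equiv a).toList b
  rwa [show ((Word.equiv a).toList.map fun y => of y.2).prod = a from
    Word.equiv.symm_apply_apply a] at this

end Monoid.CoprodI

section Crossings

open Monoid

theorem sideHeight_combo (f : Pt →L[ℝ] ℝ) (c : ℝ) (b : Bool) (t : ℝ) (x y : Pt) :
    sideHeight f c b ((1 - t) • x + t • y) =
      (1 - t) * sideHeight f c b x + t * sideHeight f c b y := by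
  cases b <;> simp [sideHeight] <;> ring

namespace PLLoop

variable (δ : PLLoop) (f : Pt →L[ℝ] ℝ) (c : ℝ)

/-- The side of the line `f = c` on which a vertex lies. -/
def side (l : ℕ) : Bool := decide (c < f (δ.vertex l))

/-- The edge `l` crosses the line `f = c`. -/
abbrev Crosses (l : ℕ) : Prop := δ.side f c l ≠ δ.side f c (l + 1)

/-- The parameter on the edge `l` where it crosses the line `f = c`. -/
def crossParam (l : ℕ) : ℝ :=
  (c - f (δ.vertex l)) / (f (δ.vertex (l + 1)) - f (δ.vertex l))

/-- The time at which the edge `l` crosses the line `f = c`. -/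
def crossTime (l : ℕ) : ℝ := (l + δ.crossParam f c l) / δ.m

variable {δ f c}

theorem side_add_m (l : ℕ) : δ.side f c (l + δ.m) = δ.side f c l := by
  rw [side, side, vertex_add_m]

theorem crosses_add_m (l : ℕ) : δ.Crosses f c (l + δ.m) ↔ δ.Crosses f c l := by
  rw [Crosses, Crosses, add_right_comm, side_add_m, side_add_m]

theorem crossTime_add_m (l : ℕ) : δ.crossTime f c (l + δ.m) = δ.crossTime f c l + 1 := by
  rw [crossTime, crossTime, crossParam, crossParam, add_right_comm, vertex_add_m, vertex_add_m,
    div_add_one δ.m_pos'.ne']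
  push_cast
  ring

theorem count_crosses_mul_add (k n : ℕ) :
    Nat.count (δ.Crosses f c) (k * δ.m + n) =
      k * Nat.count (δ.Crosses f c) δ.m + Nat.count (δ.Crosses f c) n := by
  induction k with
  | zero => simp
  | succ k ih =>
    rw [show (k + 1) * δ.m + n = δ.m + (k * δ.m + n) by ring, Nat.count_add]
    simp only [add_comm δ.m, crosses_add_m, ih]
    ring

theorem sideHeight_side_pos (hV : ∀ l, f (δ.vertex l) ≠ c)
    (l : ℕ) : 0 < sideHeight f c (δ.side f c l) (δ.vertex l) := by
  rcases lt_or_gt_of_ne (hV l) with h | h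
  · simp [side, sideHeight, h, not_lt.2 h.le]
  · simp [side, sideHeight, h]

theorem crossParam_mem (hV : ∀ l, f (δ.vertex l) ≠ c)
    {l : ℕ} (hl : δ.Crosses f c l) : δ.crossParam f c l ∈ Ioo (0 : ℝ) 1 := by
  have h0 := hV l
  have h1 := hV (l + 1)
  have hl' : ¬(c < f (δ.vertex l) ↔ c < f (δ.vertex (l + 1))) := by
    simpa [Crosses, side] using hl
  unfold crossParam
  rcases lt_or_gt_of_ne h0 with h0 | h0 <;> rcases lt_or_gt_of_ne h1 with h1 | h1
  · exact absurd (iff_of_false h0.not_gt h1.not_gt) hl'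
  · exact ⟨div_pos (by linarith) (by linarith), (div_lt_one (by linarith)).2 (by linarith)⟩
  · exact ⟨div_pos_of_neg_of_neg (by linarith) (by linarith),
      (div_lt_one_of_neg (by linarith)).2 (by linarith)⟩
  · exact absurd (iff_of_true h0 h1) hl'

theorem apply_crossTime (hV : ∀ l, f (δ.vertex l) ≠ c) {l : ℕ} (hl : δ.Crosses f c l) :
    f (δ.toFun (δ.crossTime f c l)) = c := by
  have h := crossParam_mem hV hl
  rw [crossTime, δ.toFun_edge l h.1.le h.2.le, map_add, map_smul, map_smul, smul_eq_mul,
    smul_eq_mul]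
  have hd : f (δ.vertex (l + 1)) - f (δ.vertex l) ≠ 0 := by
    intro h0
    rw [crossParam, h0, div_zero] at h
    exact h.1.ne rfl
  rw [crossParam]
  field_simp
  ring

theorem sideHeight_edge_nonneg {b : Bool} {l : ℕ} {x y : ℝ} (hx : x ∈ Icc (0 : ℝ) 1)
    (hy : y ∈ Icc (0 : ℝ) 1) (hxb : 0 ≤ sideHeight f c b (δ.toFun ((l + x) / δ.m)))
    (hyb : 0 ≤ sideHeight f c b (δ.toFun ((l + y) / δ.m))) :
    ∀ s ∈ Icc ((l + x) / δ.m) ((l + y) / δ.m), 0 ≤ sideHeight f c b (δ.toFun s) := by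
  intro s hs
  have := Icc_subset_segment (𝕜 := ℝ) hs
  rw [segment_eq_image'] at this
  obtain ⟨θ, hθ, rfl⟩ := this
  dsimp only
  rw [smul_eq_mul, δ.toFun_sub_edge l hx hy hθ, sideHeight_combo]
  exact add_nonneg (mul_nonneg (by linarith [hθ.2]) hxb) (mul_nonneg hθ.1 hyb)

theorem sideHeight_crossTime (hV : ∀ l, f (δ.vertex l) ≠ c)
    {l : ℕ} (hl : δ.Crosses f c l) (b : Bool) :
    sideHeight f c b (δ.toFun (δ.crossTime f c l)) = 0 := by
  have := apply_crossTime hV hl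
  cases b <;> simp [sideHeight, this]

theorem sideHeight_vertex_nonneg (hV : ∀ l, f (δ.vertex l) ≠ c) (l : ℕ) :
    0 ≤ sideHeight f c (δ.side f c l) (δ.toFun ((l + 0) / δ.m)) := by
  rw [δ.toFun_edge l le_rfl zero_le_one]
  simpa using (sideHeight_side_pos hV l).le

theorem sideHeight_vertex_succ_nonneg (hV : ∀ l, f (δ.vertex l) ≠ c) (l : ℕ) :
    0 ≤ sideHeight f c (δ.side f c (l + 1)) (δ.toFun ((l + 1) / δ.m)) := by
  have := sideHeight_vertex_nonneg hV (l + 1)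
  rwa [add_zero, Nat.cast_add_one] at this

theorem sideHeight_before_cross (hV : ∀ l, f (δ.vertex l) ≠ c) {l : ℕ} (hl : δ.Crosses f c l) :
    ∀ s ∈ Icc ((l : ℝ) / δ.m) (δ.crossTime f c l),
      0 ≤ sideHeight f c (δ.side f c l) (δ.toFun s) := by
  have h := crossParam_mem hV hl
  have := sideHeight_edge_nonneg ⟨le_rfl, zero_le_one⟩ ⟨h.1.le, h.2.le⟩
    (sideHeight_vertex_nonneg hV l) (sideHeight_crossTime hV hl _).ge
  rwa [add_zero] at this

theorem sideHeight_after_cross (hV : ∀ l, f (δ.vertex l) ≠ c) {l : ℕ} (hl : δ.Crosses f c l) :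
    ∀ s ∈ Icc (δ.crossTime f c l) ((l + 1) / δ.m),
      0 ≤ sideHeight f c (δ.side f c (l + 1)) (δ.toFun s) := by
  have h := crossParam_mem hV hl
  exact sideHeight_edge_nonneg ⟨h.1.le, h.2.le⟩ ⟨zero_le_one, le_rfl⟩
    (sideHeight_crossTime hV hl _).ge (sideHeight_vertex_succ_nonneg hV l)

theorem sideHeight_of_not_cross (hV : ∀ l, f (δ.vertex l) ≠ c) {l : ℕ} (hl : ¬δ.Crosses f c l) :
    ∀ s ∈ Icc ((l : ℝ) / δ.m) ((l + 1) / δ.m),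
      0 ≤ sideHeight f c (δ.side f c (l + 1)) (δ.toFun s) := by
  have h := sideHeight_vertex_nonneg hV l
  rw [not_not.1 hl] at h
  have := sideHeight_edge_nonneg ⟨le_rfl, zero_le_one⟩ ⟨zero_le_one, le_rfl⟩ h
    (sideHeight_vertex_succ_nonneg hV l)
  rwa [add_zero] at this

theorem crossTime_mem (hV : ∀ l, f (δ.vertex l) ≠ c) {l : ℕ} (hl : δ.Crosses f c l) :
    δ.crossTime f c l ∈ Icc ((l : ℝ) / δ.m) ((l + 1) / δ.m) := by
  have h := crossParam_mem hV hl
  exact ⟨div_le_div_of_nonneg_right (by linarith [h.1]) δ.m_pos'.le,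
    div_le_div_of_nonneg_right (by linarith [h.2]) δ.m_pos'.le⟩

variable {G : Bool → Type} [∀ b, Group (G b)] {F : ℝ → CoprodI G}

/-- If each arc of a loop on one side of a line moves `F` by an element of the corresponding
factor, then the syllable length of the displacement of `F` is bounded by the number of
crossings. -/
theorem syllableLength_le_count (hV : ∀ l, f (δ.vertex l) ≠ c)
    (hF : ∀ b x y, 0 ≤ x → x ≤ y → (∀ s ∈ Icc x y, 0 ≤ sideHeight f c b (δ.toFun s)) →
      ∃ g : G b, F y = F x * CoprodI.of g) (k : ℕ) :
    ((F k)⁻¹ * F 0).syllableLength ≤ k * Nat.count (δ.Crosses f c) δ.m + 1 := by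
  have hm := δ.m_pos'
  have key : ∀ l : ℕ, ∃ x : G (δ.side f c l),
      (CoprodI.of x * ((F (l / δ.m))⁻¹ * F 0)).syllableLength ≤
        Nat.count (δ.Crosses f c) l := by
    intro l
    induction l with
    | zero =>
      refine ⟨1, ?_⟩
      simp [CoprodI.syllableLength_one]
    | succ l ih =>
      have hl0 : (0 : ℝ) ≤ l / δ.m := by positivity
      by_cases hl : δ.Crosses f c l
      · obtain ⟨x, hx⟩ := ih
        have hmem := crossTime_mem hV hl
        obtain ⟨g, hg⟩ := hF _ _ _ hl0 hmem.1 (sideHeight_before_cross hV hl)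
        obtain ⟨g', hg'⟩ := hF _ _ _ (hl0.trans hmem.1) hmem.2 (sideHeight_after_cross hV hl)
        refine ⟨g', ?_⟩
        rw [Nat.cast_succ, hg', hg, Nat.count_succ, if_pos hl]
        have e : CoprodI.of g' * ((F (l / δ.m) * CoprodI.of g * CoprodI.of g')⁻¹ * F 0) =
            CoprodI.of (g⁻¹ * x⁻¹) * (CoprodI.of x * ((F (l / δ.m))⁻¹ * F 0)) := by
          simp only [map_mul, map_inv]
          group
        rw [e]
        exact (CoprodI.syllableLength_of_mul_le _ _).trans (Nat.succ_le_succ hx)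
      · obtain ⟨g, hg⟩ := hF _ _ _ hl0 (div_le_div_of_nonneg_right (by linarith) hm.le)
          (sideHeight_of_not_cross hV hl)
        rw [Nat.cast_succ, hg, Nat.count_succ, if_neg hl, add_zero]
        rw [not_not.1 hl] at ih
        obtain ⟨x, hx⟩ := ih
        refine ⟨x * g, ?_⟩
        convert hx using 2
        simp only [map_mul]
        group
  obtain ⟨x, hx⟩ := key (k * δ.m)
  have h := CoprodI.syllableLength_of_mul_le x⁻¹
    (CoprodI.of x * ((F (((k * δ.m : ℕ) : ℝ) / δ.m))⁻¹ * F 0))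
  rw [map_inv, inv_mul_cancel_left, Nat.cast_mul, mul_div_cancel_right₀ _ hm.ne'] at h
  rw [Nat.cast_mul, mul_div_cancel_right₀ _ hm.ne'] at hx
  have hc := count_crosses_mul_add (δ := δ) (f := f) (c := c) k 0
  rw [add_zero, Nat.count_zero, add_zero] at hc
  rw [hc] at hx
  exact h.trans (Nat.succ_le_succ hx)

/-- If each arc of a loop between consecutive crossings of a line moves `F` by a nontrivial
element of the corresponding factor, then the syllable length of the displacement of `F` is the
number of crossings. -/
theorem syllableLength_eq_count (hV : ∀ l, f (δ.vertex l) ≠ c)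
    (hF : ∀ p q, p < q → δ.Crosses f c p → δ.Crosses f c q →
      δ.crossTime f c q ≤ δ.crossTime f c p + 1 →
      (∀ s ∈ Icc (δ.crossTime f c p) (δ.crossTime f c q),
        0 ≤ sideHeight f c (δ.side f c q) (δ.toFun s)) →
      ∃ g : G (δ.side f c q), g ≠ 1 ∧
        F (δ.crossTime f c q) = F (δ.crossTime f c p) * CoprodI.of g)
    {i : ℕ} (hi : δ.Crosses f c i) (k : ℕ) :
    ((F (δ.crossTime f c i + k))⁻¹ * F (δ.crossTime f c i)).syllableLength =
      k * Nat.count (δ.Crosses f c) δ.m := by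
  have hm := δ.m_pos'
  have key : ∀ n : ℕ, ∃ p, i ≤ p ∧ p ≤ i + n ∧ δ.Crosses f c p ∧
      (∀ e, p < e → e ≤ i + n → ¬δ.Crosses f c e) ∧
      (∀ s ∈ Icc (δ.crossTime f c p) (((i + n : ℕ) + 1) / δ.m),
        0 ≤ sideHeight f c (δ.side f c (i + n + 1)) (δ.toFun s)) ∧
      ∃ w : CoprodI.Word G, (F (δ.crossTime f c p))⁻¹ * F (δ.crossTime f c i) = w.prod ∧
        w.fstIdx ≠ some (δ.side f c (i + n + 1)) ∧
        w.toList.length + Nat.count (δ.Crosses f c) i + 1 =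
          Nat.count (δ.Crosses f c) (i + n + 1) := by
    intro n
    induction n with
    | zero =>
      refine ⟨i, le_rfl, le_rfl, hi, fun e h1 h2 => absurd h1 (not_lt.2 h2),
        sideHeight_after_cross hV hi, CoprodI.Word.empty, ?_, ?_, ?_⟩
      · simp
      · simp [CoprodI.Word.fstIdx]
      · rw [add_zero, Nat.count_succ, if_pos hi]
        simp
    | succ n ih =>
      obtain ⟨p, hip, hpn, hp, hno, harc, w, hw, hw1, hwl⟩ := ih
      by_cases hc : δ.Crosses f c (i + n + 1)
      · have hq := crossTime_mem hV hc
        have harc' : ∀ s ∈ Icc (δ.crossTime f c p) (δ.crossTime f c (i + n + 1)),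
            0 ≤ sideHeight f c (δ.side f c (i + n + 1)) (δ.toFun s) := by
          intro s hs
          rcases le_total s (((i + n : ℕ) + 1) / δ.m) with h | h
          · exact harc s ⟨hs.1, h⟩
          · refine sideHeight_before_cross hV hc s ⟨?_, hs.2⟩
            rwa [Nat.cast_succ]
        have hle : δ.crossTime f c (i + n + 1) ≤ δ.crossTime f c p + 1 := by
          rw [← crossTime_add_m]
          have hpm : i + n + 1 ≤ p + δ.m := by
            by_contra hlt
            exact hno (p + δ.m) (by have := δ.m_pos; omega) (by omega) ((crosses_add_m p).2 hp)
          rcases hpm.eq_or_lt with h | h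
          · rw [h]
          · refine hq.2.trans (le_trans ?_ (crossTime_mem hV ((crosses_add_m p).2 hp)).1)
            refine div_le_div_of_nonneg_right ?_ hm.le
            exact_mod_cast h
        obtain ⟨g, hg1, hg⟩ := hF p (i + n + 1) (by omega) hp hc hle harc'
        refine ⟨i + n + 1, by omega, by omega, hc, fun e h1 h2 => by omega, ?_,
          CoprodI.Word.cons g⁻¹ w hw1 (inv_ne_one.2 hg1), ?_, ?_, ?_⟩
        · exact sideHeight_after_cross hV hc
        · rw [CoprodI.Word.prod_cons, ← hw, hg, map_inv]
          group
        · rw [CoprodI.Word.fstIdx_cons]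
          intro h
          exact hc (Option.some_injective _ h)
        · rw [← add_assoc, Nat.count_succ, if_pos hc, ← hwl, CoprodI.Word.cons_toList,
            List.length_cons]
          ring
      · refine ⟨p, hip, by omega, hp, ?_, ?_, w, hw, ?_, ?_⟩
        · intro e h1 h2
          rcases h2.eq_or_lt with rfl | h
          · exact hc
          · exact hno e h1 (by omega)
        · intro s hs
          rcases le_total s (((i + n : ℕ) + 1) / δ.m) with h | h
          · rw [← add_assoc, ← not_not.1 hc]
            exact harc s ⟨hs.1, h⟩
          · refine sideHeight_of_not_cross hV hc s ⟨?_, hs.2⟩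
            rwa [Nat.cast_succ]
        · rw [← add_assoc, ← not_not.1 hc]
          exact hw1
        · rw [← add_assoc, Nat.count_succ, if_neg hc, hwl, add_zero]
  have hper : ∀ k : ℕ, δ.Crosses f c (i + k * δ.m) ∧
      δ.crossTime f c (i + k * δ.m) = δ.crossTime f c i + k := by
    intro k
    induction k with
    | zero => simpa using hi
    | succ k ih =>
      rw [Nat.succ_mul, ← add_assoc, crosses_add_m, crossTime_add_m, ih.2]
      refine ⟨ih.1, ?_⟩
      push_cast
      ring
  obtain ⟨p, hip, hpn, hp, hno, -, w, hw, -, hwl⟩ := key (k * δ.m)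
  obtain rfl : p = i + k * δ.m := by
    by_contra hne
    exact hno _ (lt_of_le_of_ne hpn hne) le_rfl (hper k).1
  rw [← (hper k).2, hw, CoprodI.syllableLength_prod]
  rw [Nat.count_succ, if_pos (hper k).1, add_comm i, count_crosses_mul_add] at hwl
  omega

end PLLoop

end Crossings

section Comparison

open Monoid

theorem exists_pos_le_abs_sub {P : Set Pt} (hP : P.Finite) (f : Pt →L[ℝ] ℝ) {c : ℝ}
    (hc : ∀ p ∈ P, f p ≠ c) : ∃ r > 0, ∀ p ∈ P, r ≤ |f p - c| := by
  rcases P.eq_empty_or_nonempty with rfl | hne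
  · exact ⟨1, one_pos, by simp⟩
  · obtain ⟨p, hp, hmin⟩ := Set.exists_min_image P (fun p => |f p - c|) hP hne
    exact ⟨|f p - c|, abs_pos.2 (sub_ne_zero.2 (hc p hp)), hmin⟩

theorem exists_lt_one_forall_abs_sub_lt {H : ℝ × ℝ → Pt} (hH : Continuous H)
    (hper : ∀ t s, H (t, s + 1) = H (t, s)) (f : Pt →L[ℝ] ℝ) {r : ℝ} (hr : 0 < r) :
    ∃ T, 0 ≤ T ∧ T < 1 ∧ ∀ t ∈ Icc T 1, ∀ s, |f (H (t, s)) - f (H (1, s))| < r := by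
  have hc : IsCompact (Icc (0 : ℝ) 1 ×ˢ Icc (0 : ℝ) 1) := isCompact_Icc.prod isCompact_Icc
  have hu := hc.uniformContinuousOn_of_continuous (f.continuous.comp hH).continuousOn
  obtain ⟨d, hd, hd'⟩ := Metric.uniformContinuousOn_iff.1 hu r hr
  refine ⟨max 0 (1 - d / 2), le_max_left _ _, max_lt one_pos (by linarith), fun t ht s => ?_⟩
  have ht0 := (le_max_left _ _).trans ht.1
  have htd := (le_max_right _ _).trans ht.1
  have hf : ∀ t, H (t, s) = H (t, Int.fract s) := by
    intro t
    have := (show Function.Periodic (fun s => H (t, s)) 1 from hper t).sub_int_mul_eq ⌊s⌋ (x := s)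
    rw [mul_one] at this
    exact this.symm
  have hs : Int.fract s ∈ Icc (0 : ℝ) 1 := ⟨Int.fract_nonneg s, (Int.fract_lt_one s).le⟩
  have := hd' (t, Int.fract s) ⟨⟨ht0, ht.2⟩, hs⟩ (1, Int.fract s) ⟨⟨zero_le_one, le_rfl⟩, hs⟩ (by
    rw [Prod.dist_eq, dist_self, Real.dist_eq, max_lt_iff, abs_lt]
    exact ⟨⟨by linarith, by linarith [ht.2]⟩, hd⟩)
  rw [Real.dist_eq] at this
  rw [hf, hf 1]
  exact this

theorem exists_isLift_of_homotopy {G : Type} [Group G] {P : Set Pt} {w : Pt → Pt → G}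
    (hw : ∀ x, x ∉ P → ∃ V, IsOpen V ∧ x ∈ V ∧ CocycleOn w V)
    {H : ℝ × ℝ → Pt} (hH : Continuous H) (hper : ∀ t s, H (t, s + 1) = H (t, s))
    (hav : ∀ t s, 0 ≤ t → t < 1 → H (t, s) ∉ P) {T : ℝ} (hT0 : 0 ≤ T) (hT1 : T < 1) :
    ∃ F₀ F, IsLift w (fun s => H (0, s)) F₀ ∧ IsLift w (fun s => H (T, s)) F ∧
      ∀ F₀, IsLift w (fun s => H (0, s)) F₀ → ConjDisplacement F₀ F := by
  have hK : Continuous fun z : ℝ × ℝ => H (T * z.1, z.2) := by fun_prop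
  have hKav : ∀ t s, 0 ≤ t → t ≤ 1 → H (T * t, s) ∉ P := fun t s h0 h1 =>
    hav _ _ (mul_nonneg hT0 h0) (by nlinarith)
  obtain ⟨h, hh, hV⟩ := exists_uniform_cocycle hw hK (fun t s => hper _ _) hKav
  have hlift : ∀ t, 0 ≤ t → t ≤ 1 → ∃ F, IsLift w (fun s => H (T * t, s)) F := by
    intro t h0 h1
    refine exists_isLift hh fun s => ?_
    obtain ⟨V, hV1, hV2⟩ := hV t s h0 h1
    exact ⟨V, hV1, fun s' hs' => hV2 t s' (by simpa using hh) hs'⟩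
  obtain ⟨F₀, hF₀⟩ := hlift 0 le_rfl zero_le_one
  obtain ⟨F, hF⟩ := hlift 1 zero_le_one le_rfl
  refine ⟨F₀, F, by simpa using hF₀, by simpa using hF, fun F₁ hF₁ => ?_⟩
  exact conjDisplacement_of_homotopy hw hK (fun t s => hper _ _) hKav (by simpa using hF₁) hF

theorem IsLift.apply_add_natCast {G : Type} [Group G] {w : Pt → Pt → G} {α : ℝ → Pt}
    {F : ℝ → G} (hα : ∀ s, α (s + 1) = α s) (hF : IsLift w α F) {x : ℝ} (hx : 0 ≤ x) (k : ℕ) :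
    F (x + k) = F k * (F 0)⁻¹ * F x := by
  have hαk : ∀ s, α (s + k) = α s := by
    intro s
    have := (show Function.Periodic α 1 from hα).nat_mul k s
    rwa [mul_one] at this
  have key := eq_of_eventually_eq_on_Icc (fun s => F (s + k) * (F s)⁻¹) hx (by
    intro s hs
    have hsub : Icc 0 x ⊆ Ici 0 := fun z hz => hz.1
    have ht : Tendsto (fun s' : ℝ => s' + k) (𝓝[Icc 0 x] s) (𝓝[Ici 0] (s + k)) := by
      refine tendsto_nhdsWithin_iff.2 ⟨?_, ?_⟩
      · exact ((continuous_add_const (k : ℝ)).tendsto s).mono_left nhdsWithin_le_nhds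
      · filter_upwards [self_mem_nhdsWithin] with s' hs'
        exact add_nonneg hs'.1 k.cast_nonneg
    filter_upwards [nhdsWithin_mono _ hsub (hF s hs.1),
      ht.eventually (hF (s + k) (add_nonneg hs.1 k.cast_nonneg))] with s' h1 h2
    rw [h1, h2, hαk, hαk]
    group)
  rw [zero_add] at key
  rw [key]
  group

theorem le_of_forall_mul_le_mul_add {a b C : ℕ} (h : ∀ k : ℕ, k * a ≤ k * b + C) : a ≤ b := by
  by_contra! hlt
  have := h (C + 1)
  nlinarith

/-- A shortest loop crosses a generic line at most as often as any other homotopic loop. -/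
theorem count_crosses_le {P : Set Pt} (hP : P.Finite) {γ δ δ' : PLLoop}
    (h : HomotopicRelExt P γ δ)
    (hmin : ∀ δ' : PLLoop, HomotopicRelExt P γ δ' → δ.length ≤ δ'.length)
    (h' : HomotopicRelExt P γ δ') (f : Pt →L[ℝ] ℝ) {c : ℝ} (hc : ∀ p ∈ P, f p ≠ c)
    (hV : ∀ l, f (δ.vertex l) ≠ c) (hV' : ∀ l, f (δ'.vertex l) ≠ c) :
    Nat.count (δ.Crosses f c) δ.m ≤ Nat.count (δ'.Crosses f c) δ'.m := by
  by_cases hex : ∃ i, δ.Crosses f c i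
  swap
  · push Not at hex
    rw [(Nat.count_iff_forall_not (p := δ.Crosses f c) (n := δ.m)).2 fun l _ => by simp [hex l]]
    exact Nat.zero_le _
  obtain ⟨i, hi⟩ := hex
  obtain ⟨r, hr0, hr⟩ := exists_pos_le_abs_sub hP f hc
  obtain ⟨H, hH, hH0, hH1, hper, hav⟩ := h
  obtain ⟨H', hH', hH0', hH1', hper', hav'⟩ := h'
  obtain ⟨T, hT0, hT1, hT⟩ := exists_lt_one_forall_abs_sub_lt hH hper f hr0
  obtain ⟨T', hT0', hT1', hT'⟩ := exists_lt_one_forall_abs_sub_lt hH' hper' f hr0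
  simp only [hH1] at hT
  simp only [hH1'] at hT'
  have hclose : ∀ {a b : ℝ}, |a - b| < r → ∀ β : Bool,
      0 ≤ (if β then b - c else c - b) → -r < if β then a - c else c - a := by
    intro a b hab β
    rw [abs_lt] at hab
    cases β <;> simp <;> intro _ <;> linarith [hab.1, hab.2]
  have hstrip := strip_subset_sideSet (f := f) (c := c) hr
  have hS : ∀ b, Nonempty (TransitionSystem (sideSet P f c r b) (strip f c r)) := by
    intro b
    refine exists_transitionSystem (isOpen_sideSet hP b) convex_strip (hstrip b)
      (δ.toFun (δ.crossTime f c i)) ?_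
    change |f _ - c| < r
    rwa [PLLoop.apply_crossTime hV hi, sub_self, abs_zero]
  obtain ⟨S⟩ := Classical.nonempty_pi.2 hS
  have hw := gluedTransition_local S hP hr0
  obtain ⟨F₀, F, hF₀, hF, hconj⟩ := exists_isLift_of_homotopy hw hH hper hav hT0 hT1
  obtain ⟨-, F', -, hF', hconj'⟩ := exists_isLift_of_homotopy hw hH' hper' hav' hT0' hT1'
  obtain ⟨u, hu⟩ := (hconj F₀ hF₀).symm.trans (hconj' F₀ (by simpa only [hH0, hH0'] using hF₀))
  have hup := PLLoop.syllableLength_le_count (F := F') hV' (by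
    intro b x y hx hxy hb
    obtain ⟨g, hg, -⟩ := hF'.exists_of_mem_sideSet S (by fun_prop) hx hxy (b := b) fun s hs =>
      ⟨hav' T' s hT0' hT1', hclose (hT' T' ⟨le_rfl, hT1'.le⟩ s) b (hb s hs)⟩
    exact ⟨g, hg⟩)
  have hlow := PLLoop.syllableLength_eq_count (F := F) hV (by
    intro p q hpq hp hq hyx hb
    have hx0 : 0 ≤ δ.crossTime f c p := by
      refine le_trans ?_ (PLLoop.crossTime_mem hV hp).1
      positivity
    have hxy : δ.crossTime f c p ≤ δ.crossTime f c q := by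
      refine (PLLoop.crossTime_mem hV hp).2.trans
        (le_trans ?_ (PLLoop.crossTime_mem hV hq).1)
      refine div_le_div_of_nonneg_right ?_ δ.m_pos'.le
      exact_mod_cast hpq
    obtain ⟨g, hg, hK⟩ := hF.exists_of_mem_sideSet S (by fun_prop) hx0 hxy
      (b := δ.side f c q) fun s hs =>
      ⟨hav T s hT0 hT1, hclose (hT T ⟨le_rfl, hT1.le⟩ s) _ (hb s hs)⟩
    refine ⟨g, ?_, hg⟩
    rintro rfl
    have hmem : ∀ l, δ.Crosses f c l → ∀ t ∈ Icc T 1, H (t, δ.crossTime f c l) ∈ strip f c r := by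
      intro l hl t ht
      have := hT t ht (δ.crossTime f c l)
      rwa [PLLoop.apply_crossTime hV hl] at this
    have hTm : T ∈ Icc T 1 := ⟨le_rfl, hT1.le⟩
    obtain ⟨K, hKc, hKm, hK0, hK1, hKx, hKy⟩ := hK (hmem p hp T hTm) (hmem q hq T hTm) rfl
    have hpp := PLLoop.crossParam_mem hV hp
    have hqq := PLLoop.crossParam_mem hV hq
    have hlt : δ.crossTime f c p < δ.crossTime f c q := by
      refine div_lt_div_of_pos_right ?_ δ.m_pos'
      have : (p : ℝ) + 1 ≤ q := by exact_mod_cast hpq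
      linarith [hpp.2, hqq.1]
    have hsc := loopHtpy_shortcut hH hper hav hT0 hT1 hlt hyx convex_strip
      (fun x hx => (hstrip true hx).1) (hmem p hp) (hmem q hq) hKc (fun z => (hKm z).1)
      hK0 hK1 hKx hKy
    simp only [hH0, hH1] at hsc
    obtain ⟨δ₁, hδ₁, hlen⟩ := PLLoop.exists_length_lt_of_shortcut f ⟨hpp.1.le, hpp.2.le⟩
      ⟨hqq.1.le, hqq.2.le⟩ hpq hyx (PLLoop.apply_crossTime hV hp)
      (PLLoop.apply_crossTime hV hq) (hV (p + 1)) hsc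
    exact absurd (hmin δ₁ hδ₁) (not_le.2 hlen)) hi
  have hx0 : 0 ≤ δ.crossTime f c i := by
    refine le_trans ?_ (PLLoop.crossTime_mem hV hi).1
    positivity
  set v := (F 0)⁻¹ * F (δ.crossTime f c i) with hv
  refine le_of_forall_mul_le_mul_add (C := v⁻¹.syllableLength + u.syllableLength + 1
    + u⁻¹.syllableLength + v.syllableLength) fun k => ?_
  rw [← hlow k, hF.apply_add_natCast (hper T) hx0 k]
  have e : (F k * (F 0)⁻¹ * F (δ.crossTime f c i))⁻¹ * F (δ.crossTime f c i) =
      v⁻¹ * (u * (((F' k)⁻¹ * F' 0) * (u⁻¹ * v))) := by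
    have h1 : (F' k)⁻¹ * F' 0 = u⁻¹ * ((F k)⁻¹ * F 0) * u := by
      have := congrArg (fun g => u⁻¹ * g⁻¹ * u) (hu k)
      simp only [mul_inv_rev, inv_inv] at this
      rw [this]
      group
    rw [h1, hv]
    group
  rw [e]
  have h1 := CoprodI.syllableLength_mul_le v⁻¹ (u * (((F' k)⁻¹ * F' 0) * (u⁻¹ * v)))
  have h2 := CoprodI.syllableLength_mul_le u (((F' k)⁻¹ * F' 0) * (u⁻¹ * v))
  have h3 := CoprodI.syllableLength_mul_le ((F' k)⁻¹ * F' 0) (u⁻¹ * v)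
  have h4 := CoprodI.syllableLength_mul_le u⁻¹ v
  have h5 := hup k
  omega

end Comparison

section Crofton

open MeasureTheory Real

theorem exists_polar (v : Pt) : ∃ φ, ∀ θ,
    cos θ * v 0 + sin θ * v 1 = ‖v‖ * cos (θ - φ) := by
  have hn : ‖v‖ = ‖(⟨v 0, v 1⟩ : ℂ)‖ := by
    rw [EuclideanSpace.norm_eq, Complex.norm_def, Complex.normSq_mk, Fin.sum_univ_two]
    simp [sq]
  refine ⟨Complex.arg ⟨v 0, v 1⟩, fun θ => ?_⟩
  have h0 := Complex.norm_mul_cos_arg (⟨v 0, v 1⟩ : ℂ)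
  have h1 := Complex.norm_mul_sin_arg (⟨v 0, v 1⟩ : ℂ)
  dsimp only at h0 h1
  rw [hn, cos_sub]
  linear_combination (-cos θ) * h0 - sin θ * h1

theorem integral_abs_dual (v : Pt) :
    ∫ θ in (0 : ℝ)..(2 * π), |cos θ * v 0 + sin θ * v 1| =
      ‖v‖ * ∫ θ in (0 : ℝ)..(2 * π), |cos θ| := by
  obtain ⟨φ, hφ⟩ := exists_polar v
  simp only [hφ, abs_mul, abs_norm]
  rw [intervalIntegral.integral_const_mul, intervalIntegral.integral_comp_sub_right
    (fun θ => |cos θ|)]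
  have hp : Function.Periodic (fun θ => |cos θ|) (2 * π) := fun θ => by simp
  have := hp.intervalIntegral_add_eq (0 - φ) 0
  rw [zero_add, show 0 - φ + 2 * π = 2 * π - φ by ring] at this
  rw [this]

/-- If one finite family of vectors has smaller total width than another in every direction, it
also has smaller total length. -/
theorem sum_norm_le_of_forall_dual {ι κ : Type} (s : Finset ι) (t : Finset κ) (u : ι → Pt)
    (v : κ → Pt) (h : ∀ g : Pt →L[ℝ] ℝ, ∑ i ∈ s, |g (u i)| ≤ ∑ k ∈ t, |g (v k)|) :
    ∑ i ∈ s, ‖u i‖ ≤ ∑ k ∈ t, ‖v k‖ := by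
  have hC : 0 < ∫ θ in (0 : ℝ)..(2 * π), |cos θ| :=
    intervalIntegral.integral_pos two_pi_pos (by fun_prop) (fun θ _ => abs_nonneg _)
      ⟨0, ⟨le_rfl, two_pi_pos.le⟩, by simp⟩
  have hle : ∫ θ in (0 : ℝ)..(2 * π), ∑ i ∈ s, |cos θ * u i 0 + sin θ * u i 1| ≤
      ∫ θ in (0 : ℝ)..(2 * π), ∑ k ∈ t, |cos θ * v k 0 + sin θ * v k 1| := by
    refine intervalIntegral.integral_mono_on two_pi_pos.le
      (Continuous.intervalIntegrable (by fun_prop) _ _)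
      (Continuous.intervalIntegrable (by fun_prop) _ _) fun θ _ => ?_
    exact h (cos θ • (EuclideanSpace.proj 0 : Pt →L[ℝ] ℝ) +
      sin θ • (EuclideanSpace.proj 1 : Pt →L[ℝ] ℝ))
  rw [intervalIntegral.integral_finsetSum fun i _ => Continuous.intervalIntegrable
      (by fun_prop) _ _,
    intervalIntegral.integral_finsetSum fun i _ => Continuous.intervalIntegrable
      (by fun_prop) _ _] at hle
  simp only [integral_abs_dual, ← Finset.sum_mul] at hle
  exact le_of_mul_le_mul_right hle hC

theorem PLLoop.count_crosses_eq (δ : PLLoop) (f : Pt →L[ℝ] ℝ) (c : ℝ) :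
    (Nat.count (δ.Crosses f c) δ.m : ℝ) = ∑ l ∈ Finset.range δ.m,
      (Ico (min (f (δ.vertex l)) (f (δ.vertex (l + 1))))
        (max (f (δ.vertex l)) (f (δ.vertex (l + 1))))).indicator 1 c := by
  rw [Nat.count_eq_card_filter_range, Finset.card_filter, Nat.cast_sum]
  refine Finset.sum_congr rfl fun l _ => ?_
  have : δ.Crosses f c l ↔ c ∈ Ico (min (f (δ.vertex l)) (f (δ.vertex (l + 1))))
      (max (f (δ.vertex l)) (f (δ.vertex (l + 1)))) := by
    simp only [PLLoop.Crosses, PLLoop.side, ne_eq, decide_eq_decide, mem_Ico, min_le_iff,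
      lt_max_iff]
    simp only [← not_lt]
    tauto
  simp only [this, indicator_apply, Pi.one_apply]
  split_ifs <;> simp

theorem integral_sum_indicator_Ico {s : Finset ℕ} (a b : ℕ → ℝ) :
    Integrable (fun c : ℝ => ∑ l ∈ s,
      (Ico (min (a l) (b l)) (max (a l) (b l))).indicator (1 : ℝ → ℝ) c) ∧
    ∫ c : ℝ, ∑ l ∈ s, (Ico (min (a l) (b l)) (max (a l) (b l))).indicator (1 : ℝ → ℝ) c =
      ∑ l ∈ s, |b l - a l| := by
  have hi : ∀ l ∈ s, Integrable fun c : ℝ =>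
      (Ico (min (a l) (b l)) (max (a l) (b l))).indicator (1 : ℝ → ℝ) c := fun l _ =>
    (integrable_indicator_iff measurableSet_Ico).2
      (integrableOn_const (by simp))
  refine ⟨integrable_finsetSum _ hi, ?_⟩
  rw [integral_finsetSum _ hi]
  refine Finset.sum_congr rfl fun l _ => ?_
  rw [integral_indicator_one measurableSet_Ico, Real.volume_real_Ico_of_le min_le_max,
    max_sub_min_eq_abs]

theorem sum_abs_dual_le {P : Set Pt} (hP : P.Finite) {γ δ δ' : PLLoop}
    (h : HomotopicRelExt P γ δ)
    (hmin : ∀ δ' : PLLoop, HomotopicRelExt P γ δ' → δ.length ≤ δ'.length)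
    (h' : HomotopicRelExt P γ δ') (f : Pt →L[ℝ] ℝ) :
    ∑ l ∈ Finset.range δ.m, |f (δ.vertex (l + 1)) - f (δ.vertex l)| ≤
      ∑ l ∈ Finset.range δ'.m, |f (δ'.vertex (l + 1)) - f (δ'.vertex l)| := by
  have h1 := integral_sum_indicator_Ico (s := Finset.range δ.m) (fun l => f (δ.vertex l))
    (fun l => f (δ.vertex (l + 1)))
  have h2 := integral_sum_indicator_Ico (s := Finset.range δ'.m) (fun l => f (δ'.vertex l))
    (fun l => f (δ'.vertex (l + 1)))
  rw [← h1.2, ← h2.2]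
  refine integral_mono_ae h1.1 h2.1 ?_
  have hb : (f '' P ∪ (range (fun l => f (δ.vertex l)) ∪ range
      fun l => f (δ'.vertex l))).Countable :=
    (hP.image f).countable.union ((countable_range _).union (countable_range _))
  filter_upwards [hb.ae_notMem volume] with c hc
  simp only [mem_union, mem_image, mem_range, not_or, not_exists, not_and] at hc
  rw [← δ.count_crosses_eq, ← δ'.count_crosses_eq]
  exact Nat.cast_le.2 (count_crosses_le hP h hmin h' f hc.1 hc.2.1 hc.2.2)

end Crofton

section Affine

theorem PLLoop.affMap_vertex (A : Pt ≃ₗ[ℝ] Pt) (b : Pt) (γ : PLLoop) (l : ℕ) :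
    (γ.affMap A b).vertex l = A (γ.vertex l) + b := rfl

theorem PLLoop.affMap_toFun (A : Pt ≃ₗ[ℝ] Pt) (b : Pt) (γ : PLLoop) (s : ℝ) :
    (γ.affMap A b).toFun s = A (γ.toFun s) + b := by
  have h : ∀ (θ : ℝ) (p q : Pt), (1 - θ) • (A p + b) + θ • (A q + b) =
      A ((1 - θ) • p + θ • q) + b := fun θ p q => by
    rw [map_add, map_smul, map_smul]
    module
  exact h _ _ _

theorem HomotopicRelExt.affMap {P : Set Pt} {γ δ : PLLoop} (h : HomotopicRelExt P γ δ)
    (A : Pt ≃ₗ[ℝ] Pt) (b : Pt) :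
    HomotopicRelExt ((fun x => A x + b) '' P) (γ.affMap A b) (δ.affMap A b) := by
  obtain ⟨H, hc, h0, h1, hper, hav⟩ := h
  have hA : Continuous A := A.toLinearMap.continuous_of_finiteDimensional
  refine ⟨fun x => A (H x) + b, by fun_prop, fun s => ?_, fun s => ?_, fun t s => ?_,
    fun t s ht0 ht1 => ?_⟩
  · simp only [h0, PLLoop.affMap_toFun]
  · simp only [h1, PLLoop.affMap_toFun]
  · simp only [hper]
  · rintro ⟨p, hp, hpe⟩
    exact hav t s ht0 ht1 (A.injective (add_right_cancel hpe) ▸ hp)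

theorem PLLoop.affMap_affMap_symm (A : Pt ≃ₗ[ℝ] Pt) (b : Pt) (γ : PLLoop) :
    (γ.affMap A b).affMap A.symm (-A.symm b) = γ := by
  simp [PLLoop.affMap]

theorem PLLoop.affMap_symm_affMap (A : Pt ≃ₗ[ℝ] Pt) (b : Pt) (γ : PLLoop) :
    (γ.affMap A.symm (-A.symm b)).affMap A b = γ := by
  simp [PLLoop.affMap]

theorem PLLoop.length_affMap (A : Pt ≃ₗ[ℝ] Pt) (b : Pt) (γ : PLLoop) :
    (γ.affMap A b).length =
      ∑ l ∈ Finset.range γ.m, ‖A (γ.vertex (l + 1)) - A (γ.vertex l)‖ := by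
  rw [PLLoop.length_eq_sum]
  refine Finset.sum_congr rfl fun l _ => ?_
  rw [PLLoop.edgeLength, dist_comm, dist_eq_norm, PLLoop.affMap_vertex, PLLoop.affMap_vertex,
    add_sub_add_right_eq_sub]

end Affine

/-- Shortest homotopic curves are invariant under invertible affine
transformations `T = (x ↦ A x + b)`: if `δ` is a shortest piecewise-linear loop
homotopic rel `P` in the extended sense to `γ`, then `T ∘ δ` is a shortest
piecewise-linear loop homotopic rel `T(P)` in the extended sense to `T ∘ γ`. -/
theorem shortest_homotopic_affine_invariant (P : Set Pt) (hP : P.Finite)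
    (γ δ : PLLoop) (hγ : γ.image ∩ P = ∅)
    (hhom : HomotopicRelExt P γ δ)
    (hmin : ∀ δ' : PLLoop, HomotopicRelExt P γ δ' → δ.length ≤ δ'.length)
    (A : Pt ≃ₗ[ℝ] Pt) (b : Pt) :
    HomotopicRelExt ((fun x => A x + b) '' P) (γ.affMap A b) (δ.affMap A b) ∧
      ∀ δ' : PLLoop, HomotopicRelExt ((fun x => A x + b) '' P) (γ.affMap A b) δ' →
        (δ.affMap A b).length ≤ δ'.length := by
  refine ⟨hhom.affMap A b, fun δ' h' => ?_⟩
  have h'' : HomotopicRelExt P γ (δ'.affMap A.symm (-A.symm b)) := by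
    have := h'.affMap A.symm (-A.symm b)
    rwa [PLLoop.affMap_affMap_symm, image_image, image_congr (g := id) (by simp), image_id]
      at this
  rw [← δ'.affMap_symm_affMap A b, PLLoop.length_affMap, PLLoop.length_affMap]
  refine sum_norm_le_of_forall_dual _ _ _ _ fun g => ?_
  simpa using sum_abs_dual_le hP hhom hmin h''
    (g.comp A.toContinuousLinearEquiv.toContinuousLinearMap)

end
end

section
/- Let P ⊂ ℝ² be a finite set of point obstacles, let γ be a piecewise-linear loop whose image is disjoint from P, and let δ be a nonconstant piecewise-linear loop of minimal length among all piecewise-linear loops homotopic rel P in the extended sense to γ, given by a cyclic vertex sequence v₀,…,v_{m−1} with cyclically consecutive vertices distinct. Then every genuine corner of δ lies at an obstacle: for every index i such that v_i does not lie strictly between v_{i−1} and v_{i+1} on the segment from v_{i−1} to v_{i+1} (i.e., the unsigned angle ∠v_{i−1}v_iv_{i+1} is not equal to π), the vertex v_i belongs to P. -/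
/-!
Statement 4: every genuine corner of a shortest homotopic piecewise-linear loop
lies at an obstacle point.
-/

/-!
Statement 0: existence of a shortest piecewise-linear loop homotopic rel `P`
(in the extended sense) to a given piecewise-linear loop avoiding `P`.
-/

noncomputable section

theorem PLLoop.toFun_add_intCast (δ : PLLoop) (t : ℝ) (n : ℤ) :
    δ.toFun (t + n) = δ.toFun t := by
  simp [PLLoop.toFun]

/-- On each edge, a piecewise-linear loop is given by the affine interpolation of its
endpoints. -/
theorem PLLoop.toFun_eq_lineMap (δ : PLLoop) (t : ℝ) (n : ℤ) (h₁ : (n : ℝ) ≤ t * δ.m)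
    (h₂ : t * δ.m ≤ n + 1) :
    δ.toFun t = AffineMap.lineMap (δ.v (n : ZMod δ.m)) (δ.v ((n + 1 : ℤ) : ZMod δ.m))
      (t * δ.m - n) := by
  have hx : Int.fract t * δ.m = t * δ.m - ((⌊t⌋ * δ.m : ℤ) : ℝ) := by
    rw [Int.fract]; push_cast; ring
  have hfloor : ⌊Int.fract t * δ.m⌋ = ⌊t * δ.m⌋ - ⌊t⌋ * δ.m := by
    rw [hx, Int.floor_sub_intCast]
  have key : δ.toFun t = AffineMap.lineMap (δ.v ((⌊t * δ.m⌋ : ℤ) : ZMod δ.m))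
      (δ.v ((⌊t * δ.m⌋ + 1 : ℤ) : ZMod δ.m)) (t * δ.m - ⌊t * δ.m⌋) := by
    simp only [PLLoop.toFun]
    rw [hfloor, hx, AffineMap.lineMap_apply_module]
    push_cast
    simp
  rw [key]
  rcases h₂.lt_or_eq with h | h
  · have : ⌊t * δ.m⌋ = n := Int.floor_eq_iff.2 ⟨h₁, h⟩
    rw [this]
  · have : ⌊t * δ.m⌋ = n + 1 := Int.floor_eq_iff.2 ⟨by simp [h], by simp [h]⟩
    rw [this, h]
    simp

theorem PLLoop.toFun_div (δ : PLLoop) (n : ℤ) :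
    δ.toFun ((n : ℝ) / δ.m) = δ.v (n : ZMod δ.m) := by
  have hm : (δ.m : ℝ) ≠ 0 := by exact_mod_cast δ.m_pos.ne'
  rw [δ.toFun_eq_lineMap _ n (by rw [div_mul_cancel₀ _ hm]) (by rw [div_mul_cancel₀ _ hm]; simp)]
  rw [div_mul_cancel₀ _ hm]
  simp

theorem PLLoop.continuous_toFun (δ : PLLoop) : Continuous δ.toFun := by
  rw [continuous_iff_continuousAt]
  intro t₀
  set n : ℤ := ⌊t₀ * δ.m⌋
  set A := δ.v (n : ZMod δ.m)
  set B := δ.v ((n + 1 : ℤ) : ZMod δ.m)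
  set C := δ.v ((n - 1 : ℤ) : ZMod δ.m)
  have hcont : Continuous fun t : ℝ =>
      A + (max 0 (t * δ.m - n)) • (B - A) + (max 0 (n - t * δ.m)) • (C - A) := by fun_prop
  refine hcont.continuousAt.congr ?_
  have hopen : IsOpen {t : ℝ | (n : ℝ) - 1 < t * δ.m ∧ t * δ.m < n + 1} := by
    refine IsOpen.and ?_ ?_ <;> exact isOpen_lt (by fun_prop) (by fun_prop)
  have hmem : t₀ ∈ {t : ℝ | (n : ℝ) - 1 < t * δ.m ∧ t * δ.m < n + 1} :=
    ⟨by linarith [Int.floor_le (t₀ * δ.m)], Int.lt_floor_add_one _⟩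
  filter_upwards [hopen.mem_nhds hmem] with t ht
  obtain ⟨h₁, h₂⟩ := ht
  rcases le_total (n : ℝ) (t * δ.m) with h | h
  · rw [δ.toFun_eq_lineMap t n h h₂.le, max_eq_right (by linarith), max_eq_left (by linarith),
      AffineMap.lineMap_apply_module]
    module
  · rw [δ.toFun_eq_lineMap t (n - 1) (by push_cast; linarith) (by push_cast; linarith),
      max_eq_left (by linarith), max_eq_right (by linarith), AffineMap.lineMap_apply_module,
      sub_add_cancel, Int.cast_sub n 1 (R := ℝ), Int.cast_one]
    module

/-- The loop obtained by dividing every edge into `N` edges of equal length. -/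
def PLLoop.subdivide (δ : PLLoop) (N : ℕ) (hN : 0 < N) : PLLoop where
  m := δ.m * N
  m_pos := Nat.mul_pos δ.m_pos hN
  v k := δ.toFun ((k.val : ℝ) / (δ.m * N : ℕ))

theorem PLLoop.subdivide_v (δ : PLLoop) (N : ℕ) (hN : 0 < N) (n : ℤ) :
    (δ.subdivide N hN).v (n : ZMod (δ.m * N)) = δ.toFun ((n : ℝ) / (δ.m * N)) := by
  have hM : 0 < δ.m * N := Nat.mul_pos δ.m_pos hN
  have : NeZero (δ.m * N) := ⟨hM.ne'⟩
  have hMne : ((δ.m * N : ℕ) : ℝ) ≠ 0 := by exact_mod_cast hM.ne'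
  have hval := ZMod.val_intCast (n := δ.m * N) n
  have hdiv := Int.emod_add_mul_ediv n (δ.m * N : ℕ)
  rw [← hval] at hdiv
  have hdiv' : ((n : ZMod (δ.m * N)).val : ℝ) + (δ.m * N : ℕ) * ((n / (δ.m * N : ℕ) : ℤ) : ℝ)
      = n := by exact_mod_cast hdiv
  change δ.toFun _ = _
  rw [← δ.toFun_add_intCast _ (n / (δ.m * N : ℕ))]
  congr 1
  rw [← Nat.cast_mul, eq_div_iff hMne, ← hdiv', add_mul, div_mul_cancel₀ _ hMne]
  ring

/-- The vertices of a subdivision, in terms of the vertices of the original loop. -/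
theorem PLLoop.subdivide_v_eq_lineMap (δ : PLLoop) (N : ℕ) (hN : 0 < N) (j n : ℤ)
    (h₁ : n * N ≤ j) (h₂ : j ≤ (n + 1) * N) :
    (δ.subdivide N hN).v (j : ZMod (δ.m * N)) =
      AffineMap.lineMap (δ.v (n : ZMod δ.m)) (δ.v ((n + 1 : ℤ) : ZMod δ.m))
        ((j : ℝ) / N - n) := by
  have hm : (δ.m : ℝ) ≠ 0 := by exact_mod_cast δ.m_pos.ne'
  have hN' : (0 : ℝ) < N := by exact_mod_cast hN
  have h : (j : ℝ) / (δ.m * N) * δ.m = j / N := by field_simp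
  have h₁' : (n : ℝ) * N ≤ j := by exact_mod_cast h₁
  have h₂' : (j : ℝ) ≤ (n + 1) * N := by exact_mod_cast h₂
  rw [δ.subdivide_v, δ.toFun_eq_lineMap _ n, h]
  · rw [h, le_div_iff₀ hN']; exact h₁'
  · rw [h, div_le_iff₀ hN']; exact h₂'

theorem Int.mul_ediv_le_and_add_one_le (j : ℤ) {N : ℕ} (hN : 0 < N) :
    j / N * N ≤ j ∧ j + 1 ≤ (j / N + 1) * N := by
  have hN' : (0 : ℤ) < N := by exact_mod_cast hN
  exact ⟨Int.ediv_mul_le _ hN'.ne', by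
    have := Int.lt_ediv_add_one_mul_self j hN'
    omega⟩

theorem PLLoop.toFun_subdivide (δ : PLLoop) (N : ℕ) (hN : 0 < N) :
    (δ.subdivide N hN).toFun = δ.toFun := by
  funext t
  have hN' : (0 : ℝ) < N := by exact_mod_cast hN
  have hcast : ((δ.subdivide N hN).m : ℝ) = δ.m * N := by simp [PLLoop.subdivide]
  set j : ℤ := ⌊t * (δ.subdivide N hN).m⌋
  have hj₁ : (j : ℝ) ≤ t * (δ.subdivide N hN).m := Int.floor_le _
  have hj₂ : t * (δ.subdivide N hN).m ≤ j + 1 := (Int.lt_floor_add_one _).le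
  obtain ⟨hn₁, hn₂⟩ := Int.mul_ediv_le_and_add_one_le j hN
  rw [(δ.subdivide N hN).toFun_eq_lineMap t j hj₁ hj₂]
  set n : ℤ := j / N
  have hn₁' : (n : ℝ) * N ≤ j := by exact_mod_cast hn₁
  have hn₂' : (j : ℝ) + 1 ≤ (n + 1) * N := by exact_mod_cast hn₂
  rw [hcast] at hj₁ hj₂ ⊢
  rw [δ.toFun_eq_lineMap t n (by nlinarith) (by nlinarith)]
  have e₁ := δ.subdivide_v_eq_lineMap N hN j n hn₁ (by omega)
  have e₂ := δ.subdivide_v_eq_lineMap N hN (j + 1) n (by omega) hn₂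
  refine (congrArg₂ (fun a b => AffineMap.lineMap a b _) e₁ e₂).trans ?_
  rw [← AffineMap.apply_lineMap]
  congr 1
  rw [AffineMap.lineMap_apply_ring']
  push_cast
  field_simp
  ring

theorem Finset.sum_range_mul_div {M : Type*} [AddCommMonoid M] (f : ℕ → M) (m : ℕ) {N : ℕ}
    (hN : 0 < N) :
    ∑ j ∈ Finset.range (m * N), f (j / N) = N • ∑ i ∈ Finset.range m, f i := by
  induction m with
  | zero => simp
  | succ m ih =>
    rw [Nat.succ_mul, Finset.sum_range_add, ih, Finset.sum_range_succ, smul_add]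
    congr 1
    rw [Finset.sum_congr rfl (g := fun _ => f m), Finset.sum_const, Finset.card_range]
    intro x hx
    rw [Nat.mul_comm, Nat.mul_add_div hN, Nat.div_eq_of_lt (Finset.mem_range.1 hx), add_zero]

theorem PLLoop.length_subdivide (δ : PLLoop) (N : ℕ) (hN : 0 < N) :
    (δ.subdivide N hN).length = δ.length := by
  have hNne : (N : ℝ) ≠ 0 := by exact_mod_cast hN.ne'
  let w : ZMod (δ.m * N) → Pt := (δ.subdivide N hN).v
  have hedge : ∀ j : ℕ, dist (w (j : ZMod (δ.m * N))) (w ((j : ZMod (δ.m * N)) + 1)) =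
      (fun i : ℕ => dist (δ.v (i : ZMod δ.m)) (δ.v ((i : ZMod δ.m) + 1)) / N) (j / N) := by
    intro j
    obtain ⟨hn₁, hn₂⟩ := Int.mul_ediv_le_and_add_one_le (j : ℤ) hN
    have e₁ : w _ = _ := δ.subdivide_v_eq_lineMap N hN j _ hn₁ (by omega)
    have e₂ : w _ = _ := δ.subdivide_v_eq_lineMap N hN (j + 1) _ (by omega) hn₂
    have hc : ((j : ℤ) / (N : ℤ)) = ((j / N : ℕ) : ℤ) := by simp
    rw [hc] at e₁ e₂
    rw [Int.cast_natCast] at e₁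
    have hc₂ : (((j : ℤ) + 1 : ℤ) : ZMod (δ.m * N)) = (j : ZMod (δ.m * N)) + 1 := by push_cast; rfl
    rw [hc₂] at e₂
    rw [e₁, e₂, dist_lineMap_lineMap, Real.dist_eq]
    have hd : (((j : ℤ) : ℝ) / N - ((j / N : ℕ) : ℤ) -
        ((((j : ℤ) + 1 : ℤ) : ℝ) / N - ((j / N : ℕ) : ℤ))) = -(1 / N) := by
      push_cast; ring
    rw [hd, abs_neg, abs_of_pos (by positivity), one_div_mul_eq_div, Int.cast_add, Int.cast_one,
      Int.cast_natCast]
  change ∑ j ∈ Finset.range (δ.m * N),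
    dist (w (j : ZMod (δ.m * N))) (w ((j : ZMod (δ.m * N)) + 1)) = _
  rw [Finset.sum_congr rfl fun j _ => hedge j, Finset.sum_range_mul_div
      (fun i : ℕ => dist (δ.v (i : ZMod δ.m)) (δ.v ((i : ZMod δ.m) + 1)) / N) _ hN, PLLoop.length,
    ← Finset.sum_div, nsmul_eq_mul, mul_div_cancel₀ _ hNne]

/-- The loop obtained by moving the vertex `k` to `p`. -/
def PLLoop.moveVertex (δ : PLLoop) (k : ZMod δ.m) (p : Pt) : PLLoop where
  m := δ.m
  m_pos := δ.m_pos
  v := Function.update δ.v k p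

theorem PLLoop.length_eq_sum_zmod (δ : PLLoop) [NeZero δ.m] :
    δ.length = ∑ i : ZMod δ.m, dist (δ.v i) (δ.v (i + 1)) := by
  rw [PLLoop.length]
  refine Finset.sum_bij (fun a _ => (a : ZMod δ.m)) (fun _ _ => Finset.mem_univ _) ?_ ?_
    (fun _ _ => rfl)
  · intro a ha b hb h
    have := congrArg ZMod.val h
    rwa [ZMod.val_cast_of_lt (Finset.mem_range.1 ha),
      ZMod.val_cast_of_lt (Finset.mem_range.1 hb)] at this
  · intro b _
    exact ⟨b.val, Finset.mem_range.2 (ZMod.val_lt b), ZMod.natCast_zmod_val b⟩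

/-- Moving a vertex onto its successor shortens the loop, unless the vertex lies between its
neighbours. -/
theorem PLLoop.length_moveVertex_lt (δ : PLLoop) (hm : 1 < δ.m) (k : ZMod δ.m)
    (h : dist (δ.v (k - 1)) (δ.v (k + 1)) <
      dist (δ.v (k - 1)) (δ.v k) + dist (δ.v k) (δ.v (k + 1))) :
    (δ.moveVertex k (δ.v (k + 1))).length < δ.length := by
  have : NeZero δ.m := ⟨by omega⟩
  have : NeZero (δ.moveVertex k (δ.v (k + 1))).m := ⟨by change δ.m ≠ 0; omega⟩
  have : Fact (1 < δ.m) := ⟨hm⟩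
  have hk : k - 1 ≠ k := by simp
  have hk' : k + 1 ≠ k := by simp
  rw [PLLoop.length_eq_sum_zmod, PLLoop.length_eq_sum_zmod]
  change ∑ i : ZMod δ.m, dist (Function.update δ.v k (δ.v (k + 1)) i)
    (Function.update δ.v k (δ.v (k + 1)) (i + 1)) < _
  rw [← Finset.sum_add_sum_compl {k - 1, k}, ← Finset.sum_add_sum_compl {k - 1, k}
    fun i : ZMod δ.m => dist (δ.v i) (δ.v (i + 1))]
  refine add_lt_add_of_lt_of_le ?_ (Finset.sum_le_sum fun i hi => ?_)
  · rw [Finset.sum_pair hk, Finset.sum_pair hk]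
    simpa [Function.update_of_ne hk, Function.update_of_ne hk'] using h
  · simp only [Finset.mem_compl, Finset.mem_insert, Finset.mem_singleton, not_or] at hi
    rw [Function.update_of_ne hi.2,
      Function.update_of_ne fun heq => hi.1 (eq_sub_of_add_eq heq)]

/-- The end of an extended homotopy may be perturbed by straight-line motion, as long as the
moving part stays at a positive distance from the obstacles. -/
theorem HomotopicRelExt.perturb {P : Set Pt} {γ δ δ' : PLLoop} (h : HomotopicRelExt P γ δ)
    {ε : ℝ} (hε : 0 < ε)
    (hδ : ∀ s, δ'.toFun s = δ.toFun s ∨ ∀ l ∈ Set.Icc (0 : ℝ) 1, ∀ p ∈ P,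
      ε ≤ dist (AffineMap.lineMap (δ.toFun s) (δ'.toFun s) l) p) :
    HomotopicRelExt P γ δ' := by
  obtain ⟨H, hH, h0, h1, hper, hP⟩ := h
  obtain ⟨t₀, ht₀, ht₁, hclose⟩ : ∃ t₀ : ℝ, 0 < t₀ ∧ t₀ < 1 ∧ ∀ t, t₀ ≤ t → t < 1 → ∀ s,
      dist (H (t, s)) (δ.toFun s) < ε := by
    have hev : ∀ᶠ t in nhds (1 : ℝ), ∀ s ∈ Set.Icc (0 : ℝ) 1, dist (H (t, s)) (H (1, s)) < ε := by
      refine isCompact_Icc.eventually_forall_of_forall_eventually fun s _ => ?_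
      have hc : Continuous fun q : ℝ × ℝ => dist (H (q.1, q.2)) (H (1, q.2)) := by fun_prop
      exact hc.continuousAt.eventually_lt continuousAt_const (by simpa using hε)
    obtain ⟨η, hη, hball⟩ := Metric.eventually_nhds_iff.1 hev
    refine ⟨max (1 / 2) (1 - η / 2), by positivity, max_lt (by norm_num) (by linarith), ?_⟩
    intro t ht htlt s
    have hs : dist (H (t, Int.fract s)) (H (1, Int.fract s)) < ε := by
      refine hball ?_ _ ⟨Int.fract_nonneg s, (Int.fract_lt_one s).le⟩
      rw [Real.dist_eq, abs_lt]
      constructor <;> linarith [(le_max_right _ _).trans ht]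
    have hp : ∀ t, H (t, Int.fract s) = H (t, s) := fun t => by
      have hf : Function.Periodic (fun s => H (t, s)) 1 := hper t
      have := hf.sub_int_mul_eq ⌊s⌋ (x := s)
      simpa [Int.self_sub_floor] using this
    rwa [hp, hp, h1] at hs
  refine ⟨fun q => H q + (max 0 ((q.1 - t₀) / (1 - t₀))) • (δ'.toFun q.2 - δ.toFun q.2),
    ?_, ?_, ?_, ?_, ?_⟩
  · have := δ.continuous_toFun
    have := δ'.continuous_toFun
    fun_prop
  · intro s
    have : (0 - t₀) / (1 - t₀) ≤ 0 := div_nonpos_of_nonpos_of_nonneg (by linarith) (by linarith)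
    simp only [max_eq_left this, h0]
    simp
  · intro s
    have : (1 - t₀) / (1 - t₀) = 1 := div_self (by linarith)
    simp [this, h1]
  · intro t s
    have e : ∀ δ : PLLoop, δ.toFun (s + 1) = δ.toFun s := fun δ => by
      simpa using δ.toFun_add_intCast s 1
    simp only [hper, e]
  · intro t s ht htlt
    rcases hδ s with heq | hfar
    · simpa [heq] using hP t s ht htlt
    rcases lt_or_ge t t₀ with hlt | hge
    · have : (t - t₀) / (1 - t₀) ≤ 0 := div_nonpos_of_nonpos_of_nonneg (by linarith) (by linarith)
      simpa [max_eq_left this] using hP t s ht htlt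
    · intro hmem
      set l : ℝ := max 0 ((t - t₀) / (1 - t₀))
      have hl₁ : l ≤ 1 := max_le zero_le_one ((div_le_one (by linarith)).2 (by linarith))
      have := hfar l ⟨le_max_left _ _, hl₁⟩ _ hmem
      refine this.not_gt ?_
      simp only [AffineMap.lineMap_apply, vsub_eq_sub, vadd_eq_add]
      rw [add_comm, dist_add_right, dist_comm]
      exact hclose t hge htlt s

/-- Moving a vertex inside a ball that contains its two incident edges, and whose concentric
double avoids the obstacles, does not change the extended homotopy class. -/
theorem HomotopicRelExt.moveVertex {P : Set Pt} {γ δ : PLLoop} (h : HomotopicRelExt P γ δ)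
    (hm : 1 < δ.m) (k : ZMod δ.m) (p c : Pt) {r : ℝ} (hr : 0 < r)
    (hball : ∀ q ∈ P, 2 * r ≤ dist q c) (hp : p ∈ Metric.ball c r)
    (hk : δ.v k ∈ Metric.ball c r) (hprev : δ.v (k - 1) ∈ Metric.ball c r)
    (hnext : δ.v (k + 1) ∈ Metric.ball c r) :
    HomotopicRelExt P γ (δ.moveVertex k p) := by
  have : Fact (1 < δ.m) := ⟨hm⟩
  refine h.perturb hr fun s => ?_
  set n : ℤ := ⌊s * δ.m⌋
  have hn₁ : (n : ℝ) ≤ s * δ.m := Int.floor_le _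
  have hn₂ : s * δ.m < n + 1 := Int.lt_floor_add_one _
  have e := δ.toFun_eq_lineMap s n hn₁ hn₂.le
  have eMoved : (δ.moveVertex k p).toFun s =
      AffineMap.lineMap (Function.update δ.v k p (n : ZMod δ.m))
        (Function.update δ.v k p ((n + 1 : ℤ) : ZMod δ.m)) (s * δ.m - n) :=
    (δ.moveVertex k p).toFun_eq_lineMap s n hn₁ hn₂.le
  have hl : s * δ.m - n ∈ Set.Icc (0 : ℝ) 1 := ⟨by linarith, by linarith⟩
  rw [Int.cast_add, Int.cast_one] at e eMoved
  have hconv := convex_ball c r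
  have hfar : ∀ x ∈ Metric.ball c r, ∀ y ∈ Metric.ball c r, ∀ l ∈ Set.Icc (0 : ℝ) 1, ∀ q ∈ P,
      r ≤ dist (AffineMap.lineMap x y l) q := by
    intro x hx y hy l hl q hq
    have h₁ : dist (AffineMap.lineMap x y l) c < r := hconv.lineMap_mem hx hy hl
    have h₂ := dist_triangle_left q c (AffineMap.lineMap x y l)
    linarith [hball q hq]
  by_cases h₁ : (n : ZMod δ.m) = k
  · right
    have h₂ : k + 1 ≠ k := by simp
    rw [h₁] at e eMoved
    rw [Function.update_self, Function.update_of_ne h₂] at eMoved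
    rw [e, eMoved]
    exact hfar _ (hconv.lineMap_mem hk hnext hl) _ (hconv.lineMap_mem hp hnext hl)
  by_cases h₂ : (n : ZMod δ.m) + 1 = k
  · right
    have h₃ : (n : ZMod δ.m) = k - 1 := eq_sub_of_add_eq h₂
    rw [Function.update_of_ne h₁, h₂, Function.update_self] at eMoved
    rw [h₂] at e
    rw [h₃] at e eMoved
    rw [e, eMoved]
    exact hfar _ (hconv.lineMap_mem hprev hk hl) _ (hconv.lineMap_mem hprev hp hl)
  · left
    rw [Function.update_of_ne h₁, Function.update_of_ne h₂] at eMoved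
    rw [e, eMoved]

/-- Every genuine corner of a shortest homotopic piecewise-linear
loop lies at an obstacle: if `δ` is a nonconstant shortest piecewise-linear loop
homotopic rel `P` in the extended sense to `γ`, with cyclically consecutive
vertices distinct, then every vertex at which the unsigned angle is not `π`
belongs to `P`. -/
theorem shortest_homotopic_corners_at_obstacles (P : Set Pt) (hP : P.Finite)
    (γ : PLLoop) (hγ : γ.image ∩ P = ∅) (δ : PLLoop)
    (hhom : HomotopicRelExt P γ δ)
    (hmin : ∀ δ' : PLLoop, HomotopicRelExt P γ δ' → δ.length ≤ δ'.length)
    (hne : ∀ i : ZMod δ.m, δ.v i ≠ δ.v (i + 1)) :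
    ∀ i : ZMod δ.m,
      EuclideanGeometry.angle (δ.v (i - 1)) (δ.v i) (δ.v (i + 1)) ≠ Real.pi →
        δ.v i ∈ P := by
  intro i hangle
  by_contra hi
  have hm : NeZero δ.m := ⟨δ.m_pos.ne'⟩
  set a := δ.v (i - 1) with ha
  set b := δ.v i with hb
  set c := δ.v (i + 1) with hc
  have hab : b ≠ a := by
    have := hne (i - 1)
    rw [sub_add_cancel] at this
    exact this.symm
  have hstrict : dist a c < dist a b + dist b c := by
    refine lt_of_le_of_ne (dist_triangle a b c) fun h => hangle ?_
    exact EuclideanGeometry.angle_eq_pi_iff_sbtw.2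
      ⟨dist_add_dist_eq_iff.1 h.symm, hab, hne i⟩
  obtain ⟨R, hR, hball⟩ := Metric.isOpen_iff.1 hP.isClosed.isOpen_compl b hi
  obtain ⟨N, hN⟩ := exists_nat_gt (max 1 ((dist a b + dist b c) / (R / 2)))
  have hN₁ : (1 : ℝ) < N := (le_max_left _ _).trans_lt hN
  have hN₀ : (0 : ℝ) < N := by linarith
  have hN₂ : (dist a b + dist b c) / N < R / 2 := by
    have := (le_max_right _ _).trans_lt hN
    rw [div_lt_iff₀ (by positivity)] at this ⊢
    linarith
  have hN₁' : 1 < N := by exact_mod_cast hN₁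
  have hNpos : 0 < N := by omega
  set δN := δ.subdivide N hNpos with hδN
  set z : ℤ := (i.val : ℤ) with hz
  have hzi : (z : ZMod δ.m) = i := by simp [hz]
  have hzs : ((z + 1 : ℤ) : ZMod δ.m) = i + 1 := by simp [hz]
  have hzp : ((z - 1 : ℤ) : ZMod δ.m) = i - 1 := by simp [hz]
  have hNz : (1 : ℤ) < N := by exact_mod_cast hN₁'
  let k : ZMod δN.m := ((z * N : ℤ) : ZMod (δ.m * N))
  have hvk : δN.v k = b := by
    have := δ.subdivide_v_eq_lineMap N hNpos (z * N) z le_rfl (by nlinarith)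
    rw [hzi] at this
    refine this.trans ?_
    push_cast
    rw [mul_div_cancel_right₀ _ hN₀.ne', sub_self, AffineMap.lineMap_apply_zero]
  have hvs : δN.v (k + 1) = AffineMap.lineMap b c (1 / N : ℝ) := by
    have := δ.subdivide_v_eq_lineMap N hNpos (z * N + 1) z (by omega) (by nlinarith)
    rw [hzi, hzs] at this
    have hk : k + 1 = ((z * N + 1 : ℤ) : ZMod (δ.m * N)) := (Int.cast_add _ _).trans
      (congrArg _ Int.cast_one) |>.symm
    rw [hk]
    refine this.trans ?_
    congr 1
    push_cast
    field_simp
    ring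
  have hvp : δN.v (k - 1) = AffineMap.lineMap b a (1 / N : ℝ) := by
    have := δ.subdivide_v_eq_lineMap N hNpos (z * N - 1) (z - 1) (by nlinarith) (by nlinarith)
    rw [sub_add_cancel, hzi, hzp] at this
    have hk : k - 1 = ((z * N - 1 : ℤ) : ZMod (δ.m * N)) := (Int.cast_sub _ _).trans
      (congrArg _ Int.cast_one) |>.symm
    rw [hk, ← AffineMap.lineMap_apply_one_sub]
    refine this.trans ?_
    congr 1
    push_cast
    field_simp
    ring
  have hdist : ∀ x, dist b (AffineMap.lineMap b x (1 / N : ℝ)) = dist b x / N := fun x => by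
    rw [dist_left_lineMap, Real.norm_of_nonneg (by positivity)]
    ring
  have hδm : 1 < δN.m := by
    change 1 < δ.m * N
    nlinarith [δ.m_pos]
  have hhomN : HomotopicRelExt P γ δN := by
    simpa only [HomotopicRelExt, hδN, PLLoop.toFun_subdivide] using hhom
  have hlen : δN.length = δ.length := δ.length_subdivide N hNpos
  rw [add_div] at hN₂
  have hab₀ : 0 ≤ dist a b / N := by positivity
  have hbc₀ : 0 ≤ dist b c / N := by positivity
  have hs : δN.v (k + 1) ∈ Metric.ball b (R / 2) := by
    rw [hvs, Metric.mem_ball', hdist]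
    linarith
  have hp : δN.v (k - 1) ∈ Metric.ball b (R / 2) := by
    rw [hvp, Metric.mem_ball', hdist, dist_comm]
    linarith
  have hhom' := hhomN.moveVertex hδm k (δN.v (k + 1)) b (half_pos hR)
    (fun q hq => by
      by_contra! hlt
      exact hball (by rw [Metric.mem_ball]; linarith) hq)
    hs (by rw [hvk]; exact Metric.mem_ball_self (half_pos hR)) hp hs
  have hlt := δN.length_moveVertex_lt hδm k (by
    rw [hvk, hvs, hvp, dist_comm _ b, hdist, hdist, ← add_div]
    have : dist (AffineMap.lineMap b a (1 / N : ℝ)) (AffineMap.lineMap b c (1 / N : ℝ)) =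
        dist a c / N := by
      rw [dist_eq_norm, dist_eq_norm]
      have : (AffineMap.lineMap b a (1 / N : ℝ)) - (AffineMap.lineMap b c (1 / N : ℝ)) =
          (1 / N : ℝ) • (a - c) := by
        simp only [AffineMap.lineMap_apply_module]
        module
      rw [this, norm_smul, Real.norm_of_nonneg (by positivity)]
      ring
    rw [this, dist_comm b a]
    exact div_lt_div_of_pos_right hstrict hN₀)
  linarith [hmin _ hhom']

end
end

section
/- Let C be a circle in ℝ² bounding the closed disk D, let p and r be points on C, and let q be a point in the open disk bounded by C such that the ordered triple p, q, r describes a clockwise turn, i.e., det(q − p, r − q) < 0. Let q₀ = p, q₁, …, q_n = r (with n ≥ 2 and consecutive vertices distinct) be the vertices of a simple piecewise-linear path (the concatenated segment map is injective) such that q_j = q for some 0 < j < n and q_i lies in the open disk for every 0 < i < n (so the path meets C only at its endpoints p and r). Then the path has at least one clockwise vertex: there exists an index 0 < i < n with det(q_i − q_{i−1}, q_{i+1} − q_i) < 0. -/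
/-!
Statement 5: a simple piecewise-linear path from `p` through `q` to `r` inside a
closed disk, meeting the bounding circle only at its endpoints `p, r`, where
`p, q, r` describes a clockwise turn, must have at least one clockwise vertex.
-/

noncomputable section

/-- The 2×2 determinant `det(u, w) = u₁ w₂ − u₂ w₁` of two plane vectors. -/
def det2 (u w : Pt) : ℝ := u 0 * w 1 - u 1 * w 0

/-- The standard parametrization over `[0,1]` of the piecewise-linear path with
vertex sequence `v 0, v 1, …, v n`: on `[i/n, (i+1)/n]` it traverses the straight
segment from `v i` to `v (i+1)`. -/
def plPath (n : ℕ) (v : ℕ → Pt) : ℝ → Pt := fun t =>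
  let x : ℝ := t * n
  let i : ℕ := min ⌊x⌋₊ (n - 1)
  (1 - (x - (i : ℝ))) • v i + (x - (i : ℝ)) • v (i + 1)

/-- The oriented side of the point `z` with respect to the line through `v j` and `v (j + 1)`;
it is positive strictly to the left of that line. -/
def edgeSide (v : ℕ → Pt) (j : ℕ) (z : Pt) : ℝ := det2 (v (j + 1) - v j) (z - v j)

/-- The edges `j` and `k` span the same line with the same orientation. -/
def SameSide (v : ℕ → Pt) (j k : ℕ) : Prop :=
  ∃ a > (0 : ℝ), ∀ z, edgeSide v j z = a * edgeSide v k z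

lemma SameSide.refl (v : ℕ → Pt) (j : ℕ) : SameSide v j j := ⟨1, one_pos, by simp⟩

lemma SameSide.trans {v : ℕ → Pt} {i j k : ℕ} (h : SameSide v i j) (h' : SameSide v j k) :
    SameSide v i k := by
  obtain ⟨a, ha, h⟩ := h
  obtain ⟨b, hb, h'⟩ := h'
  exact ⟨a * b, mul_pos ha hb, fun z => by rw [h, h', mul_assoc]⟩

lemma edgeSide_add_smul (v : ℕ → Pt) (j : ℕ) (a b : Pt) (t : ℝ) :
    edgeSide v j (a + t • (b - a)) = (1 - t) * edgeSide v j a + t * edgeSide v j b := by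
  simp [edgeSide, det2]
  ring

lemma edgeSide_succ_self (v : ℕ → Pt) (j : ℕ) : edgeSide v j (v (j + 1)) = 0 := by
  simp [edgeSide, det2]
  ring

lemma edgeSide_add_smul_next (v : ℕ → Pt) (i : ℕ) (s : ℝ) :
    edgeSide v i (v (i + 1) + s • (v (i + 2) - v (i + 1))) =
      s * det2 (v (i + 1) - v i) (v (i + 2) - v (i + 1)) := by
  simp [edgeSide, det2]
  ring

lemma edgeSide_succ_add_smul (v : ℕ → Pt) (i : ℕ) (s : ℝ) :
    edgeSide v (i + 1) (v i + s • (v (i + 1) - v i)) =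
      (1 - s) * det2 (v (i + 1) - v i) (v (i + 2) - v (i + 1)) := by
  simp [edgeSide, det2]
  ring

lemma exists_smul_of_det2_eq_zero {u w : Pt} (hu : u ≠ 0) (h : det2 u w = 0) :
    ∃ a : ℝ, w = a • u := by
  simp only [det2] at h
  by_cases h0 : u 0 = 0
  · have h1 : u 1 ≠ 0 := fun h1 => hu (by ext i; fin_cases i <;> simp [h0, h1])
    refine ⟨w 1 / u 1, ?_⟩
    ext i
    fin_cases i
    · have : w 0 = 0 := by simpa [h0, h1] using h
      simp [h0, this]
    · simp [h1]
  · refine ⟨w 0 / u 0, ?_⟩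
    ext i
    fin_cases i
    · simp [h0]
    · simp only [Fin.mk_one, PiLp.smul_apply, smul_eq_mul]
      field_simp
      linarith

lemma exists_eq_add_smul_of_edgeSide_eq_zero {v : ℕ → Pt} {j : ℕ} {z : Pt}
    (hj : v j ≠ v (j + 1)) (h : edgeSide v j z = 0) :
    ∃ s : ℝ, z = v j + s • (v (j + 1) - v j) := by
  obtain ⟨s, hs⟩ := exists_smul_of_det2_eq_zero (sub_ne_zero.2 hj.symm) h
  exact ⟨s, by rw [← hs]; abel⟩

lemma sameSide_succ {v : ℕ → Pt} {i : ℕ} {a : ℝ} (ha : 0 < a)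
    (h : v (i + 2) - v (i + 1) = a • (v (i + 1) - v i)) : SameSide v i (i + 1) := by
  refine ⟨a⁻¹, inv_pos.2 ha, fun z => ?_⟩
  simp only [edgeSide, h, det2, PiLp.smul_apply, PiLp.sub_apply, smul_eq_mul]
  field_simp
  ring

lemma add_smul_mem_segment {a b : Pt} {s : ℝ} (h0 : 0 ≤ s) (h1 : s ≤ 1) :
    a + s • (b - a) ∈ segment ℝ a b := by
  rw [segment_eq_image']
  exact ⟨s, ⟨h0, h1⟩, rfl⟩

lemma plPath_apply {n : ℕ} {v : ℕ → Pt} {k : ℕ} (hk : k < n) {s : ℝ} (h0 : 0 ≤ s) (h1 : s ≤ 1) :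
    plPath n v ((k + s) / n) = v k + s • (v (k + 1) - v k) := by
  have hn : (n : ℝ) ≠ 0 := by
    have : n ≠ 0 := by omega
    exact_mod_cast this
  have hx : (k + s) / n * (n : ℝ) = k + s := by field_simp
  simp only [plPath, hx]
  rcases h1.lt_or_eq with h1 | rfl
  · have hf : ⌊(k : ℝ) + s⌋₊ = k := by
      rw [Nat.floor_eq_iff (by positivity)]
      constructor <;> linarith
    rw [hf, min_eq_left (by omega)]
    simp only [add_sub_cancel_left]
    module
  · have hf : ⌊(k : ℝ) + 1⌋₊ = k + 1 := by exact_mod_cast Nat.floor_natCast (k + 1)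
    rw [hf]
    by_cases hk' : k + 1 ≤ n - 1
    · rw [min_eq_left hk']
      push_cast
      module
    · rw [min_eq_right (by omega), show n - 1 = k by omega]
      module

/-- The edges of a polygonal path meet only in the obvious way: no edge, its starting point
excepted, meets an earlier edge. -/
def EdgesDisjoint (n : ℕ) (v : ℕ → Pt) : Prop :=
  ∀ i < n, ∀ k < i, ∀ t : ℝ, 0 < t → t ≤ 1 →
    v i + t • (v (i + 1) - v i) ∉ segment ℝ (v k) (v (k + 1))

lemma edgesDisjoint_of_injOn {n : ℕ} {v : ℕ → Pt}
    (h : Set.InjOn (plPath n v) (Set.Icc (0 : ℝ) 1)) : EdgesDisjoint n v := by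
  intro i hi k hk t ht0 ht1 hmem
  rw [segment_eq_image'] at hmem
  obtain ⟨s, ⟨hs0, hs1⟩, hs⟩ := hmem
  have hn : (0 : ℝ) < n := by exact_mod_cast (by omega : 0 < n)
  have hIcc : ∀ (m : ℕ), m < n → ∀ u : ℝ, 0 ≤ u → u ≤ 1 →
      ((m : ℝ) + u) / n ∈ Set.Icc (0 : ℝ) 1 := by
    intro m hm u hu0 hu1
    have : (m : ℝ) + 1 ≤ n := by exact_mod_cast hm
    exact ⟨by positivity, by rw [div_le_one hn]; linarith⟩
  have := h (hIcc k (by omega) s hs0 hs1) (hIcc i hi t ht0.le ht1) (by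
    rw [plPath_apply (by omega) hs0 hs1, plPath_apply hi ht0.le ht1]
    exact hs)
  have hki : (k : ℝ) + 1 ≤ i := by exact_mod_cast hk
  field_simp at this
  linarith

/-- Consecutive edges of a simple path which are parallel have the same direction. -/
lemma EdgesDisjoint.exists_pos_smul {n : ℕ} {v : ℕ → Pt} (h : EdgesDisjoint n v) {i : ℕ}
    (hi : i + 1 < n) (hne : v i ≠ v (i + 1)) (hne' : v (i + 1) ≠ v (i + 2))
    (hdet : det2 (v (i + 1) - v i) (v (i + 2) - v (i + 1)) = 0) :
    ∃ a > (0 : ℝ), v (i + 2) - v (i + 1) = a • (v (i + 1) - v i) := by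
  obtain ⟨a, ha⟩ := exists_smul_of_det2_eq_zero (sub_ne_zero.2 hne.symm) hdet
  refine ⟨a, ?_, ha⟩
  by_contra! hle
  rcases hle.lt_or_eq with hlt | rfl
  · set t := min 1 (-a)⁻¹
    have hinv : 0 < (-a)⁻¹ := inv_pos.2 (by linarith)
    have ht0 : 0 < t := lt_min one_pos hinv
    have hta : t * (-a) ≤ 1 := by
      calc t * (-a) ≤ (-a)⁻¹ * (-a) :=
            mul_le_mul_of_nonneg_right (min_le_right _ _) (by linarith)
        _ = 1 := inv_mul_cancel₀ (by linarith)
    refine h (i + 1) hi i (by omega) t ht0 (min_le_left _ _) ?_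
    rw [show i + 1 + 1 = i + 2 from rfl, ha, show v (i + 1) + t • a • (v (i + 1) - v i) =
      v i + (1 + t * a) • (v (i + 1) - v i) by module]
    exact add_smul_mem_segment (by linarith) (by nlinarith)
  · rw [zero_smul, sub_eq_zero] at ha
    exact hne' ha.symm

/-- The intersection of the disk with the half-planes to the left of the edges `0, …, i` is
bounded, inside the disk, by these edges and by the ray extending the edge `i`; the last vertex
`v (i + 1)` is not a corner of this region. -/
structure Trapped (c : Pt) (R : ℝ) (v : ℕ → Pt) (i : ℕ) : Prop where
  frontier : ∀ z ∈ Metric.ball c R, (∀ j ≤ i, 0 ≤ edgeSide v j z) →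
    ∀ j ≤ i, edgeSide v j z = 0 → (∃ k ≤ i, z ∈ segment ℝ (v k) (v (k + 1))) ∨
      (SameSide v j i ∧ ∃ s > (1 : ℝ), z = v i + s • (v (i + 1) - v i))
  vertex : ∀ j ≤ i, 0 < edgeSide v j (v (i + 1)) ∨ SameSide v j i

lemma trapped_zero {c : Pt} {R : ℝ} {v : ℕ → Pt} (h0 : dist (v 0) c = R) (h1 : dist (v 1) c < R)
    (hne : v 0 ≠ v 1) : Trapped c R v 0 where
  frontier := by
    intro z hz _ j hj hzj
    obtain rfl : j = 0 := by omega
    obtain ⟨s, rfl⟩ := exists_eq_add_smul_of_edgeSide_eq_zero hne hzj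
    rcases lt_or_ge 1 s with hs1 | hs1
    · exact Or.inr ⟨SameSide.refl v 0, s, hs1, rfl⟩
    rcases le_or_gt 0 s with hs0 | hs0
    · exact Or.inl ⟨0, le_rfl, add_smul_mem_segment hs0 hs1⟩
    exfalso
    have hpos : 0 < 1 - s := by linarith
    have hmem := (convex_ball c R) hz (Metric.mem_ball.2 h1) (a := (1 - s)⁻¹) (b := -s * (1 - s)⁻¹)
      (by positivity) (mul_nonneg (by linarith) (by positivity)) (by field_simp; ring)
    have heq : (1 - s)⁻¹ • (v 0 + s • (v (0 + 1) - v 0)) + (-s * (1 - s)⁻¹) • v 1 = v 0 := by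
      have : (1 - s)⁻¹ * (1 - s) = 1 := inv_mul_cancel₀ hpos.ne'
      calc _ = ((1 - s)⁻¹ * (1 - s)) • v 0 := by rw [zero_add]; module
        _ = v 0 := by rw [this, one_smul]
    rw [heq, Metric.mem_ball, h0] at hmem
    exact lt_irrefl _ hmem
  vertex := by
    intro j hj
    obtain rfl : j = 0 := by omega
    exact Or.inr (SameSide.refl v 0)

lemma Trapped.nonneg_next {c : Pt} {R : ℝ} {n : ℕ} {v : ℕ → Pt} {i : ℕ} (h : Trapped c R v i)
    (hdisj : EdgesDisjoint n v) (hi : i + 1 < n) (hv : dist (v (i + 1)) c < R)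
    (hv' : dist (v (i + 2)) c ≤ R)
    (hdet : 0 ≤ det2 (v (i + 1) - v i) (v (i + 2) - v (i + 1))) :
    ∀ j ≤ i, 0 ≤ edgeSide v j (v (i + 2)) := by
  by_contra! hneg
  have hside : 0 ≤ edgeSide v i (v (i + 2)) := by
    have := edgeSide_add_smul_next v i 1
    rw [one_smul, one_mul, add_sub_cancel] at this
    rwa [this]
  have hstart : ∀ j ≤ i, edgeSide v j (v (i + 2)) < 0 → 0 < edgeSide v j (v (i + 1)) := by
    intro j hj hlt
    refine (h.vertex j hj).resolve_right ?_
    rintro ⟨a, ha, hja⟩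
    rw [hja] at hlt
    nlinarith [mul_nonneg ha.le hside]
  let τ : ℕ → ℝ := fun j => edgeSide v j (v (i + 1)) /
    (edgeSide v j (v (i + 1)) - edgeSide v j (v (i + 2)))
  obtain ⟨j, hj, hmin⟩ := ((Finset.range (i + 1)).filter
    (fun j => edgeSide v j (v (i + 2)) < 0)).exists_min_image τ (by
      obtain ⟨j, hj, hlt⟩ := hneg
      exact ⟨j, by simp [hlt]; omega⟩)
  simp only [Finset.mem_filter, Finset.mem_range, Nat.lt_succ_iff] at hj hmin
  obtain ⟨hji, hjneg⟩ := hj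
  have hjpos := hstart j hji hjneg
  have hτ0 : 0 < τ j := div_pos hjpos (by linarith)
  have hτ1 : τ j < 1 := by
    rw [div_lt_one (by linarith)]
    linarith
  set z := v (i + 1) + τ j • (v (i + 2) - v (i + 1)) with hz
  have hball : z ∈ Metric.ball c R := by
    have hconv := (convex_closedBall c R).combo_interior_closure_mem_interior
      (x := v (i + 1)) (y := v (i + 2)) (a := 1 - τ j) (b := τ j)
      (interior_mono Metric.ball_subset_closedBall (by
        rw [Metric.isOpen_ball.interior_eq]; exact hv))
      (subset_closure hv') (by linarith) hτ0.le (by ring)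
    have hR : R ≠ 0 := (dist_nonneg.trans_lt hv).ne'
    rw [interior_closedBall c hR] at hconv
    convert hconv using 1
    rw [hz]
    module
  have hzj : edgeSide v j z = 0 := by
    rw [hz, edgeSide_add_smul]
    have : edgeSide v j (v (i + 1)) - edgeSide v j (v (i + 2)) ≠ 0 := by linarith
    simp only [τ]
    field_simp
    ring
  have hzall : ∀ k ≤ i, 0 ≤ edgeSide v k z := by
    intro k hk
    rw [hz, edgeSide_add_smul]
    rcases lt_or_ge (edgeSide v k (v (i + 2))) 0 with hlt | hge
    · have hkpos := hstart k hk hlt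
      have hle := hmin k ⟨hk, hlt⟩
      have := (le_div_iff₀ (by linarith)).1 hle
      linarith
    · have hk0 : 0 ≤ edgeSide v k (v (i + 1)) := by
        rcases h.vertex k hk with hpos | ⟨a, _, hka⟩
        · exact hpos.le
        · rw [hka, edgeSide_succ_self, mul_zero]
      have : 0 ≤ 1 - τ j := by linarith
      positivity
  rcases h.frontier z hball hzall j hji hzj with ⟨k, hk, hmem⟩ | ⟨⟨a, ha, hja⟩, -⟩
  · exact hdisj (i + 1) hi k (by omega) (τ j) hτ0 hτ1.le hmem
  · rw [hja] at hjneg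
    nlinarith [mul_nonneg ha.le hside]

lemma Trapped.succ {c : Pt} {R : ℝ} {n : ℕ} {v : ℕ → Pt} {i : ℕ} (h : Trapped c R v i)
    (hdisj : EdgesDisjoint n v) (hi : i + 1 < n) (hne : v i ≠ v (i + 1))
    (hne' : v (i + 1) ≠ v (i + 2)) (hv : dist (v (i + 1)) c < R) (hv' : dist (v (i + 2)) c < R)
    (hdet : 0 ≤ det2 (v (i + 1) - v i) (v (i + 2) - v (i + 1))) : Trapped c R v (i + 1) where
  frontier := by
    intro z hz hpos
    have hlast : edgeSide v (i + 1) z = 0 → (∃ k ≤ i + 1, z ∈ segment ℝ (v k) (v (k + 1))) ∨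
        ∃ s > (1 : ℝ), z = v (i + 1) + s • (v (i + 2) - v (i + 1)) := by
      intro hz0
      obtain ⟨s, hs⟩ := exists_eq_add_smul_of_edgeSide_eq_zero hne' hz0
      change z = v (i + 1) + s • (v (i + 2) - v (i + 1)) at hs
      rcases lt_or_ge 1 s with hs1 | hs1
      · exact Or.inr ⟨s, hs1, hs⟩
      rcases le_or_gt 0 s with hs0 | hs0
      · exact Or.inl ⟨i + 1, le_rfl, hs ▸ add_smul_mem_segment hs0 hs1⟩
      have hside : edgeSide v i z = s * det2 (v (i + 1) - v i) (v (i + 2) - v (i + 1)) := by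
        rw [hs, edgeSide_add_smul_next]
      have hdet0 : det2 (v (i + 1) - v i) (v (i + 2) - v (i + 1)) = 0 := by
        have := hpos i (by omega)
        nlinarith
      rcases h.frontier z hz (fun j hj => hpos j (by omega)) i le_rfl (by rw [hside, hdet0, mul_zero])
        with ⟨k, hk, hmem⟩ | ⟨-, s', hs', hzs'⟩
      · exact Or.inl ⟨k, by omega, hmem⟩
      · exfalso
        obtain ⟨a, ha, hae⟩ := hdisj.exists_pos_smul hi hne hne' hdet0
        rw [hae] at hs
        have hzero : (s' - 1 - s * a) • (v (i + 1) - v i) = 0 := by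
          rw [show (s' - 1 - s * a) • (v (i + 1) - v i) = (v i + s' • (v (i + 1) - v i)) -
            (v (i + 1) + s • a • (v (i + 1) - v i)) by module, ← hs, ← hzs', sub_self]
        rcases smul_eq_zero.1 hzero with h0 | h0
        · nlinarith
        · exact hne (sub_eq_zero.1 h0).symm
    intro j hj hzj
    rcases Nat.lt_or_ge i j with hij | hij
    · obtain rfl : j = i + 1 := by omega
      exact (hlast hzj).imp_right fun hs => ⟨SameSide.refl v _, hs⟩
    rcases h.frontier z hz (fun j hj => hpos j (by omega)) j hij hzj with
      ⟨k, hk, hmem⟩ | ⟨hside, s, hs, hzs⟩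
    · exact Or.inl ⟨k, by omega, hmem⟩
    have hnext := hpos (i + 1) le_rfl
    rw [hzs, edgeSide_succ_add_smul] at hnext
    have hdet0 : det2 (v (i + 1) - v i) (v (i + 2) - v (i + 1)) = 0 := by nlinarith
    obtain ⟨a, ha, hae⟩ := hdisj.exists_pos_smul hi hne hne' hdet0
    refine (hlast ?_).imp_right fun hs => ⟨hside.trans (sameSide_succ ha hae), hs⟩
    rw [hzs, edgeSide_succ_add_smul, hdet0, mul_zero]
  vertex := by
    intro j hj
    rcases Nat.lt_or_ge i j with hij | hij
    · obtain rfl : j = i + 1 := by omega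
      exact Or.inr (SameSide.refl v _)
    have hpos := h.nonneg_next hdisj hi hv hv'.le hdet
    refine (hpos j hij).lt_or_eq.imp id fun h0 => ?_
    rcases h.frontier (v (i + 2)) hv' hpos j hij h0.symm with ⟨k, hk, hmem⟩ | ⟨hside, s, hs, hzs⟩
    · exact absurd (by simpa using hmem) (hdisj (i + 1) hi k (by omega) 1 one_pos le_rfl)
    · refine hside.trans (sameSide_succ (a := s - 1) (by linarith) ?_)
      rw [hzs]
      module

/-- A simple path without clockwise vertices entering the disk from its boundary ends on the left
of all its edges. -/
lemma edgeSide_end_nonneg {c : Pt} {R : ℝ} {n : ℕ} {v : ℕ → Pt} (hn : 2 ≤ n)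
    (h0 : dist (v 0) c = R) (hend : dist (v n) c = R) (hcons : ∀ i < n, v i ≠ v (i + 1))
    (hinterior : ∀ i, 0 < i → i < n → dist (v i) c < R) (hdisj : EdgesDisjoint n v)
    (hdet : ∀ i, i + 1 < n → 0 ≤ det2 (v (i + 1) - v i) (v (i + 2) - v (i + 1))) :
    ∀ j < n, 0 ≤ edgeSide v j (v n) := by
  have htrap : ∀ i, i + 1 < n → Trapped c R v i := by
    intro i
    induction i with
    | zero => exact fun _ => trapped_zero h0 (hinterior 1 one_pos (by omega)) (hcons 0 (by omega))
    | succ i ih =>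
      intro hi
      exact (ih (by omega)).succ hdisj (by omega) (hcons i (by omega)) (hcons (i + 1) (by omega))
        (hinterior _ (by omega) (by omega)) (hinterior _ (by omega) hi) (hdet i (by omega))
  obtain ⟨m, rfl⟩ : ∃ m, n = m + 2 := ⟨n - 2, by omega⟩
  intro j hj
  rcases Nat.lt_or_ge m j with hmj | hmj
  · obtain rfl : j = m + 1 := by omega
    exact (edgeSide_succ_self v (m + 1)).ge
  · exact (htrap m (by omega)).nonneg_next hdisj (by omega) (hinterior _ (by omega) (by omega))
      hend.le (hdet m (by omega)) j hmj

lemma dist_sq_eq (a b : Pt) : dist a b ^ 2 = (a 0 - b 0) ^ 2 + (a 1 - b 1) ^ 2 := by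
  rw [EuclideanSpace.dist_eq, Real.sq_sqrt (by positivity)]
  simp [Fin.sum_univ_two, Real.dist_eq, sq_abs]

/-- The disk, apart from the boundary point `r`, lies strictly on one side of its tangent at `r`. -/
lemma dot_pos_of_dist_le {c r z : Pt} (h : dist z c ≤ dist r c) (hne : z ≠ r) :
    0 < (z 0 - r 0) * (c 0 - r 0) + (z 1 - r 1) * (c 1 - r 1) := by
  have hsq : dist z c ^ 2 ≤ dist r c ^ 2 := by gcongr
  have hpos : 0 < dist z r ^ 2 := pow_pos (dist_pos.2 hne) 2
  rw [dist_sq_eq] at hpos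
  rw [dist_sq_eq, dist_sq_eq] at hsq
  nlinarith

/-- Within an open half-plane, the relation `0 ≤ det2 u w` is transitive. -/
lemma det2_nonneg_trans {u w x : Pt} {a b : ℝ} (hu : 0 < u 0 * a + u 1 * b)
    (hw : 0 < w 0 * a + w 1 * b) (hx : 0 < x 0 * a + x 1 * b)
    (huw : 0 ≤ det2 u w) (hwx : 0 ≤ det2 w x) : 0 ≤ det2 u x := by
  have key : det2 u x * (w 0 * a + w 1 * b) =
      det2 u w * (x 0 * a + x 1 * b) + det2 w x * (u 0 * a + u 1 * b) := by
    simp only [det2]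
    ring
  have : 0 ≤ det2 u x * (w 0 * a + w 1 * b) := by rw [key]; positivity
  exact nonneg_of_mul_nonneg_left this hw

/-- Let `C` be the circle of center `c` and radius `R > 0`, let
`p, r ∈ C`, and let `q` be in the open disk, with `p, q, r` describing a clockwise
turn (`det(q − p, r − q) < 0`).  Any simple piecewise-linear path
`p = v 0, v 1, …, v n = r` (`n ≥ 2`, consecutive vertices distinct) passing
through `q` whose interior vertices all lie in the open disk has a clockwise
vertex: some `0 < i < n` with `det(v i − v (i−1), v (i+1) − v i) < 0`. -/
theorem simple_path_in_disk_has_clockwise_vertex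
    (c : Pt) (R : ℝ) (hR : 0 < R) (p r q : Pt)
    (hp : dist p c = R) (hr : dist r c = R) (hq : dist q c < R)
    (hturn : det2 (q - p) (r - q) < 0)
    (n : ℕ) (hn : 2 ≤ n) (v : ℕ → Pt)
    (hv0 : v 0 = p) (hvn : v n = r)
    (hcons : ∀ i < n, v i ≠ v (i + 1))
    (hthrough : ∃ j, 0 < j ∧ j < n ∧ v j = q)
    (hinterior : ∀ i, 0 < i → i < n → dist (v i) c < R)
    (hsimple : Set.InjOn (plPath n v) (Set.Icc (0 : ℝ) 1)) :
    ∃ i, 0 < i ∧ i < n ∧ det2 (v i - v (i - 1)) (v (i + 1) - v i) < 0 := by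
  by_contra! hccw
  subst hv0 hvn
  have hdet : ∀ i, i + 1 < n → 0 ≤ det2 (v (i + 1) - v i) (v (i + 2) - v (i + 1)) :=
    fun i hi => by simpa using hccw (i + 1) (by omega) hi
  have hleft := edgeSide_end_nonneg hn hp hr hcons hinterior
    (edgesDisjoint_of_injOn hsimple) hdet
  have hpr : v 0 ≠ v n := by
    intro h
    rw [h] at hturn
    simp only [det2, PiLp.sub_apply] at hturn
    linarith
  have hdot : ∀ i < n, 0 < (v i - v n) 0 * (c 0 - v n 0) + (v i - v n) 1 * (c 1 - v n 1) := by
    intro i hi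
    rcases Nat.eq_zero_or_pos i with rfl | h0
    · exact dot_pos_of_dist_le (hp.trans hr.symm).le hpr
    · have hlt := hinterior i h0 hi
      exact dot_pos_of_dist_le (hlt.le.trans hr.ge) fun h => by rw [h, hr] at hlt; exact hlt.false
  have hstep : ∀ i < n, 0 ≤ det2 (v i - v n) (v (i + 1) - v n) := by
    intro i hi
    have := hleft i hi
    simp only [edgeSide, det2, PiLp.sub_apply] at this ⊢
    linarith
  have hmono : ∀ i < n, 0 ≤ det2 (v 0 - v n) (v i - v n) := by
    intro i
    induction i with
    | zero => exact fun _ => by simp [det2, mul_comm]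
    | succ i ih =>
      exact fun hi => det2_nonneg_trans (hdot 0 (by omega)) (hdot i (by omega)) (hdot _ hi)
        (ih (by omega)) (hstep i (by omega))
  obtain ⟨j, -, hj, rfl⟩ := hthrough
  have := hmono j hj
  simp only [det2, PiLp.sub_apply] at this hturn
  linarith

end
end

section
/- Let α be an arbitrary type. Consider the following elementary step on finite lists over α: replace a list of the form A ++ B by A ++ [e, e] ++ B for some element e (insertion of an adjacent equal pair), or the reverse operation (deletion of an adjacent equal pair). Call two lists equivalent if one can be transformed into the other by a finite sequence of such steps. Call a list reduced if it contains no two consecutive equal elements. Then every list over α is equivalent to exactly one reduced list. -/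
/-!
Statement 6: every finite list over a type `α` is equivalent, under insertion and
deletion of adjacent equal pairs, to exactly one reduced list.
-/

/-- One insertion step: `A ++ B` becomes `A ++ [e, e] ++ B` for some element `e`. -/
def PairInsertion {α : Type*} (l₁ l₂ : List α) : Prop :=
  ∃ (A B : List α) (e : α), l₁ = A ++ B ∧ l₂ = A ++ e :: e :: B

/-- Two lists are equivalent if one can be transformed into the other by a finite
sequence of insertions or deletions of adjacent equal pairs. -/
def PairEquiv {α : Type*} : List α → List α → Prop :=
  Relation.ReflTransGen (fun l₁ l₂ => PairInsertion l₁ l₂ ∨ PairInsertion l₂ l₁)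

/-- A list is reduced if it has no two consecutive equal elements. -/
def IsReducedList {α : Type*} (l : List α) : Prop := List.Chain' (· ≠ ·) l

open scoped Classical in
/-- Prepend `a` to a list, cancelling it against the head if they are equal. -/
noncomputable def cancelCons {α : Type*} (a : α) : List α → List α
  | [] => [a]
  | b :: t => if a = b then t else a :: b :: t

theorem isReducedList_cancelCons {α : Type*} {r : List α} (a : α) (h : IsReducedList r) :
    IsReducedList (cancelCons a r) := by
  unfold IsReducedList at *
  cases r with
  | nil => exact List.isChain_singleton a
  | cons b t =>
    simp only [cancelCons]
    split_ifs with hab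
    · exact List.IsChain.tail h
    · exact List.isChain_cons_cons.2 ⟨hab, h⟩

theorem cancelCons_cancelCons_of_isReducedList {α : Type*} {r : List α} (a : α)
    (h : IsReducedList r) : cancelCons a (cancelCons a r) = r := by
  unfold IsReducedList at h
  rcases r with _ | ⟨b, _ | ⟨c, t⟩⟩
  · simp [cancelCons]
  · by_cases hab : a = b <;> simp [cancelCons, hab]
  · have hbc : b ≠ c := (List.isChain_cons_cons.1 h).1
    by_cases hab : a = b <;> simp [cancelCons, hab, hbc]

/-- The normal form of a list, obtained by cancelling adjacent equal pairs from the right. -/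
noncomputable def pairReduce {α : Type*} (l : List α) : List α :=
  l.foldr cancelCons []

theorem isReducedList_pairReduce {α : Type*} (l : List α) : IsReducedList (pairReduce l) := by
  induction l with
  | nil => exact List.isChain_nil
  | cons a l ih => exact isReducedList_cancelCons a ih

theorem PairInsertion.pairReduce_eq {α : Type*} {l₁ l₂ : List α} (h : PairInsertion l₁ l₂) :
    pairReduce l₁ = pairReduce l₂ := by
  obtain ⟨A, B, e, rfl, rfl⟩ := h
  have hB := cancelCons_cancelCons_of_isReducedList e (isReducedList_pairReduce B)
  unfold pairReduce at hB ⊢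
  rw [List.foldr_append, List.foldr_append, List.foldr_cons, List.foldr_cons, hB]

theorem PairEquiv.pairReduce_eq {α : Type*} {l₁ l₂ : List α} (h : PairEquiv l₁ l₂) :
    pairReduce l₁ = pairReduce l₂ := by
  induction h with
  | refl => rfl
  | tail _ hs ih => exact ih.trans (hs.elim (·.pairReduce_eq) (·.pairReduce_eq.symm))

theorem IsReducedList.pairReduce_eq {α : Type*} {r : List α} (h : IsReducedList r) :
    pairReduce r = r := by
  unfold IsReducedList at h
  induction r with
  | nil => rfl
  | cons a t ih =>
    have ht : pairReduce t = t := ih (List.IsChain.tail h)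
    change cancelCons a (pairReduce t) = a :: t
    rw [ht]
    cases t with
    | nil => rfl
    | cons b t => exact if_neg (List.isChain_cons_cons.1 h).1

theorem PairInsertion.cons {α : Type*} {l₁ l₂ : List α} (a : α) (h : PairInsertion l₁ l₂) :
    PairInsertion (a :: l₁) (a :: l₂) := by
  obtain ⟨A, B, e, rfl, rfl⟩ := h
  exact ⟨a :: A, B, e, rfl, rfl⟩

theorem PairEquiv.cons {α : Type*} {l₁ l₂ : List α} (a : α) (h : PairEquiv l₁ l₂) :
    PairEquiv (a :: l₁) (a :: l₂) :=
  Relation.ReflTransGen.lift (a :: ·)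
    (fun _ _ => Or.imp (PairInsertion.cons a) (PairInsertion.cons a)) _ _ h

theorem pairEquiv_cancelCons {α : Type*} (a : α) (l : List α) :
    PairEquiv (a :: l) (cancelCons a l) := by
  cases l with
  | nil => exact .refl
  | cons b t =>
    simp only [cancelCons]
    split_ifs with hab
    · subst hab
      exact .single (.inr ⟨[], t, a, rfl, rfl⟩)
    · exact .refl

theorem pairEquiv_pairReduce {α : Type*} (l : List α) : PairEquiv l (pairReduce l) := by
  induction l with
  | nil => exact .refl
  | cons a l ih => exact Relation.ReflTransGen.trans (ih.cons a) (pairEquiv_cancelCons a _)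

/-- Every list is equivalent to exactly one reduced list. -/
theorem exists_unique_reduced_equiv {α : Type*} (l : List α) :
    ∃! r : List α, IsReducedList r ∧ PairEquiv l r := by
  refine ⟨pairReduce l, ⟨isReducedList_pairReduce l, pairEquiv_pairReduce l⟩, ?_⟩
  rintro r ⟨hr, hlr⟩
  exact hr.pairReduce_eq.symm.trans hlr.pairReduce_eq.symm
end

section
/- Discrete Fenchel inequality: let m ≥ 2 and let p₀, …, p_{m−1} ∈ ℝ² be the cyclic vertex sequence of a closed polygonal curve with cyclically consecutive vertices distinct (p_i ≠ p_{(i+1) mod m} for all i). Then the total absolute curvature satisfies Σ_{i=0}^{m−1} (π − ∠p_{i−1}p_i p_{i+1}) ≥ 2π, where indices are modulo m. -/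
open InnerProductGeometry in
/-- The angle between the ends of a finite sequence of vectors is at most the sum of the angles
between consecutive terms. -/
theorem angle_le_sum_range_angle {V : Type*} [NormedAddCommGroup V] [InnerProductSpace ℝ V]
    (f : ℕ → V) (n : ℕ) :
    angle (f 0) (f (n + 1)) ≤ ∑ i ∈ Finset.range (n + 1), angle (f i) (f (i + 1)) := by
  induction n with
  | zero => simp
  | succ n ih =>
    rw [Finset.sum_range_succ]
    linarith [angle_le_angle_add_angle (f 0) (f (n + 1)) (f (n + 1 + 1))]

open InnerProductGeometry in
/-- A cyclic sequence of at least two nonzero vectors with sum zero has total turning angle at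
least `2π`. -/
theorem two_pi_le_sum_angle_of_sum_eq_zero {V : Type*} [NormedAddCommGroup V]
    [InnerProductSpace ℝ V] (n : ℕ) (f : ℕ → V) (hf : ∀ i ≤ n + 1, f i ≠ 0)
    (hsum : ∑ i ∈ Finset.range (n + 2), f i = 0) :
    2 * Real.pi ≤
      ∑ i ∈ Finset.range (n + 1), angle (f i) (f (i + 1)) + angle (f (n + 1)) (f 0) := by
  induction n generalizing f with
  | zero =>
    have h1 : f 1 = -f 0 := by
      rw [eq_neg_iff_add_eq_zero, add_comm]
      simpa [Finset.sum_range_succ] using hsum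
    have h0 : f 0 ≠ 0 := hf 0 (by omega)
    simp only [zero_add, Finset.sum_range_one, h1, angle_self_neg_of_nonzero h0,
      angle_neg_self_of_nonzero h0]
    linarith
  | succ n ih =>
    have h0 : f 0 ≠ 0 := hf 0 (by omega)
    rw [Finset.sum_range_succ']
    by_cases h : f 0 + f 1 = 0
    · have h1 : f 1 = -f 0 := by rwa [eq_neg_iff_add_eq_zero, add_comm]
      have hpath := angle_le_sum_range_angle (fun i => f (i + 1)) n
      have htri := angle_le_angle_add_angle (f 1) (f (n + 1 + 1)) (f 0)
      have h10 : angle (f 1) (f 0) = Real.pi := by rw [h1, angle_neg_self_of_nonzero h0]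
      have h01 : angle (f 0) (f 1) = Real.pi := by rw [angle_comm, h10]
      simp only [zero_add] at hpath ⊢
      linarith
    · obtain ⟨g, hg0, hg⟩ : ∃ g : ℕ → V, g 0 = f 0 + f 1 ∧ ∀ i, g (i + 1) = f (i + 2) :=
        ⟨fun i => Nat.casesOn i (f 0 + f 1) fun j => f (j + 2), rfl, fun _ => rfl⟩
      have key := ih g
        (by
          rintro (_ | i) hi
          · rwa [hg0]
          · rw [hg]
            exact hf (i + 2) (by omega))
        (by
          rw [Finset.sum_range_succ'] at hsum ⊢
          rw [Finset.sum_range_succ'] at hsum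
          rw [← hsum]
          simp only [hg0, hg, zero_add, add_assoc, Nat.reduceAdd, add_comm (f 0)])
      rw [Finset.sum_range_succ'] at key ⊢
      simp only [hg0, hg, zero_add, add_assoc, Nat.reduceAdd] at key ⊢
      have hadd := angle_eq_angle_add_add_angle_add (f 0) (hf 1 (by omega))
      have hnext := angle_le_angle_add_angle (f 0 + f 1) (f 1) (f 2)
      have hprev := angle_le_angle_add_angle (f (n + 2)) (f 0) (f 0 + f 1)
      have hcomm := angle_comm (f 1) (f 0 + f 1)
      linarith

/-- For a closed polygonal curve with cyclic vertex sequence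
`p 0, …, p (m−1)` in the plane (`m ≥ 2`, cyclically consecutive vertices
distinct), the sum of exterior angles is at least `2π`. -/
theorem discrete_fenchel (m : ℕ) (hm : 2 ≤ m) (p : ℕ → EuclideanSpace ℝ (Fin 2))
    (hne : ∀ i < m, p i ≠ p ((i + 1) % m)) :
    2 * Real.pi ≤ ∑ i ∈ Finset.range m,
      (Real.pi - EuclideanGeometry.angle (p ((i + m - 1) % m)) (p i) (p ((i + 1) % m))) := by
  obtain ⟨n, rfl⟩ : ∃ n, m = n + 2 := ⟨m - 2, by omega⟩
  let q : ℕ → EuclideanSpace ℝ (Fin 2) := fun i => p (i % (n + 2))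
  have hq : ∀ i, q (i + (n + 2)) = q i := fun i => by simp [q]
  have hext : ∀ a b c : EuclideanSpace ℝ (Fin 2),
      InnerProductGeometry.angle (b - a) (c - b) = Real.pi - EuclideanGeometry.angle a b c := by
    intro a b c
    rw [EuclideanGeometry.angle, vsub_eq_sub, vsub_eq_sub, ← neg_sub b a,
      InnerProductGeometry.angle_neg_left, sub_sub_cancel]
  have key := two_pi_le_sum_angle_of_sum_eq_zero n (fun i => q (i + 1) - q i)
    (fun i hi => by
      have h := hne i (by omega)
      simpa [q, sub_ne_zero, Nat.mod_eq_of_lt (show i < n + 2 by omega)] using h.symm)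
    (by
      rw [Finset.sum_range_sub q, sub_eq_zero]
      simpa using hq 0)
  have hwrap : q (n + 1 + 1) = q 0 := by simpa using hq 0
  simp only [hext, hwrap, zero_add] at key
  rw [Finset.sum_range_succ']
  convert key using 2
  · refine Finset.sum_congr rfl fun i hi => ?_
    have hi' := Finset.mem_range.mp hi
    have h1 : (i + 1 + (n + 2) - 1) % (n + 2) = i % (n + 2) := by
      rw [show i + 1 + (n + 2) - 1 = i + (n + 2) by omega, Nat.add_mod_right]
    simp only [q, h1, Nat.mod_eq_of_lt (show i + 1 < n + 2 by omega)]
  · simp [q]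
end

section
/- Convex chains inside a triangle are short: let u, v, w ∈ ℝ² and let z₁, …, z_k (k ≥ 1) be points of the closed triangle conv{u, v, w} such that the points u, z₁, …, z_k, w are pairwise distinct, in strictly convex position, and occur in this cyclic order along the boundary of their convex hull. Then the length of the polygonal chain from u to w through z₁, …, z_k is at most the length of the path from u to w through v: dist(u, z₁) + Σ_{i=1}^{k−1} dist(z_i, z_{i+1}) + dist(z_k, w) ≤ dist(u, v) + dist(v, w). -/
/-!
Statement 11: a convex chain inside a triangle, from one vertex `u` to another
vertex `w`, is at most as long as the two-segment path through the apex `v`.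
-/

noncomputable section

/-- The cyclic list `p 0, …, p (m−1)` consists of points in strictly convex
position listed in cyclic order along the boundary of their convex hull: every
other point lies strictly on one fixed side (the same for all edges, i.e. the
list traverses the convex polygon boundary either counterclockwise or clockwise)
of each directed edge `p i → p (i+1)`. -/
def StrictlyConvexCyclicOrder (m : ℕ) (p : ℕ → Pt) : Prop :=
  (∀ i < m, ∀ j < m, j ≠ i → j ≠ (i + 1) % m →
      0 < det2 (p ((i + 1) % m) - p i) (p j - p i)) ∨
  (∀ i < m, ∀ j < m, j ≠ i → j ≠ (i + 1) % m →
      det2 (p ((i + 1) % m) - p i) (p j - p i) < 0)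

/-- The cyclic sequence `u, z 0, z 1, …, z (k−1), w` of length `k + 2`. -/
def chainSeq (u w : Pt) (k : ℕ) (z : ℕ → Pt) : ℕ → Pt := fun j =>
  if j = 0 then u else if j ≤ k then z (j - 1) else w

/-- If `v` is weakly right and `w` strictly left of the line `ab`, and `b` is weakly left of
`vw` (left and right being exchanged if `e < 0`), then the ray from `a` through `b` meets the
segment `vw` at a point not before `b`. -/
lemma exists_ray_inter_segment {e : ℝ} {a b v w : Pt}
    (hw : 0 < e * det2 (b - a) (w - a)) (hv : e * det2 (b - a) (v - a) ≤ 0)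
    (hb : 0 ≤ e * det2 (w - v) (b - v)) :
    ∃ s t : ℝ, 1 ≤ s ∧ 0 ≤ t ∧ t ≤ 1 ∧
      AffineMap.lineMap a b s = (AffineMap.lineMap v w t : Pt) := by
  have hG : 0 < e * det2 (b - a) (w - v) := by
    simp only [det2, PiLp.sub_apply] at *
    linarith
  have hG' : e * det2 (b - a) (w - v) ≠ 0 := hG.ne'
  refine ⟨e * det2 (w - v) (a - v) / (e * det2 (b - a) (w - v)),
    -(e * det2 (b - a) (v - a)) / (e * det2 (b - a) (w - v)), ?_, ?_, ?_, ?_⟩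
  · rw [le_div_iff₀ hG]
    simp only [det2, PiLp.sub_apply] at *
    linarith
  · exact div_nonneg (by linarith) hG.le
  · rw [div_le_one hG]
    simp only [det2, PiLp.sub_apply] at *
    linarith
  · ext i
    simp only [AffineMap.lineMap_apply, vsub_eq_sub, vadd_eq_add, PiLp.add_apply,
      PiLp.smul_apply, PiLp.sub_apply, smul_eq_mul]
    rw [div_mul_eq_mul_div, div_mul_eq_mul_div, div_add' _ _ _ hG', div_add' _ _ _ hG']
    congr 1
    simp only [det2, PiLp.sub_apply]
    fin_cases i <;> simp <;> ring

/-- A chain `p 0, …, p (n + 1)` that turns to one side (given by the sign of `e`), stays on that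
side of the line from `v` to its endpoint, and whose first edge has `v` on the other side, is at
most as long as the two-segment path through `v`. -/
lemma sum_dist_le_of_convex_chain (e : ℝ) (n : ℕ) : ∀ (p : ℕ → Pt) (v : Pt),
    (∀ i j, i + 1 < j → j ≤ n + 1 → 0 < e * det2 (p (i + 1) - p i) (p j - p i)) →
    (∀ j ≤ n + 1, 0 ≤ e * det2 (p (n + 1) - v) (p j - v)) →
    e * det2 (p 1 - p 0) (v - p 0) ≤ 0 →
    ∑ i ∈ Finset.range (n + 1), dist (p i) (p (i + 1)) ≤
      dist (p 0) v + dist v (p (n + 1)) := by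
  induction n with
  | zero =>
    intro p v _ _ _
    simpa using dist_triangle (p 0) v (p 1)
  | succ n ih =>
    intro p v hconv hside hfirst
    obtain ⟨s, t, hs, ht0, ht1, hst⟩ := exists_ray_inter_segment
      (hconv 0 (n + 2) (by omega) le_rfl) hfirst (hside 1 (by omega))
    set v' : Pt := AffineMap.lineMap v (p (n + 2)) t with hv'
    have hc0 : ∀ i, v' i = v i + t * (p (n + 2) i - v i) := fun i => by
      simp [hv', AffineMap.lineMap_apply]; ring
    have hc1 : ∀ i, v' i = p 0 i + s * (p 1 i - p 0 i) := fun i => by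
      simp [← hst, AffineMap.lineMap_apply]; ring
    have key := ih (fun i => p (i + 1)) v'
      (fun i j hij hj => hconv (i + 1) (j + 1) (by omega) (by omega))
      (fun j hj => by
        have := mul_nonneg (sub_nonneg.2 ht1) (hside (j + 1) (by omega))
        simp only [det2, PiLp.sub_apply, hc0] at *
        linarith)
      (by
        have : 0 ≤ e * det2 (p 1 - p 0) (p 2 - p 0) :=
          (hconv 0 2 (by omega) (by omega)).le
        have := mul_nonneg (sub_nonneg.2 hs) this
        simp only [det2, PiLp.sub_apply, hc1] at *
        linarith)
    have hvw : dist v v' + dist v' (p (n + 2)) = dist v (p (n + 2)) :=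
      Wbtw.dist_add_dist ⟨t, ⟨ht0, ht1⟩, rfl⟩
    have hpv : dist (p 0) (p 1) + dist (p 1) v' = dist (p 0) v' := by
      rw [← hst, dist_left_lineMap, dist_right_lineMap, Real.norm_eq_abs, Real.norm_eq_abs,
        abs_of_nonpos (by linarith), abs_of_nonneg (by linarith)]
      ring
    have htri := dist_triangle (p 0) v v'
    rw [Finset.sum_range_succ']
    simp only [zero_add] at key ⊢
    change _ ≤ dist (p 1) v' + dist v' (p (n + 2)) at key
    change _ ≤ dist (p 0) v + dist v (p (n + 2))
    linarith

/-- Let `u, v, w ∈ ℝ²` and let `z 0, …, z (k−1)` (`k ≥ 1`) be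
points of the closed triangle `conv {u, v, w}` such that the points
`u, z 0, …, z (k−1), w` are pairwise distinct, in strictly convex position, and
occur in this cyclic order along the boundary of their convex hull.  Then the
polygonal chain from `u` to `w` through the `z i` is at most as long as the path
from `u` to `w` through `v`. -/
theorem convex_chain_in_triangle_short (u v w : Pt) (k : ℕ) (hk : 1 ≤ k)
    (z : ℕ → Pt) (hz : ∀ i < k, z i ∈ convexHull ℝ ({u, v, w} : Set Pt))
    (hdist : ∀ i < k + 2, ∀ j < k + 2, i ≠ j →
      chainSeq u w k z i ≠ chainSeq u w k z j)
    (hconv : StrictlyConvexCyclicOrder (k + 2) (chainSeq u w k z)) :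
    dist u (z 0) + ∑ i ∈ Finset.range (k - 1), dist (z i) (z (i + 1))
        + dist (z (k - 1)) w
      ≤ dist u v + dist v w := by
  obtain ⟨n, rfl⟩ : ∃ n, k = n + 1 := ⟨k - 1, by omega⟩
  obtain ⟨e, he⟩ : ∃ e : ℝ, ∀ i j, i + 1 < j → j ≤ n + 2 →
      0 < e * det2 (chainSeq u w (n + 1) z (i + 1) - chainSeq u w (n + 1) z i)
        (chainSeq u w (n + 1) z j - chainSeq u w (n + 1) z i) := by
    rcases hconv with h | h
    · refine ⟨1, fun i j hij hj => ?_⟩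
      have hm : (i + 1) % (n + 1 + 2) = i + 1 := Nat.mod_eq_of_lt (by omega)
      have := h i (by omega) j (by omega) (by omega) (by omega)
      rw [hm] at this
      linarith
    · refine ⟨-1, fun i j hij hj => ?_⟩
      have hm : (i + 1) % (n + 1 + 2) = i + 1 := Nat.mod_eq_of_lt (by omega)
      have := h i (by omega) j (by omega) (by omega) (by omega)
      rw [hm] at this
      linarith
  have hq0 : chainSeq u w (n + 1) z 0 = u := by simp [chainSeq]
  have hqz : ∀ i ≤ n, chainSeq u w (n + 1) z (i + 1) = z i := fun i hi => by
    simp [chainSeq, hi]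
  have hqw : chainSeq u w (n + 1) z (n + 2) = w := by simp [chainSeq]
  have hcoord : ∀ x ∈ convexHull ℝ ({u, v, w} : Set Pt), ∃ a b c : ℝ,
      0 ≤ a ∧ 0 ≤ b ∧ 0 ≤ c ∧ a + b + c = 1 ∧ ∀ i, x i = a * u i + b * v i + c * w i := by
    intro x hx
    rw [convexHull_insert (by simp), convexHull_pair] at hx
    obtain ⟨_, rfl, y, ⟨b, c, hb, hc, hbc, rfl⟩, a, d, ha, hd, had, rfl⟩ :=
      mem_convexJoin.1 hx
    refine ⟨a, d * b, d * c, ha, by positivity, by positivity, ?_, fun i => ?_⟩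
    · linear_combination had + d * hbc
    · simp
      ring
  obtain ⟨a, b, c, ha, hb, hc, habc, hz0⟩ := hcoord _ (hz 0 (by omega))
  obtain rfl : a = 1 - b - c := by linarith
  have hD : 0 < e * det2 (v - u) (w - u) := by
    have h := he 0 (n + 2) (by omega) le_rfl
    rw [hq0, hqw, hqz 0 (by omega)] at h
    refine pos_of_mul_pos_right (a := b) ?_ hb
    simp only [det2, PiLp.sub_apply, hz0] at *
    linarith
  have hside : ∀ x ∈ convexHull ℝ ({u, v, w} : Set Pt), 0 ≤ e * det2 (w - v) (x - v) := by
    intro x hx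
    obtain ⟨a, b, c, ha, hb, hc, habc, hx⟩ := hcoord x hx
    obtain rfl : b = 1 - a - c := by linarith
    have := mul_nonneg ha hD.le
    simp only [det2, PiLp.sub_apply, hx] at *
    linarith
  have key := sum_dist_le_of_convex_chain e (n + 1) (chainSeq u w (n + 1) z) v he
    (fun j hj => by
      rw [hqw]
      apply hside
      rcases Nat.eq_zero_or_pos j with rfl | hj0
      · rw [hq0]
        exact subset_convexHull ℝ _ (by simp)
      obtain ⟨i, rfl⟩ : ∃ i, j = i + 1 := ⟨j - 1, by omega⟩
      rcases Nat.lt_or_ge n i with hi | hi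
      · obtain rfl : i = n + 1 := by omega
        rw [hqw]
        exact subset_convexHull ℝ _ (by simp)
      · rw [hqz i hi]
        exact hz i (by omega))
    (by
      have := mul_nonneg hc hD.le
      rw [hq0, hqz 0 (by omega)]
      simp only [det2, PiLp.sub_apply, hz0] at *
      linarith)
  rw [Finset.sum_range_succ, Finset.sum_range_succ', hq0, hqw, hqz 0 (by omega),
    hqz n le_rfl] at key
  rw [Finset.sum_congr rfl fun i hi => by
    rw [hqz i (by have := Finset.mem_range.1 hi; omega),
      hqz (i + 1) (by have := Finset.mem_range.1 hi; omega)]] at key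
  simp only [Nat.add_sub_cancel]
  linarith


end
end

section
/- Let u, v, w ∈ ℝ² be affinely independent points, and let z be a point of the closed triangle conv{u, v, w} with z ≠ v. Then dist(u, z) + dist(z, w) < dist(u, v) + dist(v, w); that is, replacing the apex v of the two-segment path u→v→w by any other point of the triangle strictly decreases the path length. -/
/-!
Statement 12: replacing the apex `v` of the two-segment path `u → v → w` by any
other point of the closed triangle strictly decreases the path length.
-/

/-- In a strictly convex space, the middle point of an affinely independent triple makes the
triangle inequality strict. -/
lemma dist_lt_dist_add_dist_of_affineIndependent {V : Type*} [NormedAddCommGroup V]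
    [NormedSpace ℝ V] [StrictConvexSpace ℝ V] {u v w : V}
    (h : AffineIndependent ℝ ![u, v, w]) : dist u w < dist u v + dist v w := by
  refine (dist_triangle u v w).lt_of_ne fun heq => ?_
  exact affineIndependent_iff_not_collinear_set.1 h (dist_add_dist_eq_iff.1 heq.symm).collinear

/-- The sum of the distances to two fixed points is a convex function. -/
lemma convexOn_dist_add_dist {V : Type*} [NormedAddCommGroup V] [NormedSpace ℝ V] (u w : V) :
    ConvexOn ℝ Set.univ fun x => dist u x + dist x w := by
  simp only [dist_comm u]
  exact (convexOn_univ_dist u).add (convexOn_univ_dist w)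

/-- Let `u, v, w ∈ ℝ²` be affinely independent and let `z` be a
point of the closed triangle `conv {u, v, w}` with `z ≠ v`.  Then
`dist u z + dist z w < dist u v + dist v w`. -/
theorem apex_replacement_strictly_shorter (u v w z : EuclideanSpace ℝ (Fin 2))
    (h : AffineIndependent ℝ ![u, v, w])
    (hz : z ∈ convexHull ℝ ({u, v, w} : Set (EuclideanSpace ℝ (Fin 2))))
    (hzv : z ≠ v) :
    dist u z + dist z w < dist u v + dist v w := by
  have htri := dist_lt_dist_add_dist_of_affineIndependent h
  rw [Set.insert_comm, convexHull_insert (Set.insert_nonempty u {w}), convexHull_pair,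
    mem_convexJoin] at hz
  obtain ⟨v', hv, q, hq, a, b, ha, hb, hab, rfl⟩ := hz
  obtain rfl : v' = v := hv
  have hconv := (convexOn_dist_add_dist u w).2 (Set.mem_univ v') (Set.mem_univ q) ha hb hab
  have hq' : dist u q + dist q w = dist u w := dist_add_dist_of_mem_segment hq
  have hb_pos : 0 < b := by
    refine hb.lt_of_ne fun hb0 => hzv ?_
    obtain rfl : a = 1 := by linarith
    simp [← hb0]
  simp only [smul_eq_mul, hq'] at hconv
  refine hconv.trans_lt ?_
  obtain rfl : a = 1 - b := by linarith
  nlinarith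
end
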